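/- arXiv:2305.11836 — 6 statements merged into one kernel-verified Lean document; each statement's English description precedes it below -/
import Mathlib

section
/- Pucci extremal operator on pure power functions (identities (3.2)/(4.2)). Let N ≥ 2, α ∈ (0,1), 0 < λ ≤ Λ, and β ∈ (−2α, N). Define u_β(x) = |x|^{−β} for x ≠ 0 and u_β(0) = 0. Then: (a) for every x ≠ 0 the function y ↦ S₊(δ(u_β, x, y)) |y|^{−(N+2α)} is Lebesgue integrable on ℝ^N; (b) for any two unit vectors e, e′ ∈ S^{N−1} the corresponding integrals at x = e and x = e′ coincide, so c(β) := ∫_{ℝ^N} S₊(δ(u_β, e₁, y)) |y|^{−(N+2α)} dy (e₁ the first standard basis vector) is well defined; and (c) for every x ≠ 0, ∫_{ℝ^N} S₊(δ(u_β, x, y)) |y|^{−(N+2α)} dy = c(β) |x|^{−β−2α}. -/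
open MeasureTheory Classical

/-- The nonlocal second difference `δ(u,x,y) = u(x+y) + u(x-y) - 2u(x)`. -/
noncomputable def nlD {N : ℕ} (u : EuclideanSpace ℝ (Fin N) → ℝ)
    (x y : EuclideanSpace ℝ (Fin N)) : ℝ :=
  u (x + y) + u (x - y) - 2 * u x

/-- `S₊(t) = Λ t⁺ - λ t⁻`. -/
noncomputable def Splus (l L t : ℝ) : ℝ := L * max t 0 - l * max (-t) 0

/-- The pure power function `u_β(x) = |x|^{-β}`, `u_β(0) = 0`. -/
noncomputable def upow {N : ℕ} (β : ℝ) (x : EuclideanSpace ℝ (Fin N)) : ℝ :=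
  if x = 0 then 0 else ‖x‖ ^ (-β)

open Topology

lemma aux_near {N : ℕ} (hN : 2 ≤ N) (p ε : ℝ) (hp : -(N : ℝ) < p) (hε : 0 < ε) :
    IntegrableOn (fun y : EuclideanSpace ℝ (Fin N) => ‖y‖ ^ p) (Metric.ball 0 ε) := by
  have : Nontrivial (EuclideanSpace ℝ (Fin N)) := by
    apply Module.nontrivial_of_finrank_pos (R := ℝ)
    simp; omega
  rw [← integrable_indicator_iff measurableSet_ball]
  have h := (integrable_fun_norm_addHaar (volume : Measure (EuclideanSpace ℝ (Fin N)))
    (f := (Set.Iio ε).indicator (fun t : ℝ => t ^ p))).2 ?_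
  · refine h.congr (Filter.Eventually.of_forall fun y => ?_)
    simp [Set.indicator]
  · have h2 : IntegrableOn (fun t : ℝ => t ^ ((N : ℝ) - 1 + p)) (Set.Ioo 0 ε) :=
      (intervalIntegral.integrableOn_Ioo_rpow_iff hε).2 (by linarith)
    have h3 : IntegrableOn ((Set.Iio ε).indicator (fun t : ℝ => t ^ ((N : ℝ) - 1 + p)))
        (Set.Ioi 0) := by
      rw [IntegrableOn, integrable_indicator_iff measurableSet_Iio, IntegrableOn,
        Measure.restrict_restrict measurableSet_Iio, Set.inter_comm, Set.Ioi_inter_Iio]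
      exact h2
    refine h3.congr_fun (fun t ht => ?_) measurableSet_Ioi
    have ht : 0 < t := ht
    by_cases h : t < ε
    · simp only [Set.indicator, Set.mem_Iio, h, if_true, finrank_euclideanSpace, Fintype.card_fin,
        smul_eq_mul]
      rw [Real.rpow_add ht, ← Real.rpow_natCast, Nat.cast_sub (by omega)]
      simp
    · simp [Set.indicator, h]

lemma aux_far {N : ℕ} (hN : 2 ≤ N) (p ε : ℝ) (hp : p < -(N : ℝ)) (hε : 0 < ε) :
    IntegrableOn (fun y : EuclideanSpace ℝ (Fin N) => ‖y‖ ^ p) (Metric.ball 0 ε)ᶜ := by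
  have : Nontrivial (EuclideanSpace ℝ (Fin N)) := by
    apply Module.nontrivial_of_finrank_pos (R := ℝ)
    simp; omega
  rw [← integrable_indicator_iff measurableSet_ball.compl]
  have h := (integrable_fun_norm_addHaar (volume : Measure (EuclideanSpace ℝ (Fin N)))
    (f := (Set.Ici ε).indicator (fun t : ℝ => t ^ p))).2 ?_
  · refine h.congr (Filter.Eventually.of_forall fun y => ?_)
    simp [Set.indicator]
  · have h2 : IntegrableOn (fun t : ℝ => t ^ ((N : ℝ) - 1 + p)) (Set.Ici ε) :=
      (integrableOn_Ici_iff_integrableOn_Ioi).2 (integrableOn_Ioi_rpow_of_lt (by linarith) hε)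
    have h3 : IntegrableOn ((Set.Ici ε).indicator (fun t : ℝ => t ^ ((N : ℝ) - 1 + p)))
        (Set.Ioi 0) :=
      ((integrable_indicator_iff measurableSet_Ici).2 h2).integrableOn
    refine h3.congr_fun (fun t ht => ?_) measurableSet_Ioi
    have ht : 0 < t := ht
    by_cases h : ε ≤ t
    · simp only [Set.indicator, Set.mem_Ici, h, if_true, finrank_euclideanSpace, Fintype.card_fin,
        smul_eq_mul]
      rw [Real.rpow_add ht, ← Real.rpow_natCast, Nat.cast_sub (by omega)]
      simp
    · simp [Set.indicator, h]

lemma aux_upow_meas {N : ℕ} (β : ℝ) :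
    Measurable (upow β : EuclideanSpace ℝ (Fin N) → ℝ) := by
  unfold upow
  exact Measurable.ite (measurableSet_singleton 0) measurable_const
    (measurable_norm.pow_const _)

lemma aux_upow_nonneg {N : ℕ} (β : ℝ) (x : EuclideanSpace ℝ (Fin N)) : 0 ≤ upow β x := by
  unfold upow
  split_ifs <;> positivity

lemma aux_upow_le {N : ℕ} (β : ℝ) (x : EuclideanSpace ℝ (Fin N)) : upow β x ≤ ‖x‖ ^ (-β) := by
  unfold upow
  split_ifs
  · positivity
  · rfl

lemma aux_shift {N : ℕ} (hN : 2 ≤ N) (α β ε : ℝ) (hα : 0 < α) (hβ : -(2 * α) < β)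
    (hβN : β < N) (hε : 0 < ε) (x : EuclideanSpace ℝ (Fin N)) :
    IntegrableOn (fun y => upow β (x + y) * ‖y‖ ^ (-((N : ℝ) + 2 * α))) (Metric.ball 0 ε)ᶜ := by
  have hm : AEStronglyMeasurable (fun y : EuclideanSpace ℝ (Fin N) =>
      upow β (x + y) * ‖y‖ ^ (-((N : ℝ) + 2 * α)))
      (volume.restrict (Metric.ball 0 ε)ᶜ) :=
    (((aux_upow_meas β).comp (measurable_const_add x)).mul
      (measurable_norm.pow_const _)).aestronglyMeasurable
  rcases le_or_gt β 0 with hb | hb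
  · have hd := (aux_far hN (-β - ((N : ℝ) + 2 * α)) ε (by linarith) hε).const_mul
      ((‖x‖ / ε + 1) ^ (-β))
    refine Integrable.mono' hd hm ?_
    refine (ae_restrict_iff' measurableSet_ball.compl).2 (Filter.Eventually.of_forall fun y hy => ?_)
    have hy : ε ≤ ‖y‖ := by simpa using hy
    have hy0 : 0 < ‖y‖ := hε.trans_le hy
    rw [Real.norm_of_nonneg (mul_nonneg (aux_upow_nonneg _ _) (by positivity)),
      sub_eq_add_neg, Real.rpow_add hy0, ← mul_assoc,
      ← Real.mul_rpow (by positivity) hy0.le]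
    refine mul_le_mul_of_nonneg_right ((aux_upow_le _ _).trans ?_) (by positivity)
    refine Real.rpow_le_rpow (norm_nonneg _) ((norm_add_le _ _).trans ?_) (by linarith)
    have : ‖x‖ ≤ ‖x‖ / ε * ‖y‖ := by
      rw [div_mul_eq_mul_div, le_div_iff₀ hε]
      exact mul_le_mul_of_nonneg_left hy (norm_nonneg _)
    linarith
  · have h1 := (integrable_indicator_iff measurableSet_ball).2
      (aux_near hN (-β) 1 (by linarith) one_pos)
    have h2 := (h1.comp_add_left x).const_mul (ε ^ (-((N : ℝ) + 2 * α)))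
    have h3 := aux_far hN (-((N : ℝ) + 2 * α)) ε (by linarith) hε
    refine Integrable.mono' (h2.integrableOn.add h3) hm ?_
    refine (ae_restrict_iff' measurableSet_ball.compl).2 (Filter.Eventually.of_forall fun y hy => ?_)
    have hy : ε ≤ ‖y‖ := by simpa using hy
    have hy0 : 0 < ‖y‖ := hε.trans_le hy
    rw [Real.norm_of_nonneg (mul_nonneg (aux_upow_nonneg _ _) (by positivity))]
    simp only [Pi.add_apply]
    have hw : ‖y‖ ^ (-((N : ℝ) + 2 * α)) ≤ ε ^ (-((N : ℝ) + 2 * α)) :=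
      Real.rpow_le_rpow_of_nonpos hε hy (by have : (0:ℝ) ≤ N := by positivity
                                            linarith)
    have hw0 : 0 ≤ ‖y‖ ^ (-((N : ℝ) + 2 * α)) := by positivity
    by_cases hxy : ‖x + y‖ < 1
    · have : x + y ∈ Metric.ball (0 : EuclideanSpace ℝ (Fin N)) 1 := by simpa using hxy
      rw [Set.indicator_of_mem this]
      have := mul_le_mul (aux_upow_le β (x + y)) hw hw0 (by positivity)
      linarith
    · have : x + y ∉ Metric.ball (0 : EuclideanSpace ℝ (Fin N)) 1 := by simpa using hxy
      rw [Set.indicator_of_notMem this]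
      have := mul_le_mul_of_nonneg_right ((aux_upow_le β (x + y)).trans
        (Real.rpow_le_one_of_one_le_of_nonpos (not_lt.1 hxy) (by linarith))) hw0
      linarith

lemma aux_taylor {N : ℕ} (β : ℝ) (x : EuclideanSpace ℝ (Fin N)) (hx : x ≠ 0) :
    ∃ C ε : ℝ, 0 ≤ C ∧ 0 < ε ∧ ∀ y : EuclideanSpace ℝ (Fin N), ‖y‖ < ε →
      |nlD (upow β) x y| ≤ C * ‖y‖ ^ 2 := by
  have hc : ContDiffAt ℝ 2 (upow β : EuclideanSpace ℝ (Fin N) → ℝ) x := by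
    have h1 : ContDiffAt ℝ 2 (fun z : EuclideanSpace ℝ (Fin N) => ‖z‖ ^ (-β)) x :=
      (contDiffAt_norm ℝ hx).rpow_const_of_ne (norm_ne_zero_iff.2 hx)
    refine h1.congr_of_eventuallyEq ?_
    filter_upwards [isOpen_ne.mem_nhds hx] with z hz
    have hz : z ≠ 0 := hz
    simp [upow, hz]
  obtain ⟨K, t, ht, hK⟩ := (hc.fderiv_right (m := 1) (by norm_num)).exists_lipschitzOnWith
  have hd : ∀ᶠ z in 𝓝 x, DifferentiableAt ℝ (upow β : EuclideanSpace ℝ (Fin N) → ℝ) z :=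
    (hc.eventually (by simp)).mono fun z hz => hz.differentiableAt (by norm_num)
  obtain ⟨ε, hε, hs⟩ := Metric.mem_nhds_iff.1 (Filter.inter_mem ht hd)
  refine ⟨2 * K, ε, by positivity, hε, fun y hy => ?_⟩
  have mem : ∀ z ∈ Metric.closedBall (0 : EuclideanSpace ℝ (Fin N)) ‖y‖,
      x + z ∈ Metric.ball x ε ∧ x - z ∈ Metric.ball x ε := by
    intro z hz
    have hz : ‖z‖ ≤ ‖y‖ := by simpa using hz
    simp [dist_eq_norm]
    exact hz.trans_lt hy
  have hmv := Convex.norm_image_sub_le_of_norm_hasFDerivWithin_le (𝕜 := ℝ)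
    (f := nlD (upow β) x)
    (f' := fun z => fderiv ℝ (upow β) (x + z) - fderiv ℝ (upow β) (x - z))
    (s := Metric.closedBall (0 : EuclideanSpace ℝ (Fin N)) ‖y‖) (C := 2 * K * ‖y‖)
    (x := 0) (y := y) ?_ ?_ (convex_closedBall _ _) (by simp) (by simp)
  · have h0 : nlD (upow β) x 0 = 0 := by simp [nlD]; ring
    rw [h0, sub_zero, sub_zero, Real.norm_eq_abs] at hmv
    linarith [hmv]
  · intro z hz
    obtain ⟨m1, m2⟩ := mem z hz
    have d1 : HasFDerivAt (fun z => upow β (x + z)) (fderiv ℝ (upow β) (x + z)) z := by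
      have := (hs m1).2.hasFDerivAt.comp z ((hasFDerivAt_id z).const_add x)
      simp only [ContinuousLinearMap.comp_neg, ContinuousLinearMap.comp_id] at this
      exact this
    have d2 : HasFDerivAt (fun z => upow β (x - z)) (-fderiv ℝ (upow β) (x - z)) z := by
      have := (hs m2).2.hasFDerivAt.comp z ((hasFDerivAt_id z).const_sub x)
      simp only [ContinuousLinearMap.comp_neg, ContinuousLinearMap.comp_id] at this
      exact this
    have := (d1.add d2).sub_const (2 * upow β x)
    rw [← sub_eq_add_neg] at this
    exact this.hasFDerivWithinAt
  · intro z hz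
    obtain ⟨m1, m2⟩ := mem z hz
    have hz : ‖z‖ ≤ ‖y‖ := by simpa using hz
    have := hK.norm_sub_le (hs m1).1 (hs m2).1
    refine this.trans ?_
    have e : x + z - (x - z) = (2 : ℝ) • z := by rw [two_smul]; abel
    rw [e, norm_smul]
    simp only [Real.norm_ofNat]
    have : (0 : ℝ) ≤ K := K.2
    nlinarith

lemma aux_splus_abs (l L t : ℝ) (hl : 0 < l) (hlL : l ≤ L) : |Splus l L t| ≤ L * |t| := by
  unfold Splus
  rcases le_total t 0 with h | h
  · rw [max_eq_right h, max_eq_left (by linarith), abs_of_nonpos h, abs_le]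
    constructor <;> nlinarith
  · rw [max_eq_left h, max_eq_right (by linarith), abs_of_nonneg h, abs_le]
    constructor <;> nlinarith

lemma aux_splus_mul (l L c t : ℝ) (hc : 0 ≤ c) : Splus l L (c * t) = c * Splus l L t := by
  unfold Splus
  rw [show max (c * t) 0 = c * max t 0 by rw [mul_max_of_nonneg _ _ hc, mul_zero],
    show max (-(c * t)) 0 = c * max (-t) 0 by rw [mul_max_of_nonneg _ _ hc, mul_zero, mul_neg]]
  ring

lemma aux_integrable {N : ℕ} (hN : 2 ≤ N) (α l L β : ℝ)
    (hα : α ∈ Set.Ioo (0 : ℝ) 1) (hl : 0 < l) (hlL : l ≤ L)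
    (hβ : β ∈ Set.Ioo (-(2 * α)) (N : ℝ)) (x : EuclideanSpace ℝ (Fin N)) (hx : x ≠ 0) :
    Integrable (fun y => Splus l L (nlD (upow β) x y) * ‖y‖ ^ (-((N : ℝ) + 2 * α))) := by
  obtain ⟨C, ε, hC, hε, hT⟩ := aux_taylor β x hx
  have hmD : Measurable (nlD (upow β) x) := by
    unfold nlD
    exact (((aux_upow_meas β).comp (measurable_const_add x)).add
      ((aux_upow_meas β).comp (measurable_const.sub measurable_id))).sub_const _
  have hmw : Measurable (fun y : EuclideanSpace ℝ (Fin N) => ‖y‖ ^ (-((N : ℝ) + 2 * α))) :=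
    measurable_norm.pow_const _
  have hD : Integrable (fun y => nlD (upow β) x y * ‖y‖ ^ (-((N : ℝ) + 2 * α))) := by
    rw [← integrableOn_univ, ← Set.union_compl_self (Metric.ball 0 ε)]
    refine IntegrableOn.union ?_ ?_
    · have h1 := (aux_near hN (2 - ((N : ℝ) + 2 * α)) ε (by linarith [hα.2]) hε).const_mul C
      refine Integrable.mono' h1 (hmD.mul hmw).aestronglyMeasurable ?_
      refine (ae_restrict_iff' measurableSet_ball).2 (Filter.Eventually.of_forall fun y hy => ?_)
      have hy : ‖y‖ < ε := by simpa using hy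
      rcases eq_or_ne y 0 with rfl | hy0
      · have h0 : nlD (upow β) x 0 = 0 := by simp [nlD]; ring
        rw [h0, zero_mul, norm_zero]
        positivity
      · have hy0 : 0 < ‖y‖ := norm_pos_iff.2 hy0
        rw [norm_mul, Real.norm_eq_abs, Real.norm_of_nonneg (by positivity : 0 ≤ ‖y‖ ^ (-((N : ℝ) + 2 * α))), sub_eq_add_neg, Real.rpow_add hy0, ← mul_assoc]
        refine mul_le_mul_of_nonneg_right ?_ (by positivity)
        have := hT y hy
        simpa using this
    · have h1 := aux_shift hN α β ε hα.1 hβ.1 hβ.2 hε x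
      have h2 := aux_shift hN α β ε hα.1 hβ.1 hβ.2 hε (-x)
      have h3 := (aux_far hN (-((N : ℝ) + 2 * α)) ε (by linarith [hα.1]) hε).const_mul
        (2 * upow β x)
      refine ((h1.add h2).sub h3).congr (Filter.Eventually.of_forall fun y => ?_)
      have : upow β (-x + y) = upow β (x - y) := by
        have e : -x + y = -(x - y) := by abel
        rw [e]; simp only [upow, norm_neg, neg_eq_zero]
      simp only [Pi.add_apply, Pi.sub_apply, nlD, this]
      ring
  refine Integrable.mono' (hD.norm.const_mul L) ?_ (Filter.Eventually.of_forall fun y => ?_)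
  · refine Measurable.aestronglyMeasurable (Measurable.mul ?_ hmw)
    unfold Splus
    exact ((hmD.max measurable_const).const_mul _).sub
      ((hmD.neg.max measurable_const).const_mul _)
  · rw [norm_mul, norm_mul, ← mul_assoc]
    exact mul_le_mul_of_nonneg_right (aux_splus_abs l L _ hl hlL) (norm_nonneg _)

lemma aux_rot {N : ℕ} (α l L β : ℝ) (e e' : EuclideanSpace ℝ (Fin N)) (h : ‖e‖ = ‖e'‖) :
    ∫ y, Splus l L (nlD (upow β) e y) * ‖y‖ ^ (-((N : ℝ) + 2 * α))
      = ∫ y, Splus l L (nlD (upow β) e' y) * ‖y‖ ^ (-((N : ℝ) + 2 * α)) := by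
  obtain ⟨R, hR⟩ : ∃ R : EuclideanSpace ℝ (Fin N) ≃ₗᵢ[ℝ] EuclideanSpace ℝ (Fin N), R e = e' :=
    ⟨_, Submodule.reflection_sub h⟩
  have hu : ∀ z, upow β (R z) = upow β z := by
    intro z
    simp [upow]
  rw [← R.measurePreserving.integral_comp R.toHomeomorph.measurableEmbedding
    (fun y => Splus l L (nlD (upow β) e' y) * ‖y‖ ^ (-((N : ℝ) + 2 * α)))]
  congr 1
  ext y
  simp only [nlD, ← hR, ← map_add, ← map_sub, hu, R.norm_map]

lemma aux_scale {N : ℕ} (α l L β r : ℝ) (hr : 0 < r) (e : EuclideanSpace ℝ (Fin N)) :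
    ∫ y, Splus l L (nlD (upow β) (r • e) y) * ‖y‖ ^ (-((N : ℝ) + 2 * α))
      = (∫ y, Splus l L (nlD (upow β) e y) * ‖y‖ ^ (-((N : ℝ) + 2 * α)))
        * r ^ (-β - 2 * α) := by
  have hu : ∀ z : EuclideanSpace ℝ (Fin N), upow β (r • z) = r ^ (-β) * upow β z := by
    intro z
    by_cases hz : z = 0
    · simp [upow, hz]
    · simp [upow, hz, hr.ne', norm_smul, abs_of_pos hr, Real.mul_rpow hr.le (norm_nonneg z)]
  have hs := Measure.integral_comp_smul (volume : Measure (EuclideanSpace ℝ (Fin N)))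
    (fun y => Splus l L (nlD (upow β) (r • e) y) * ‖y‖ ^ (-((N : ℝ) + 2 * α))) r
  have hp : ∀ y : EuclideanSpace ℝ (Fin N),
      Splus l L (nlD (upow β) (r • e) (r • y)) * ‖r • y‖ ^ (-((N : ℝ) + 2 * α))
      = (r ^ (-β) * r ^ (-((N : ℝ) + 2 * α))) *
        (Splus l L (nlD (upow β) e y) * ‖y‖ ^ (-((N : ℝ) + 2 * α))) := by
    intro y
    have : nlD (upow β) (r • e) (r • y) = r ^ (-β) * nlD (upow β) e y := by
      simp only [nlD, ← smul_add, ← smul_sub, hu]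
      ring
    rw [this, aux_splus_mul _ _ _ _ (by positivity), norm_smul, Real.norm_of_nonneg hr.le,
      Real.mul_rpow hr.le (norm_nonneg y)]
    ring
  simp only [hp] at hs
  rw [integral_const_mul, finrank_euclideanSpace, Fintype.card_fin, smul_eq_mul,
    abs_of_pos (by positivity), inv_mul_eq_div, eq_div_iff (by positivity)] at hs
  rw [← hs, ← Real.rpow_natCast r N]
  have : r ^ (-β - 2 * α) = r ^ (-β) * r ^ (-((N : ℝ) + 2 * α)) * r ^ (N : ℝ) := by
    rw [← Real.rpow_add hr, ← Real.rpow_add hr]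
    congr 1; ring
  rw [this]; ring

/-- Pucci maximal operator on pure power functions: integrability and the
identity `M⁺(|x|^{-β}) = c(β)|x|^{-β-2α}`. -/
theorem pucci_on_power_functions
    (N : ℕ) (hN : 2 ≤ N) (α l L β : ℝ)
    (hα : α ∈ Set.Ioo (0 : ℝ) 1) (hl : 0 < l) (hlL : l ≤ L)
    (hβ : β ∈ Set.Ioo (-(2 * α)) (N : ℝ)) :
    (∀ x : EuclideanSpace ℝ (Fin N), x ≠ 0 →
      Integrable (fun y => Splus l L (nlD (upow β) x y) * ‖y‖ ^ (-((N : ℝ) + 2 * α)))) ∧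
    (∀ e e' : EuclideanSpace ℝ (Fin N), ‖e‖ = 1 → ‖e'‖ = 1 →
      ∫ y, Splus l L (nlD (upow β) e y) * ‖y‖ ^ (-((N : ℝ) + 2 * α))
        = ∫ y, Splus l L (nlD (upow β) e' y) * ‖y‖ ^ (-((N : ℝ) + 2 * α))) ∧
    (∀ x : EuclideanSpace ℝ (Fin N), x ≠ 0 →
      ∫ y, Splus l L (nlD (upow β) x y) * ‖y‖ ^ (-((N : ℝ) + 2 * α))
        = (∫ y, Splus l L
              (nlD (upow β) (EuclideanSpace.single (⟨0, by omega⟩ : Fin N) 1) y)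
              * ‖y‖ ^ (-((N : ℝ) + 2 * α)))
          * ‖x‖ ^ (-β - 2 * α)) := by
  refine ⟨fun x hx => aux_integrable hN α l L β hα hl hlL hβ x hx,
    fun e e' he he' => aux_rot α l L β e e' (he.trans he'.symm), fun x hx => ?_⟩
  have hr : 0 < ‖x‖ := norm_pos_iff.2 hx
  rw [← aux_scale α l L β ‖x‖ hr]
  apply aux_rot
  simp [norm_smul]
end

section
/- Strict convexity of the homogeneity exponent function (from the proof of Lemma 4.1). Let N ≥ 2, α ∈ (0,1), 0 < λ ≤ Λ. Let f : S^{N−1} → ℝ be C² with f ≥ 0 and f not identically zero, let e ∈ S^{N−1}, and let κ : ℝ^N → [λ, Λ] be measurable. For β ∈ (−2α, N) set δ_β(y) = f((e+y)/|e+y|) |e+y|^{−β} + f((e−y)/|e−y|) |e−y|^{−β} − 2 f(e) (defined for y ≠ ±e) and c(β) = ∫_{ℝ^N} κ(y) δ_β(y) |y|^{−(N+2α)} dy. Then for every β ∈ (−2α, N) the function y ↦ κ(y) δ_β(y) |y|^{−(N+2α)} is Lebesgue integrable on ℝ^N, and the map β ↦ c(β) is strictly convex on the interval (−2α, N). -/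
open MeasureTheory

lemma int_ball {N : ℕ} (hN : 2 ≤ N) (r s : ℝ) (hr : 0 < r) (hs : -(N:ℝ) < s) :
    Integrable (fun y : (EuclideanSpace ℝ (Fin N)) => (Set.Iio r).indicator (fun t : ℝ => t ^ s) ‖y‖) := by
  have : Nontrivial (EuclideanSpace ℝ (Fin N)) := by
    have : Nonempty (Fin N) := ⟨⟨0, by omega⟩⟩
    infer_instance
  rw [integrable_fun_norm_addHaar (volume : Measure (EuclideanSpace ℝ (Fin N))) (f := (Set.Iio r).indicator (fun t : ℝ => t ^ s))]
  have h1 : IntegrableOn (fun t : ℝ => t ^ ((N:ℝ) - 1 + s)) (Set.Ioo 0 r) := by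
    rw [intervalIntegral.integrableOn_Ioo_rpow_iff hr]; linarith
  have h2 : IntegrableOn ((Set.Ioo 0 r).indicator (fun t : ℝ => t ^ ((N:ℝ) - 1 + s))) (Set.Ioi 0) :=
    ((integrable_indicator_iff measurableSet_Ioo).2 h1).integrableOn
  refine h2.congr_fun (fun t ht => ?_) measurableSet_Ioi
  have ht : 0 < t := ht
  by_cases h : t < r
  · simp only [Set.indicator, Set.mem_Ioo, ht, h, Set.mem_Iio, if_true, and_self, smul_eq_mul, finrank_euclideanSpace, Fintype.card_fin]
    rw [Real.rpow_add ht, ← Real.rpow_natCast, Nat.cast_sub (by omega), Nat.cast_one]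
  · simp [Set.indicator, h]

lemma int_compl {N : ℕ} (hN : 2 ≤ N) (r s : ℝ) (hr : 0 < r) (hs : s < -(N:ℝ)) :
    Integrable (fun y : (EuclideanSpace ℝ (Fin N)) => (Set.Ici r).indicator (fun t : ℝ => t ^ s) ‖y‖) := by
  have : Nontrivial (EuclideanSpace ℝ (Fin N)) := by
    have : Nonempty (Fin N) := ⟨⟨0, by omega⟩⟩
    infer_instance
  rw [integrable_fun_norm_addHaar (volume : Measure (EuclideanSpace ℝ (Fin N))) (f := (Set.Ici r).indicator (fun t : ℝ => t ^ s))]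
  have h1 : IntegrableOn (fun t : ℝ => t ^ ((N:ℝ) - 1 + s)) (Set.Ici r) := by
    rw [integrableOn_Ici_iff_integrableOn_Ioi]
    exact integrableOn_Ioi_rpow_of_lt (by linarith) hr
  have h2 : IntegrableOn ((Set.Ici r).indicator (fun t : ℝ => t ^ ((N:ℝ) - 1 + s))) (Set.Ioi 0) :=
    ((integrable_indicator_iff measurableSet_Ici).2 h1).integrableOn
  refine h2.congr_fun (fun t ht => ?_) measurableSet_Ioi
  have ht : 0 < t := ht
  by_cases h : r ≤ t
  · simp only [Set.indicator, Set.mem_Ici, h, if_true, smul_eq_mul, finrank_euclideanSpace, Fintype.card_fin]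
    rw [Real.rpow_add ht, ← Real.rpow_natCast, Nat.cast_sub (by omega), Nat.cast_one]
  · simp [Set.indicator, h]

lemma second_diff {N : ℕ} (h : (EuclideanSpace ℝ (Fin N)) → ℝ) (hh : ContDiffAt ℝ 2 h 0) :
    ∃ C r : ℝ, 0 ≤ C ∧ 0 < r ∧ ∀ y : (EuclideanSpace ℝ (Fin N)), ‖y‖ < r → |h y + h (-y) - 2 * h 0| ≤ C * ‖y‖ ^ 2 := by
  have h1 : ContDiffAt ℝ 1 (fderiv ℝ h) 0 := hh.fderiv_right (by norm_num)
  obtain ⟨K, t, ht, hK⟩ := h1.exists_lipschitzOnWith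
  have h2 : ∀ᶠ y in nhds (0:(EuclideanSpace ℝ (Fin N))), DifferentiableAt ℝ h y :=
    (hh.eventually (by simp)).mono fun y hy => hy.differentiableAt (by norm_num)
  obtain ⟨r, hr, hb⟩ := Metric.eventually_nhds_iff_ball.1 (h2.and ht)
  refine ⟨2 * K, r, by positivity, hr, fun y hy => ?_⟩
  have key := (convex_closedBall (0:(EuclideanSpace ℝ (Fin N))) ‖y‖).norm_image_sub_le_of_norm_hasFDerivWithin_le
    (f := fun z => h z + h (-z)) (f' := fun z => fderiv ℝ h z + (fderiv ℝ h (-z)).comp (-ContinuousLinearMap.id ℝ (EuclideanSpace ℝ (Fin N))))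
    (C := 2 * K * ‖y‖) (x := 0) (y := y) ?_ ?_ (by simp) (by simp)
  · simp only [Real.norm_eq_abs, neg_zero, sub_zero] at key
    calc _ = |h y + h (-y) - (h 0 + h 0)| := by ring_nf
      _ ≤ _ := key
      _ = _ := by ring
  · intro z hz
    have hz' : ‖z‖ < r := lt_of_le_of_lt (by simpa using hz) hy
    have a := (hb z (by simpa using hz')).1.hasFDerivAt
    have b := (hb (-z) (by simpa using hz')).1.hasFDerivAt
    exact (a.add (b.comp z (hasFDerivAt_id z).neg)).hasFDerivWithinAt
  · intro z hz
    have hz1 : ‖z‖ ≤ ‖y‖ := by simpa using hz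
    have hz' : ‖z‖ < r := lt_of_le_of_lt hz1 hy
    have := hK.norm_sub_le (hb z (by simpa using hz')).2 (hb (-z) (by simpa using hz')).2
    have e1 : fderiv ℝ h z + (fderiv ℝ h (-z)).comp (-ContinuousLinearMap.id ℝ (EuclideanSpace ℝ (Fin N))) = fderiv ℝ h z - fderiv ℝ h (-z) := by
      ext; simp [sub_eq_add_neg]
    rw [e1]
    refine this.trans ?_
    rw [sub_neg_eq_add, ← two_smul ℝ z, norm_smul]
    have : (0:ℝ) ≤ K := K.2
    simp only [Real.norm_ofNat]
    nlinarith

lemma term_int {N : ℕ} (hN : 2 ≤ N) (a r β : ℝ) (ha : 0 < a) (hr : 0 < r) (hβ : -a < β) (hβ' : β < N)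
    (e : (EuclideanSpace ℝ (Fin N))) (he : ‖e‖ = 1) :
    Integrable (fun y : (EuclideanSpace ℝ (Fin N)) => (Set.Ici r).indicator (fun t : ℝ => t ^ (-((N:ℝ) + a))) ‖y‖ * ‖e + y‖ ^ (-β)) := by
  set b := max (-β) 0 with hb
  have hb0 : 0 ≤ b := le_max_right _ _
  have hba : b < a := max_lt (by linarith) ha
  have i1 := (int_ball hN 1 (-β) one_pos (by linarith)).comp_add_left e
  have i2 := int_compl hN r (b - (N + a)) hr (by linarith)
  refine ((i1.const_mul (r ^ (-((N:ℝ) + a)))).add (i2.const_mul ((1 / r + 1) ^ b))).mono' ?_ ?_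
  · refine Measurable.aestronglyMeasurable ?_
    have : Measurable ((Set.Ici r).indicator (fun t : ℝ => t ^ (-((N:ℝ) + a)))) :=
      Measurable.indicator (by fun_prop) measurableSet_Ici
    fun_prop
  · refine Filter.Eventually.of_forall fun y => ?_
    simp only [Pi.add_apply]
    by_cases hy : r ≤ ‖y‖
    · have hy0 : 0 < ‖y‖ := hr.trans_le hy
      simp only [Set.indicator, Set.mem_Ici, hy, if_true, Set.mem_Iio]
      rw [Real.norm_of_nonneg (by positivity)]
      by_cases h1 : ‖e + y‖ < 1
      · simp only [h1, if_true]
        have : ‖y‖ ^ (-((N:ℝ) + a)) ≤ r ^ (-((N:ℝ) + a)) :=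
          Real.rpow_le_rpow_of_nonpos hr hy (by have : (0:ℝ) ≤ N := by positivity
                                                linarith)
        have h3 : 0 ≤ (1 / r + 1) ^ b * ‖y‖ ^ (b - (↑N + a)) := by positivity
        have := mul_le_mul_of_nonneg_right this (Real.rpow_nonneg (norm_nonneg (e+y)) (-β))
        linarith
      · simp only [h1, if_false, mul_zero, zero_add]
        push Not at h1
        have h2 : ‖e + y‖ ^ (-β) ≤ ‖e + y‖ ^ b := Real.rpow_le_rpow_of_exponent_le h1 (le_max_left _ _)
        have h3 : ‖e + y‖ ≤ (1 / r + 1) * ‖y‖ := by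
          have := norm_add_le e y
          have h4 : 1 ≤ 1 / r * ‖y‖ := by rw [one_div, ← div_eq_inv_mul]; exact (one_le_div hr).2 hy
          linarith
        have h4 : ‖e + y‖ ^ b ≤ (1 / r + 1) ^ b * ‖y‖ ^ b := by
          rw [← Real.mul_rpow (by positivity) (by positivity)]
          exact Real.rpow_le_rpow (by positivity) h3 hb0
        have h5 : ‖y‖ ^ (b - (↑N + a)) = ‖y‖ ^ (-((N:ℝ) + a)) * ‖y‖ ^ b := by
          rw [← Real.rpow_add hy0]; congr 1; ring
        rw [h5]
        have := mul_le_mul_of_nonneg_left (h2.trans h4) (Real.rpow_nonneg (norm_nonneg y) (-((N:ℝ) + a)))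
        linarith
    · simp only [Set.indicator, Set.mem_Ici, hy, if_false, zero_mul, norm_zero, mul_zero, add_zero]
      split_ifs <;> positivity

lemma integrable_main {N : ℕ}
    (hN : 2 ≤ N) (α l L : ℝ)
    (hα : α ∈ Set.Ioo (0 : ℝ) 1) (hl : 0 < l)
    (f : (EuclideanSpace ℝ (Fin N)) → ℝ) (hf : ContDiff ℝ 2 f)
    (e : (EuclideanSpace ℝ (Fin N))) (he : ‖e‖ = 1) (κ : (EuclideanSpace ℝ (Fin N)) → ℝ)
    (hκ_meas : Measurable κ)
    (hκ_bnd : ∀ y, κ y ∈ Set.Icc l L) (β : ℝ) (hβ : β ∈ Set.Ioo (-(2 * α)) (N : ℝ)) :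
      Integrable (fun y : (EuclideanSpace ℝ (Fin N)) =>
        κ y * (f (‖e + y‖⁻¹ • (e + y)) * ‖e + y‖ ^ (-β)
              + f (‖e - y‖⁻¹ • (e - y)) * ‖e - y‖ ^ (-β)
              - 2 * f e)
          * ‖y‖ ^ (-((N : ℝ) + 2 * α))) := by
  obtain ⟨ha0, ha1⟩ := hα
  obtain ⟨hb0, hb1⟩ := hβ
  obtain ⟨M, hM⟩ := (isCompact_closedBall (0:(EuclideanSpace ℝ (Fin N))) 1).exists_bound_of_continuousOn hf.continuous.continuousOn
  have hM' : ∀ z : (EuclideanSpace ℝ (Fin N)), |f (‖z‖⁻¹ • z)| ≤ M := by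
    intro z
    refine hM _ ?_
    rw [mem_closedBall_zero_iff, norm_smul, norm_inv, norm_norm]
    exact inv_mul_le_one
  have hfe : |f e| ≤ M := hM e (by simp [he])
  have hM0 : 0 ≤ M := (abs_nonneg _).trans hfe
  have he0 : e ≠ 0 := by intro h; simp [h] at he
  have hC2 : ContDiffAt ℝ 2 (fun y : (EuclideanSpace ℝ (Fin N)) => f (‖e + y‖⁻¹ • (e + y)) * ‖e + y‖ ^ (-β)) 0 := by
    have h1 : ContDiffAt ℝ 2 (fun y : (EuclideanSpace ℝ (Fin N)) => e + y) 0 := by fun_prop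
    have h2 : ContDiffAt ℝ 2 (fun y : (EuclideanSpace ℝ (Fin N)) => ‖e + y‖) 0 := h1.norm ℝ (by simpa using he0)
    have h3 : ‖e + (0:(EuclideanSpace ℝ (Fin N)))‖ ≠ 0 := by simp [he]
    exact (hf.contDiffAt.comp (0:(EuclideanSpace ℝ (Fin N))) ((h2.inv h3).smul h1)).mul (h2.rpow_const_of_ne h3)
  obtain ⟨C, r, hC, hr, hCr⟩ := second_diff _ hC2
  simp only [add_zero, he, inv_one, one_smul, Real.one_rpow, mul_one, ← sub_eq_add_neg] at hCr
  have i0 := int_ball hN r (2 - (N + 2 * α)) hr (by linarith)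
  have i1 := term_int hN (2 * α) r β (by linarith) hr hb0 hb1 e he
  have i2 := term_int hN (2 * α) r β (by linarith) hr hb0 hb1 (-e) (by simpa using he)
  have i3 := int_compl hN r (-((N:ℝ) + 2 * α)) hr (by linarith)
  refine (((i0.const_mul C).add (((i1.add i2).const_mul M).add (i3.const_mul (2 * M)))).const_mul L).mono' ?_ ?_
  · refine Measurable.aestronglyMeasurable ?_
    have := hf.continuous.measurable
    fun_prop
  · have hne : ∀ᵐ y : (EuclideanSpace ℝ (Fin N)), y ≠ 0 := by
      have : Nontrivial (EuclideanSpace ℝ (Fin N)) := by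
        have : Nonempty (Fin N) := ⟨⟨0, by omega⟩⟩
        infer_instance
      simp [ae_iff]
    filter_upwards [hne] with y hy
    have hy0 : 0 < ‖y‖ := norm_pos_iff.2 hy
    obtain ⟨k1, k2⟩ := hκ_bnd y
    have hk : |κ y| ≤ L := by rw [abs_of_pos (hl.trans_le k1)]; exact k2
    rw [mul_assoc, norm_mul]
    refine mul_le_mul hk ?_ (norm_nonneg _) (by linarith)
    simp only [Pi.add_apply, Set.indicator, Set.mem_Ici, Set.mem_Iio]
    rw [norm_mul, Real.norm_of_nonneg (Real.rpow_nonneg (norm_nonneg y) _), Real.norm_eq_abs]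
    have hsym : ‖-e + y‖ = ‖e - y‖ := by rw [← norm_neg]; congr 1; abel
    rw [hsym]
    by_cases h : ‖y‖ < r
    · have h' : ¬ r ≤ ‖y‖ := not_le.2 h
      simp only [h, h', if_true, if_false, zero_mul, mul_zero, add_zero]
      have h5 : ‖y‖ ^ (2 - ((N:ℝ) + 2 * α)) = ‖y‖ ^ 2 * ‖y‖ ^ (-((N:ℝ) + 2 * α)) := by
        rw [← Real.rpow_natCast, ← Real.rpow_add hy0]; congr 1
      rw [h5, ← mul_assoc]
      exact mul_le_mul_of_nonneg_right (hCr y h) (by positivity)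
    · have h' : r ≤ ‖y‖ := not_lt.1 h
      simp only [h, h', if_true, if_false, mul_zero, zero_add]
      have : |f (‖e + y‖⁻¹ • (e + y)) * ‖e + y‖ ^ (-β)
              + f (‖e - y‖⁻¹ • (e - y)) * ‖e - y‖ ^ (-β)
              - 2 * f e| ≤ M * ‖e + y‖ ^ (-β) + M * ‖e - y‖ ^ (-β) + 2 * M := by
        have p1 := Real.rpow_nonneg (norm_nonneg (e + y)) (-β)
        have p2 := Real.rpow_nonneg (norm_nonneg (e - y)) (-β)
        refine (abs_sub _ _).trans (add_le_add ((abs_add_le _ _).trans (add_le_add ?_ ?_)) ?_)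
        · rw [abs_mul, abs_of_nonneg p1]
          exact mul_le_mul_of_nonneg_right (hM' _) p1
        · rw [abs_mul, abs_of_nonneg p2]
          exact mul_le_mul_of_nonneg_right (hM' _) p2
        · rw [abs_mul, abs_two]; linarith
      have := mul_le_mul_of_nonneg_right this (Real.rpow_nonneg (norm_nonneg y) (-((N:ℝ) + 2 * α)))
      linarith

lemma rpow_conv (t : ℝ) (ht : 0 < t) (x y a b : ℝ) (ha : 0 < a) (hb : 0 < b) (hab : a + b = 1) :
    t ^ (-(a * x + b * y)) ≤ a * t ^ (-x) + b * t ^ (-y) := by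
  have := convexOn_exp.2 (Set.mem_univ (Real.log t * (-x))) (Set.mem_univ (Real.log t * (-y))) ha.le hb.le hab
  simp only [smul_eq_mul] at this
  rw [Real.rpow_def_of_pos ht, Real.rpow_def_of_pos ht, Real.rpow_def_of_pos ht]
  have e1 : Real.log t * (-(a * x + b * y)) = a * (Real.log t * (-x)) + b * (Real.log t * (-y)) := by ring
  rw [e1]
  exact this

lemma rpow_sconv (t : ℝ) (ht : 0 < t) (ht1 : t ≠ 1) (x y a b : ℝ) (hxy : x ≠ y) (ha : 0 < a) (hb : 0 < b)
    (hab : a + b = 1) :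
    t ^ (-(a * x + b * y)) < a * t ^ (-x) + b * t ^ (-y) := by
  have hlog : Real.log t ≠ 0 := Real.log_ne_zero_of_pos_of_ne_one ht ht1
  have := strictConvexOn_exp.2 (Set.mem_univ (Real.log t * (-x))) (Set.mem_univ (Real.log t * (-y)))
    (fun h => hxy (neg_injective (mul_left_cancel₀ hlog h))) ha hb hab
  simp only [smul_eq_mul] at this
  rw [Real.rpow_def_of_pos ht, Real.rpow_def_of_pos ht, Real.rpow_def_of_pos ht]
  have e1 : Real.log t * (-(a * x + b * y)) = a * (Real.log t * (-x)) + b * (Real.log t * (-y)) := by ring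
  rw [e1]
  exact this


/-- Strict convexity in `β` of the homogeneity exponent function
`c(β) = ∫ κ(y) δ_β(y) |y|^{-(N+2α)} dy` (from the proof of Lemma 4.1). -/
theorem exponent_function_strictly_convex
    (N : ℕ) (hN : 2 ≤ N) (α l L : ℝ)
    (hα : α ∈ Set.Ioo (0 : ℝ) 1) (hl : 0 < l) (hlL : l ≤ L)
    (f : EuclideanSpace ℝ (Fin N) → ℝ)
    (hf : ContDiff ℝ 2 f)
    (hf_nonneg : ∀ e ∈ Metric.sphere (0 : EuclideanSpace ℝ (Fin N)) 1, 0 ≤ f e)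
    (hf_ne : ∃ e₀ ∈ Metric.sphere (0 : EuclideanSpace ℝ (Fin N)) 1, f e₀ ≠ 0)
    (e : EuclideanSpace ℝ (Fin N)) (he : ‖e‖ = 1)
    (κ : EuclideanSpace ℝ (Fin N) → ℝ)
    (hκ_meas : Measurable κ)
    (hκ_bnd : ∀ y, κ y ∈ Set.Icc l L) :
    (∀ β ∈ Set.Ioo (-(2 * α)) (N : ℝ),
      Integrable (fun y : EuclideanSpace ℝ (Fin N) =>
        κ y * (f (‖e + y‖⁻¹ • (e + y)) * ‖e + y‖ ^ (-β)
              + f (‖e - y‖⁻¹ • (e - y)) * ‖e - y‖ ^ (-β)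
              - 2 * f e)
          * ‖y‖ ^ (-((N : ℝ) + 2 * α)))) ∧
    StrictConvexOn ℝ (Set.Ioo (-(2 * α)) (N : ℝ))
      (fun β : ℝ => ∫ y : EuclideanSpace ℝ (Fin N),
        κ y * (f (‖e + y‖⁻¹ • (e + y)) * ‖e + y‖ ^ (-β)
              + f (‖e - y‖⁻¹ • (e - y)) * ‖e - y‖ ^ (-β)
              - 2 * f e)
          * ‖y‖ ^ (-((N : ℝ) + 2 * α))) := by
  have hint := fun β hβ => integrable_main hN α l L hα hl f hf e he κ hκ_meas hκ_bnd β hβ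
  refine ⟨hint, convex_Ioo _ _, ?_⟩
  intro x hx y hy hxy a b ha hb hab
  have hm : a * x + b * y ∈ Set.Ioo (-(2 * α)) (N : ℝ) := (convex_Ioo _ _) hx hy ha.le hb.le hab
  have ix := hint x hx
  have iy := hint y hy
  have im := hint _ hm
  simp only [smul_eq_mul]
  rw [← integral_const_mul, ← integral_const_mul, ← integral_add (ix.const_mul a) (iy.const_mul b), ← sub_pos]
  refine lt_of_lt_of_eq ?_ (integral_sub ((ix.const_mul a).add (iy.const_mul b)) im)
  have hnt : Nontrivial (EuclideanSpace ℝ (Fin N)) := by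
    have : Nonempty (Fin N) := ⟨⟨0, by omega⟩⟩
    infer_instance
  -- nonnegativity of `f` on directions
  have hfn : ∀ z : EuclideanSpace ℝ (Fin N), z ≠ 0 → 0 ≤ f (‖z‖⁻¹ • z) := fun z hz =>
    hf_nonneg _ (by simp [norm_smul, hz])
  have hid : ∀ z : EuclideanSpace ℝ (Fin N),
      (a * (κ z * (f (‖e + z‖⁻¹ • (e + z)) * ‖e + z‖ ^ (-x)
              + f (‖e - z‖⁻¹ • (e - z)) * ‖e - z‖ ^ (-x) - 2 * f e) * ‖z‖ ^ (-((N : ℝ) + 2 * α)))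
        + b * (κ z * (f (‖e + z‖⁻¹ • (e + z)) * ‖e + z‖ ^ (-y)
              + f (‖e - z‖⁻¹ • (e - z)) * ‖e - z‖ ^ (-y) - 2 * f e) * ‖z‖ ^ (-((N : ℝ) + 2 * α))))
        - κ z * (f (‖e + z‖⁻¹ • (e + z)) * ‖e + z‖ ^ (-(a * x + b * y))
              + f (‖e - z‖⁻¹ • (e - z)) * ‖e - z‖ ^ (-(a * x + b * y)) - 2 * f e)
              * ‖z‖ ^ (-((N : ℝ) + 2 * α))
      = κ z * ‖z‖ ^ (-((N : ℝ) + 2 * α)) *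
        (f (‖e + z‖⁻¹ • (e + z)) * (a * ‖e + z‖ ^ (-x) + b * ‖e + z‖ ^ (-y) - ‖e + z‖ ^ (-(a * x + b * y)))
        + f (‖e - z‖⁻¹ • (e - z)) *
          (a * ‖e - z‖ ^ (-x) + b * ‖e - z‖ ^ (-y) - ‖e - z‖ ^ (-(a * x + b * y)))) := by
    intro z
    have hb' : b = 1 - a := by linarith
    generalize ‖e + z‖ ^ (-(a * x + b * y)) = p
    generalize ‖e - z‖ ^ (-(a * x + b * y)) = q
    subst hb'
    ring
  have hκ : ∀ z, 0 < κ z := fun z => hl.trans_le (hκ_bnd z).1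
  have hterm : ∀ z : EuclideanSpace ℝ (Fin N), z ≠ 0 →
      0 ≤ f (‖z‖⁻¹ • z) * (a * ‖z‖ ^ (-x) + b * ‖z‖ ^ (-y) - ‖z‖ ^ (-(a * x + b * y))) := fun z hz =>
    mul_nonneg (hfn z hz) (sub_nonneg.2 (rpow_conv _ (norm_pos_iff.2 hz) x y a b ha hb hab))
  have hae : ∀ᵐ z : EuclideanSpace ℝ (Fin N), z ≠ -e ∧ z ≠ e := by
    have h1 : ∀ᵐ z : EuclideanSpace ℝ (Fin N), z ≠ -e := by simp [ae_iff]
    have h2 : ∀ᵐ z : EuclideanSpace ℝ (Fin N), z ≠ e := by simp [ae_iff]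
    exact h1.and h2
  have hadd : ∀ z : EuclideanSpace ℝ (Fin N), z ≠ -e → e + z ≠ 0 := fun z hz h =>
    hz (eq_neg_of_add_eq_zero_right h)
  have hsub : ∀ z : EuclideanSpace ℝ (Fin N), z ≠ e → e - z ≠ 0 := fun z hz h =>
    hz (sub_eq_zero.1 h).symm
  refine (integral_pos_iff_support_of_nonneg_ae ?_ (((ix.const_mul a).add (iy.const_mul b)).sub im)).2 ?_
  · filter_upwards [hae] with z hz
    simp only [Pi.zero_apply, Pi.add_apply, Pi.sub_apply]
    rw [hid z]
    have h1 := hterm _ (hadd z hz.1)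
    have h2 := hterm _ (hsub z hz.2)
    have := hκ z
    positivity
  · obtain ⟨e₀, he₀, hfe₀⟩ := hf_ne
    have he₀' : ‖e₀‖ = 1 := by simpa using he₀
    have hpos : 0 < f e₀ := lt_of_le_of_ne (hf_nonneg e₀ he₀) (Ne.symm hfe₀)
    -- an open neighbourhood of `2 e₀ - e` on which the difference is positive
    have hc : ContinuousAt (fun z : EuclideanSpace ℝ (Fin N) => f (‖e + z‖⁻¹ • (e + z))) ((2:ℝ) • e₀ - e) := by
      have h0 : ‖e + ((2:ℝ) • e₀ - e)‖ ≠ 0 := by simp [norm_smul, he₀']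
      have h1 : ContinuousAt (fun z : EuclideanSpace ℝ (Fin N) => e + z) ((2:ℝ) • e₀ - e) := by fun_prop
      exact ContinuousAt.comp (g := f) hf.continuous.continuousAt ((h1.norm.inv₀ h0).smul h1)
    have hv : 0 < f (‖e + ((2:ℝ) • e₀ - e)‖⁻¹ • (e + ((2:ℝ) • e₀ - e))) := by
      rw [add_sub_cancel, norm_smul, he₀', smul_smul]
      simpa using hpos
    have ev1 : ∀ᶠ z in nhds ((2:ℝ) • e₀ - e), 0 < f (‖e + z‖⁻¹ • (e + z)) := hc.eventually_const_lt hv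
    have ev2 : ∀ᶠ z in nhds ((2:ℝ) • e₀ - e), 1 < ‖e + z‖ := by
      have h1 : ContinuousAt (fun z : EuclideanSpace ℝ (Fin N) => ‖e + z‖) ((2:ℝ) • e₀ - e) := by fun_prop
      refine h1.eventually_const_lt ?_
      beta_reduce
      rw [add_sub_cancel, norm_smul, he₀']
      norm_num
    have hU : (0 : ENNReal) < volume {z : EuclideanSpace ℝ (Fin N) | 0 < f (‖e + z‖⁻¹ • (e + z)) ∧ 1 < ‖e + z‖} :=
      Measure.measure_pos_of_mem_nhds _ (ev1.and ev2)
    refine hU.trans_le (measure_mono_ae ?_)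
    · filter_upwards [hae] with z hz hzU
      obtain ⟨hz1, hz2⟩ := hzU
      refine ne_of_gt ?_
      simp only [Pi.add_apply, Pi.sub_apply]
      rw [hid z]
      have hz0 : z ≠ 0 := by
        intro h
        simp [h, he] at hz2
      have hzn : 0 < ‖z‖ := norm_pos_iff.2 hz0
      have h2 := hterm _ (hsub z hz.2)
      have h1 : 0 < f (‖e + z‖⁻¹ • (e + z)) *
          (a * ‖e + z‖ ^ (-x) + b * ‖e + z‖ ^ (-y) - ‖e + z‖ ^ (-(a * x + b * y))) :=
        mul_pos hz1 (sub_pos.2 (rpow_sconv _ (by linarith) (ne_of_gt hz2) x y a b hxy ha hb hab))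
      have := hκ z
      positivity
end

section
/- No positive (−N)-homogeneous supersolutions (the bound β⁺ < N in Lemma 3.2). Let N ≥ 2, α ∈ (0,1). Let f : S^{N−1} → ℝ be C² with f ≥ 0 and f(e₀) > 0 for some e₀ ∈ S^{N−1}. Define u(x) = f(x/|x|) |x|^{−N} for x ≠ 0 and u(0) = 0. Then for every x ≠ 0 the following dichotomy holds: ∫_{ℝ^N} max(δ(u,x,y), 0) |y|^{−(N+2α)} dy = +∞ while ∫_{ℝ^N} max(−δ(u,x,y), 0) |y|^{−(N+2α)} dy < +∞. In particular, at no point x ≠ 0 is y ↦ δ(u,x,y)|y|^{−(N+2α)} Lebesgue integrable, so u cannot be a classical supersolution of any operator bounded below by the kernel λ|y|^{−(N+2α)} at any point. -/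
open MeasureTheory Classical

/-- The `(-N)`-homogeneous function `u(x) = f(x/|x|)|x|^{-N}`, `u(0)=0`. -/
noncomputable def uHomN {N : ℕ} (f : EuclideanSpace ℝ (Fin N) → ℝ)
    (x : EuclideanSpace ℝ (Fin N)) : ℝ :=
  if x = 0 then 0 else f (‖x‖⁻¹ • x) * ‖x‖ ^ (-(N : ℝ))

lemma aux_second_diff {N : ℕ} (u : EuclideanSpace ℝ (Fin N) → ℝ) (x : EuclideanSpace ℝ (Fin N))
    (hu : ContDiffAt ℝ 2 u x) :
    ∃ C ε : ℝ, 0 ≤ C ∧ 0 < ε ∧ ∀ y, ‖y‖ < ε → |nlD u x y| ≤ C * ‖y‖ ^ 2 := by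
  have h1 : ContDiffAt ℝ 1 (fderiv ℝ u) x := hu.fderiv_right (by norm_num)
  obtain ⟨K, t, ht, hK⟩ := h1.exists_lipschitzOnWith
  have h2 : ∀ᶠ z in nhds x, ContDiffAt ℝ 2 u z := hu.eventually (by simp)
  obtain ⟨ε, hε, hb⟩ := Metric.eventually_nhds_iff.1 (h2.and ht)
  refine ⟨2 * K, ε, by positivity, hε, fun y hy => ?_⟩
  have hd : ∀ z ∈ Metric.closedBall (0 : EuclideanSpace ℝ (Fin N)) ‖y‖,
      HasFDerivWithinAt (fun z => u (x + z) + u (x - z)) (fderiv ℝ u (x + z) - fderiv ℝ u (x - z))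
        (Metric.closedBall (0 : EuclideanSpace ℝ (Fin N)) ‖y‖) z := by
    intro z hz
    rw [mem_closedBall_zero_iff] at hz
    have ha : DifferentiableAt ℝ u (x + z) :=
      (hb (y := x + z) (by simpa [dist_eq_norm] using hz.trans_lt hy)).1.differentiableAt (by simp)
    have hc : DifferentiableAt ℝ u (x - z) :=
      (hb (y := x - z) (by simpa [dist_eq_norm] using hz.trans_lt hy)).1.differentiableAt (by simp)
    have e1 : HasFDerivAt (fun z => x + z) (ContinuousLinearMap.id ℝ (EuclideanSpace ℝ (Fin N))) z :=
      (hasFDerivAt_id z).const_add x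
    have e2 : HasFDerivAt (fun z => x - z) (-ContinuousLinearMap.id ℝ (EuclideanSpace ℝ (Fin N))) z :=
      (hasFDerivAt_id z).const_sub x
    have e3 := (ha.hasFDerivAt.comp z e1).add (hc.hasFDerivAt.comp z e2)
    refine HasFDerivAt.hasFDerivWithinAt ?_
    have e4 : fderiv ℝ u (x + z) - fderiv ℝ u (x - z) =
        (fderiv ℝ u (x + z)).comp (ContinuousLinearMap.id ℝ (EuclideanSpace ℝ (Fin N))) +
          (fderiv ℝ u (x - z)).comp (-ContinuousLinearMap.id ℝ (EuclideanSpace ℝ (Fin N))) := by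
      ext v
      simp [sub_eq_add_neg]
    rw [e4]
    exact e3
  have hbd : ∀ z ∈ Metric.closedBall (0 : EuclideanSpace ℝ (Fin N)) ‖y‖,
      ‖fderiv ℝ u (x + z) - fderiv ℝ u (x - z)‖ ≤ 2 * K * ‖y‖ := by
    intro z hz
    rw [mem_closedBall_zero_iff] at hz
    have ha := (hb (y := x + z) (by simpa [dist_eq_norm] using hz.trans_lt hy)).2
    have hc := (hb (y := x - z) (by simpa [dist_eq_norm] using hz.trans_lt hy)).2
    have := hK.dist_le_mul _ ha _ hc
    rw [dist_eq_norm, dist_eq_norm] at this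
    refine this.trans ?_
    have h3 : x + z - (x - z) = (2 : ℝ) • z := by rw [two_smul]; abel
    rw [h3, norm_smul]
    have hK0 : (0 : ℝ) ≤ K := K.2
    simp only [Real.norm_ofNat]
    nlinarith
  have := (convex_closedBall (0 : EuclideanSpace ℝ (Fin N)) ‖y‖).norm_image_sub_le_of_norm_hasFDerivWithin_le
    hd hbd (x := 0) (y := y) (by simp) (by simp)
  simp only [add_zero, sub_zero, Real.norm_eq_abs] at this
  unfold nlD
  rw [two_mul (u x)]
  refine this.trans (le_of_eq ?_)
  ring

lemma aux_nonneg {N : ℕ} (f : EuclideanSpace ℝ (Fin N) → ℝ)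
    (hf_nonneg : ∀ e ∈ Metric.sphere (0 : EuclideanSpace ℝ (Fin N)) 1, 0 ≤ f e)
    (x : EuclideanSpace ℝ (Fin N)) : 0 ≤ uHomN f x := by
  unfold uHomN
  split_ifs with h
  · exact le_rfl
  · refine mul_nonneg (hf_nonneg _ ?_) (by positivity)
    have : ‖x‖ ≠ 0 := norm_ne_zero_iff.2 h
    simp [norm_smul, this]

lemma aux_contDiffAt {N : ℕ} (f : EuclideanSpace ℝ (Fin N) → ℝ) (hf : ContDiff ℝ 2 f)
    (x : EuclideanSpace ℝ (Fin N)) (hx : x ≠ 0) : ContDiffAt ℝ 2 (uHomN f) x := by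
  have h1 : ContDiffAt ℝ 2 (fun x : EuclideanSpace ℝ (Fin N) => f (‖x‖⁻¹ • x) * ‖x‖ ^ (-(N : ℝ))) x := by
    have hn : ContDiffAt ℝ 2 (fun x : EuclideanSpace ℝ (Fin N) => ‖x‖) x := contDiffAt_norm ℝ hx
    have hx' : ‖x‖ ≠ 0 := norm_ne_zero_iff.2 hx
    refine ContDiffAt.mul ?_ (hn.rpow_const_of_ne hx')
    exact hf.contDiffAt.comp x ((hn.inv hx').smul contDiffAt_id)
  refine h1.congr_of_eventuallyEq ?_
  filter_upwards [isOpen_ne.mem_nhds hx] with z hz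
  simp only [uHomN, if_neg hz]

lemma aux_measurable {N : ℕ} (f : EuclideanSpace ℝ (Fin N) → ℝ) (hf : Continuous f) :
    Measurable (uHomN f) := by
  unfold uHomN
  refine Measurable.ite (measurableSet_singleton 0) measurable_const ?_
  refine Measurable.mul (hf.measurable.comp ?_) (measurable_norm.pow_const _)
  exact measurable_norm.inv.smul measurable_id

lemma aux_scale_s4 {N : ℕ} (f : EuclideanSpace ℝ (Fin N) → ℝ) (t : ℝ) (ht : 0 < t)
    (z : EuclideanSpace ℝ (Fin N)) : uHomN f (t • z) = (t ^ N)⁻¹ * uHomN f z := by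
  by_cases hz : z = 0
  · simp [uHomN, hz]
  · have hn : ‖z‖ ≠ 0 := norm_ne_zero_iff.2 hz
    have h1 : t • z ≠ 0 := smul_ne_zero ht.ne' hz
    simp only [uHomN, if_neg hz, if_neg h1]
    rw [norm_smul, Real.norm_of_nonneg ht.le, smul_smul, Real.mul_rpow ht.le (norm_nonneg _),
      Real.rpow_neg ht.le, Real.rpow_natCast]
    have : (t * ‖z‖)⁻¹ * t = ‖z‖⁻¹ := by field_simp
    rw [this]; ring

lemma aux_not_int {N : ℕ} (f : EuclideanSpace ℝ (Fin N) → ℝ)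
    (hf : ContDiff ℝ 2 f)
    (hf_pos : ∃ e₀ ∈ Metric.sphere (0 : EuclideanSpace ℝ (Fin N)) 1, 0 < f e₀) (R : ℝ) (hR : 0 < R) :
    ∫⁻ z in Metric.ball (0 : EuclideanSpace ℝ (Fin N)) R, ENNReal.ofReal (uHomN f z) = ⊤ := by
  by_contra hfin
  have hm := (aux_measurable f hf.continuous).ennreal_ofReal
  have hmap := Measure.map_addHaar_smul (volume : Measure (EuclideanSpace ℝ (Fin N))) (two_ne_zero (α := ℝ))
  have hsm : Measurable (fun z : EuclideanSpace ℝ (Fin N) => (2 : ℝ) • z) := measurable_const_smul 2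
  have h1 := setLIntegral_map (μ := (volume : Measure (EuclideanSpace ℝ (Fin N))))
    (s := Metric.ball 0 R) Metric.isOpen_ball.measurableSet hm hsm
  have hpre : (fun z : EuclideanSpace ℝ (Fin N) => (2 : ℝ) • z) ⁻¹' Metric.ball 0 R = Metric.ball 0 (R / 2) := by
    ext z
    simp only [Set.mem_preimage, mem_ball_zero_iff, norm_smul, Real.norm_ofNat]
    constructor <;> intro h <;> linarith
  rw [hmap, hpre, Measure.restrict_smul, lintegral_smul_measure] at h1
  simp only [aux_scale_s4 f 2 two_pos, finrank_euclideanSpace_fin] at h1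
  have hc : (0 : ℝ) ≤ (2 ^ N)⁻¹ := by positivity
  simp only [ENNReal.ofReal_mul hc] at h1
  rw [lintegral_const_mul _ hm, abs_of_nonneg hc, smul_eq_mul] at h1
  have h2 := (ENNReal.mul_right_inj (by simp [ENNReal.ofReal_eq_zero]) ENNReal.ofReal_ne_top).1 h1
  have h3 := lintegral_inter_add_sdiff (μ := (volume : Measure (EuclideanSpace ℝ (Fin N))))
    (fun z => ENNReal.ofReal (uHomN f z))
    (Metric.ball (0 : EuclideanSpace ℝ (Fin N)) R) (B := Metric.ball 0 (R / 2))
    Metric.isOpen_ball.measurableSet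
  have hsub : Metric.ball (0 : EuclideanSpace ℝ (Fin N)) (R / 2) ⊆ Metric.ball 0 R :=
    Metric.ball_subset_ball (by linarith)
  rw [Set.inter_eq_self_of_subset_right hsub, ← h2] at h3
  have h4 : ∫⁻ z in Metric.ball (0 : EuclideanSpace ℝ (Fin N)) R \ Metric.ball 0 (R / 2),
      ENNReal.ofReal (uHomN f z) = 0 := by
    have h5 := h3.trans (add_zero _).symm
    exact (ENNReal.add_right_inj hfin).1 h5
  obtain ⟨e, he, hfe⟩ := hf_pos
  rw [mem_sphere_zero_iff_norm] at he
  have he0 : e ≠ 0 := by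
    intro h
    simp [h] at he
  set p : EuclideanSpace ℝ (Fin N) := (3 * R / 4) • e with hp
  have hpn : ‖p‖ = 3 * R / 4 := by
    rw [hp, norm_smul, he, mul_one, Real.norm_of_nonneg (by positivity)]
  have hp0 : p ≠ 0 := by
    intro h
    rw [h, norm_zero] at hpn
    linarith
  have hup : 0 < uHomN f p := by
    rw [hp, aux_scale_s4 f _ (by positivity)]
    refine mul_pos (by positivity) ?_
    simp [uHomN, he0, he, hfe]
  have hev : ∀ᶠ z in nhds p, 0 < uHomN f z :=
    (aux_contDiffAt f hf p hp0).continuousAt.eventually (lt_mem_nhds hup)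
  have hev2 : ∀ᶠ z in nhds p, R / 2 < ‖z‖ :=
    continuous_norm.continuousAt.eventually (lt_mem_nhds (by change _ < _; simp only [hpn]; linarith))
  have hev3 : ∀ᶠ z in nhds p, ‖z‖ < R :=
    continuous_norm.continuousAt.eventually (gt_mem_nhds (by change _ < _; simp only [hpn]; linarith))
  have hpos : 0 < ∫⁻ z in Metric.ball (0 : EuclideanSpace ℝ (Fin N)) R \ Metric.ball 0 (R / 2),
      ENNReal.ofReal (uHomN f z) := by
    rw [setLIntegral_pos_iff hm]
    refine Measure.measure_pos_of_mem_nhds _ (x := p) ?_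
    filter_upwards [hev, hev2, hev3] with z h1 h2 h3
    refine ⟨?_, ?_, ?_⟩
    · simp [Function.mem_support, h1]
    · simpa using h3
    · simpa using h2.le
  exact hpos.ne' h4

lemma aux_top {N : ℕ} (s : ℝ) (hs : 0 < s) (f : EuclideanSpace ℝ (Fin N) → ℝ)
    (hf : ContDiff ℝ 2 f)
    (hf_nonneg : ∀ e ∈ Metric.sphere (0 : EuclideanSpace ℝ (Fin N)) 1, 0 ≤ f e)
    (hf_pos : ∃ e₀ ∈ Metric.sphere (0 : EuclideanSpace ℝ (Fin N)) 1, 0 < f e₀)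
    (x : EuclideanSpace ℝ (Fin N)) (hx : x ≠ 0) :
    ∫⁻ y, ENNReal.ofReal (max (nlD (uHomN f) x y) 0 * ‖y‖ ^ (-s)) = ⊤ := by
  have hxn : 0 < ‖x‖ := norm_pos_iff.2 hx
  have hm := (aux_measurable f hf.continuous).ennreal_ofReal
  set c : ℝ := (2 * ‖x‖) ^ (-s) with hc
  have hc0 : 0 < c := by positivity
  set F : EuclideanSpace ℝ (Fin N) → ENNReal :=
    fun y => ENNReal.ofReal (max (nlD (uHomN f) x y) 0 * ‖y‖ ^ (-s)) with hF
  by_contra hfin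
  have h0 : ∫⁻ z, F (z - x) = ∫⁻ y, F y := lintegral_sub_right_eq_self F x
  have key : ∀ z ∈ Metric.ball (0 : EuclideanSpace ℝ (Fin N)) ‖x‖,
      ENNReal.ofReal c * ENNReal.ofReal (uHomN f z) ≤
        F (z - x) + ENNReal.ofReal (c * (2 * uHomN f x)) := by
    intro z hz
    rw [mem_ball_zero_iff] at hz
    rw [hF, ← ENNReal.ofReal_mul hc0.le]
    simp only
    have hu2 := aux_nonneg f hf_nonneg (x - (z - x))
    have hux := aux_nonneg f hf_nonneg x
    rw [← ENNReal.ofReal_add (by positivity) (by positivity)]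
    apply ENNReal.ofReal_le_ofReal
    have hpos : 0 < ‖z - x‖ := by
      rw [norm_pos_iff, sub_ne_zero]
      rintro rfl
      exact lt_irrefl _ hz
    have hle : ‖z - x‖ ≤ 2 * ‖x‖ := by
      have := norm_sub_le z x
      linarith
    have hk : c ≤ ‖z - x‖ ^ (-s) := Real.rpow_le_rpow_of_nonpos hpos hle (by linarith)
    have hd : uHomN f z - 2 * uHomN f x ≤ nlD (uHomN f) x (z - x) := by
      unfold nlD
      rw [add_sub_cancel]
      linarith
    have hM : uHomN f z - 2 * uHomN f x ≤ max (nlD (uHomN f) x (z - x)) 0 := hd.trans (le_max_left _ _)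
    have hM0 : 0 ≤ max (nlD (uHomN f) x (z - x)) 0 := le_max_right _ _
    nlinarith [mul_le_mul_of_nonneg_left hk hM0, mul_le_mul_of_nonneg_left hM hc0.le]
  have h1 := setLIntegral_mono' (μ := (volume : Measure (EuclideanSpace ℝ (Fin N))))
    Metric.isOpen_ball.measurableSet key
  rw [lintegral_const_mul _ hm, aux_not_int f hf hf_pos _ hxn,
    ENNReal.mul_top (by simpa using hc0), lintegral_add_right _ measurable_const, top_le_iff,
    ENNReal.add_eq_top] at h1
  rcases h1 with h1 | h1
  · refine hfin ?_
    rw [← h0, ← top_le_iff, ← h1]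
    exact setLIntegral_le_lintegral _ _
  · rw [setLIntegral_const] at h1
    exact (ENNReal.mul_lt_top ENNReal.ofReal_lt_top measure_ball_lt_top).ne h1

lemma aux_fin {N : ℕ} (hN : 2 ≤ N) (s : ℝ) (hs : (N : ℝ) < s) (hs2 : s < N + 2)
    (f : EuclideanSpace ℝ (Fin N) → ℝ) (hf : ContDiff ℝ 2 f)
    (hf_nonneg : ∀ e ∈ Metric.sphere (0 : EuclideanSpace ℝ (Fin N)) 1, 0 ≤ f e)
    (x : EuclideanSpace ℝ (Fin N)) (hx : x ≠ 0) :
    ∫⁻ y, ENNReal.ofReal (max (-nlD (uHomN f) x y) 0 * ‖y‖ ^ (-s)) < ⊤ := by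
  have hN0 : (0 : ℝ) ≤ N := Nat.cast_nonneg N
  have hux := aux_nonneg f hf_nonneg x
  have hum := aux_measurable f hf.continuous
  have hmeas : Measurable (fun y => max (-nlD (uHomN f) x y) 0 * ‖y‖ ^ (-s)) := by
    unfold nlD
    refine Measurable.mul (Measurable.max (Measurable.neg ?_) measurable_const)
      (measurable_norm.pow_const _)
    exact ((hum.comp (measurable_const_add x)).add (hum.comp (measurable_const_sub x))).sub_const _
  obtain ⟨C, ε, hC, hε, hb⟩ := aux_second_diff _ x (aux_contDiffAt f hf x hx)
  have hnn : ∀ y : EuclideanSpace ℝ (Fin N), 0 ≤ max (-nlD (uHomN f) x y) 0 * ‖y‖ ^ (-s) :=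
    fun y => by positivity
  have i1 : IntegrableOn (fun y => max (-nlD (uHomN f) x y) 0 * ‖y‖ ^ (-s)) (Metric.ball 0 ε) := by
    refine integrableOn_ball_of_norm_le_rpow (C := C) (α := s - 2) ?_ ?_ ?_
      hmeas.aestronglyMeasurable
    · rw [finrank_euclideanSpace_fin]; omega
    · rw [finrank_euclideanSpace_fin]; linarith
    · filter_upwards [ae_restrict_mem Metric.isOpen_ball.measurableSet] with y hy
      rw [mem_ball_zero_iff] at hy
      rw [Real.norm_of_nonneg (hnn y)]
      rcases eq_or_ne y 0 with rfl | hy0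
      · have : nlD (uHomN f) x 0 = 0 := by simp [nlD, two_mul]
        rw [this]
        simp only [neg_zero, max_self, zero_mul]
        positivity
      · have hyn : 0 < ‖y‖ := norm_pos_iff.2 hy0
        have e1 : ‖y‖ ^ (-(s - 2)) = ‖y‖ ^ 2 * ‖y‖ ^ (-s) := by
          rw [← Real.rpow_natCast, ← Real.rpow_add hyn]
          congr 1
          push_cast
          ring
        rw [e1, ← mul_assoc]
        refine mul_le_mul_of_nonneg_right ?_ (by positivity)
        exact max_le ((neg_le_abs _).trans (hb y hy)) (by positivity)
  have i2 : IntegrableOn (fun y => max (-nlD (uHomN f) x y) 0 * ‖y‖ ^ (-s)) (Metric.ball 0 ε)ᶜ := by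
    have hj : Integrable (fun y : EuclideanSpace ℝ (Fin N) =>
        (2 * uHomN f x * (1 / ε + 1) ^ s) * (1 + ‖y‖) ^ (-s)) :=
      (integrable_one_add_norm (by rw [finrank_euclideanSpace_fin]; exact hs)).const_mul _
    refine Integrable.mono' hj.integrableOn hmeas.aestronglyMeasurable.restrict ?_
    filter_upwards [ae_restrict_mem Metric.isOpen_ball.measurableSet.compl] with y hy
    rw [Set.mem_compl_iff, mem_ball_zero_iff, not_lt] at hy
    have hyn : 0 < ‖y‖ := hε.trans_le hy
    rw [Real.norm_of_nonneg (hnn y), mul_assoc]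
    have ha := aux_nonneg f hf_nonneg (x + y)
    have hb := aux_nonneg f hf_nonneg (x - y)
    refine mul_le_mul (max_le ?_ (by positivity)) ?_ (by positivity) (by positivity)
    · unfold nlD; linarith
    · have h1 : 1 + ‖y‖ ≤ (1 / ε + 1) * ‖y‖ := by
        have : 1 ≤ 1 / ε * ‖y‖ := by
          rw [one_div_mul_eq_div, one_le_div hε]; exact hy
        linarith
      have hD : 0 < 1 / ε + 1 := by positivity
      have h2 := Real.rpow_le_rpow_of_nonpos (z := -s) (by positivity) h1 (by linarith)
      rw [Real.mul_rpow hD.le hyn.le] at h2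
      have h3 := mul_le_mul_of_nonneg_left h2 (Real.rpow_nonneg hD.le s)
      rwa [← mul_assoc, ← Real.rpow_add hD, add_neg_cancel, Real.rpow_zero, one_mul] at h3
  have i3 := i1.union i2
  rw [Set.union_compl_self, integrableOn_univ] at i3
  exact i3.lintegral_lt_top

/-- No positive `(-N)`-homogeneous supersolutions: the bound `β⁺ < N` in
Lemma 3.2. -/
theorem no_minus_N_homogeneous_supersolution
    (N : ℕ) (hN : 2 ≤ N) (α : ℝ) (hα : α ∈ Set.Ioo (0 : ℝ) 1)
    (f : EuclideanSpace ℝ (Fin N) → ℝ)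
    (hf : ContDiff ℝ 2 f)
    (hf_nonneg : ∀ e ∈ Metric.sphere (0 : EuclideanSpace ℝ (Fin N)) 1, 0 ≤ f e)
    (hf_pos : ∃ e₀ ∈ Metric.sphere (0 : EuclideanSpace ℝ (Fin N)) 1, 0 < f e₀) :
    ∀ x : EuclideanSpace ℝ (Fin N), x ≠ 0 →
      (∫⁻ y, ENNReal.ofReal (max (nlD (uHomN f) x y) 0 * ‖y‖ ^ (-((N : ℝ) + 2 * α))) = ⊤) ∧
      (∫⁻ y, ENNReal.ofReal (max (-nlD (uHomN f) x y) 0 * ‖y‖ ^ (-((N : ℝ) + 2 * α))) < ⊤) ∧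
      ¬ Integrable (fun y => nlD (uHomN f) x y * ‖y‖ ^ (-((N : ℝ) + 2 * α))) := by
  intro x hx
  obtain ⟨h0, h1⟩ := hα
  have hN0 : (0 : ℝ) ≤ N := Nat.cast_nonneg N
  have htop := aux_top ((N : ℝ) + 2 * α) (by linarith) f hf hf_nonneg hf_pos x hx
  refine ⟨htop, aux_fin hN _ (by linarith) (by linarith) f hf hf_nonneg x hx, fun hi => ?_⟩
  refine hi.norm.lintegral_lt_top.ne ?_
  rw [← top_le_iff, ← htop]
  refine lintegral_mono fun y => ENNReal.ofReal_le_ofReal ?_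
  rw [norm_mul, Real.norm_eq_abs, Real.norm_of_nonneg (by positivity : 0 ≤ ‖y‖ ^ (-((N : ℝ) + 2 * α)))]
  exact mul_le_mul_of_nonneg_right (max_le (le_abs_self _) (abs_nonneg _)) (by positivity)
end

section
/- No positive 2α-homogeneous supersolutions (the bound β⁻ > −2α in Lemma 3.2). Let N ≥ 2, α ∈ (0,1). Let f : S^{N−1} → ℝ be C² with f ≥ 0 and f(e₀) > 0 for some e₀ ∈ S^{N−1}. Define u(x) = f(x/|x|) |x|^{2α} for x ≠ 0 and u(0) = 0. Then for every x ≠ 0: ∫_{ℝ^N} max(δ(u,x,y), 0) |y|^{−(N+2α)} dy = +∞ while ∫_{ℝ^N} max(−δ(u,x,y), 0) |y|^{−(N+2α)} dy < +∞. In particular, at no point x ≠ 0 is y ↦ δ(u,x,y)|y|^{−(N+2α)} Lebesgue integrable, so u cannot be a classical supersolution of any operator bounded below by the kernel λ|y|^{−(N+2α)} at any point. -/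
open MeasureTheory Classical

/-- The `2α`-homogeneous function `u(x) = f(x/|x|)|x|^{2α}`, `u(0)=0`. -/
noncomputable def uHom2a {N : ℕ} (α : ℝ) (f : EuclideanSpace ℝ (Fin N) → ℝ)
    (x : EuclideanSpace ℝ (Fin N)) : ℝ :=
  if x = 0 then 0 else f (‖x‖⁻¹ • x) * ‖x‖ ^ (2 * α)

section Helpers

open Set Filter Topology

lemma uHom2a_nonneg {N : ℕ} (α : ℝ) (f : EuclideanSpace ℝ (Fin N) → ℝ)
    (hf : ∀ e ∈ Metric.sphere (0 : EuclideanSpace ℝ (Fin N)) 1, 0 ≤ f e)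
    (x : EuclideanSpace ℝ (Fin N)) : 0 ≤ uHom2a α f x := by
  unfold uHom2a
  split_ifs with h
  · exact le_rfl
  · refine mul_nonneg (hf _ ?_) (by positivity)
    simp [norm_smul, h]

lemma uHom2a_smul {N : ℕ} (α : ℝ) (f : EuclideanSpace ℝ (Fin N) → ℝ)
    (x : EuclideanSpace ℝ (Fin N)) (t : ℝ) (ht : 0 < t) :
    uHom2a α f (t • x) = t ^ (2 * α) * uHom2a α f x := by
  unfold uHom2a
  by_cases h : x = 0
  · simp [h]
  · have h1 : t • x ≠ 0 := smul_ne_zero ht.ne' h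
    have hx : 0 < ‖x‖ := norm_pos_iff.2 h
    rw [if_neg h1, if_neg h, norm_smul, Real.norm_of_nonneg ht.le, smul_smul,
      Real.mul_rpow ht.le hx.le]
    have : (t * ‖x‖)⁻¹ * t = ‖x‖⁻¹ := by field_simp
    rw [this]; ring

lemma uHom2a_contDiffAt {N : ℕ} (α : ℝ) (f : EuclideanSpace ℝ (Fin N) → ℝ)
    (hf : ContDiff ℝ 2 f) (x : EuclideanSpace ℝ (Fin N)) (hx : x ≠ 0) :
    ContDiffAt ℝ 2 (uHom2a α f) x := by
  have hn : ContDiffAt ℝ 2 (fun y : EuclideanSpace ℝ (Fin N) => ‖y‖) x := contDiffAt_norm ℝ hx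
  have hx' : ‖x‖ ≠ 0 := norm_ne_zero_iff.2 hx
  have h1 : ContDiffAt ℝ 2 (fun y : EuclideanSpace ℝ (Fin N) =>
      f (‖y‖⁻¹ • y) * ‖y‖ ^ (2 * α)) x := by
    refine ContDiffAt.mul ?_ (hn.rpow_const_of_ne hx')
    exact hf.contDiffAt.comp x ((hn.inv hx').smul contDiffAt_id)
  refine h1.congr_of_eventuallyEq ?_
  filter_upwards [isOpen_ne.mem_nhds hx] with y hy
  simp only [uHom2a]
  rw [if_neg hy]

lemma second_diff_bound {E : Type*} [NormedAddCommGroup E] [NormedSpace ℝ E]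
    (u : E → ℝ) (x : E) (hu : ContDiffAt ℝ 2 u x) :
    ∃ C : ℝ, 0 ≤ C ∧ ∃ r : ℝ, 0 < r ∧ ∀ y : E, ‖y‖ ≤ r →
      |u (x + y) + u (x - y) - 2 * u x| ≤ C * ‖y‖ ^ 2 := by
  obtain ⟨K, t, ht, hK⟩ :=
    (hu.fderiv_right (m := 1) (by norm_num)).exists_lipschitzOnWith
  have hd : ∀ᶠ z in 𝓝 x, DifferentiableAt ℝ u z := by
    filter_upwards [hu.eventually (by simp)] with z hz
    exact hz.differentiableAt (by simp)
  obtain ⟨r, hr, hball⟩ := Metric.nhds_basis_closedBall.mem_iff.1 (Filter.inter_mem ht hd)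
  refine ⟨2 * K, by positivity, r, hr, fun y hy => ?_⟩
  have key : ∀ z ∈ Metric.closedBall (0 : E) ‖y‖, x + z ∈ Metric.closedBall x r ∧
      x - z ∈ Metric.closedBall x r := by
    intro z hz
    rw [mem_closedBall_zero_iff] at hz
    constructor
    · simp; linarith
    · simp [Metric.mem_closedBall]; linarith
  have hmv := Convex.norm_image_sub_le_of_norm_hasFDerivWithin_le (𝕜 := ℝ)
    (f := fun z => u (x + z) + u (x - z)) (f' := fun z => fderiv ℝ u (x + z) - fderiv ℝ u (x - z))
    (s := Metric.closedBall (0 : E) ‖y‖) (C := 2 * K * ‖y‖) (x := 0) (y := y)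
    (fun z hz => ?_) (fun z hz => ?_) (convex_closedBall _ _) (by simp) (by simp)
  · have : u (x + y) + u (x - y) - 2 * u x = u (x + y) + u (x - y) - (u (x + 0) + u (x - 0)) := by
      simp; ring
    rw [this, ← Real.norm_eq_abs]
    refine hmv.trans (le_of_eq ?_)
    rw [sub_zero]; ring
  · obtain ⟨h1, h2⟩ := key z hz
    have d1 : HasFDerivAt u (fderiv ℝ u (x + z)) (x + z) := (hball h1).2.hasFDerivAt
    have d2 : HasFDerivAt u (fderiv ℝ u (x - z)) (x - z) := (hball h2).2.hasFDerivAt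
    have e1 := d1.comp z ((hasFDerivAt_id z).const_add x)
    have e2 := d2.comp z ((hasFDerivAt_id z).const_sub x)
    have e3 := (e1.add e2).hasFDerivWithinAt (s := Metric.closedBall (0 : E) ‖y‖)
    have e4 : fderiv ℝ u (x + z) ∘SL ContinuousLinearMap.id ℝ E +
        fderiv ℝ u (x - z) ∘SL (-ContinuousLinearMap.id ℝ E) =
        fderiv ℝ u (x + z) - fderiv ℝ u (x - z) := by
      ext v; simp [sub_eq_add_neg]
    rw [e4] at e3
    exact e3
  · obtain ⟨h1, h2⟩ := key z hz
    have := hK.dist_le_mul _ (hball h1).1 _ (hball h2).1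
    rw [dist_eq_norm, dist_eq_norm] at this
    refine this.trans ?_
    have h3 : x + z - (x - z) = (2 : ℝ) • z := by rw [two_smul]; abel
    rw [h3, norm_smul, Real.norm_of_nonneg (by norm_num)]
    have hz' : ‖z‖ ≤ ‖y‖ := by simpa using hz
    have : (0 : ℝ) ≤ K := K.2
    nlinarith

lemma radial_integrable {N : ℕ} (hN : 2 ≤ N) (α : ℝ) (hα : α ∈ Set.Ioo (0 : ℝ) 1)
    (C D r : ℝ) (hr : 0 < r) :
    Integrable (fun y : EuclideanSpace ℝ (Fin N) =>
      (fun t : ℝ => if t ≤ r then C * t ^ (2 - ((N : ℝ) + 2 * α))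
        else D * t ^ (-((N : ℝ) + 2 * α))) ‖y‖) := by
  have : Nonempty (Fin N) := ⟨⟨0, by omega⟩⟩
  have : Nontrivial (EuclideanSpace ℝ (Fin N)) := inferInstance
  obtain ⟨h0, h1⟩ := hα
  rw [integrable_fun_norm_addHaar (volume : Measure (EuclideanSpace ℝ (Fin N)))
    (f := fun t : ℝ => if t ≤ r then C * t ^ (2 - ((N : ℝ) + 2 * α))
        else D * t ^ (-((N : ℝ) + 2 * α)))]
  have hpow : ∀ t : ℝ, 0 < t → ∀ b : ℝ, t ^ (N - 1) * t ^ b = t ^ ((N : ℝ) - 1 + b) := by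
    intro t ht b
    rw [Real.rpow_add ht, ← Real.rpow_natCast, Nat.cast_sub (by omega)]
    simp
  rw [← Ioc_union_Ioi_eq_Ioi hr.le]
  refine IntegrableOn.union ?_ ?_
  · have h := (intervalIntegral.intervalIntegrable_rpow' (a := 0) (b := r)
      (r := 1 - 2 * α) (by linarith)).1.const_mul C
    refine IntegrableOn.congr_fun h ?_ measurableSet_Ioc
    intro t ht
    simp only [finrank_euclideanSpace, Fintype.card_fin, smul_eq_mul, if_pos ht.2]
    rw [mul_left_comm, hpow t ht.1]
    congr 2; ring
  · have h := (integrableOn_Ioi_rpow_of_lt (a := -1 - 2 * α) (by linarith) hr).const_mul D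
    refine IntegrableOn.congr_fun h ?_ measurableSet_Ioi
    intro t ht
    have ht' : r < t := ht
    simp only [finrank_euclideanSpace, Fintype.card_fin, smul_eq_mul, if_neg (not_le.2 ht')]
    rw [mul_left_comm, hpow t (hr.trans ht')]
    congr 2; ring

lemma neg_part_finite {N : ℕ} (hN : 2 ≤ N) (α : ℝ) (hα : α ∈ Set.Ioo (0 : ℝ) 1)
    (f : EuclideanSpace ℝ (Fin N) → ℝ)
    (hf : ContDiff ℝ 2 f)
    (hf_nonneg : ∀ e ∈ Metric.sphere (0 : EuclideanSpace ℝ (Fin N)) 1, 0 ≤ f e)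
    (x : EuclideanSpace ℝ (Fin N)) (hx : x ≠ 0) :
    ∫⁻ y, ENNReal.ofReal (max (-nlD (uHom2a α f) x y) 0 * ‖y‖ ^ (-((N : ℝ) + 2 * α))) < ⊤ := by
  obtain ⟨C, hC, r, hr, hb⟩ := second_diff_bound _ x (uHom2a_contDiffAt α f hf x hx)
  have hu := uHom2a_nonneg α f hf_nonneg
  refine lt_of_le_of_lt (lintegral_mono fun y => ?_)
    (radial_integrable hN α hα C (2 * uHom2a α f x) r hr).lintegral_lt_top
  refine ENNReal.ofReal_le_ofReal ?_
  dsimp only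
  split_ifs with h
  · rcases eq_or_ne y 0 with rfl | hy
    · have : nlD (uHom2a α f) x 0 = 0 := by simp [nlD]; ring
      rw [this]; simp; positivity
    have hy' : 0 < ‖y‖ := norm_pos_iff.2 hy
    rw [sub_eq_add_neg, Real.rpow_add hy', ← mul_assoc]
    refine mul_le_mul_of_nonneg_right ?_ (by positivity)
    have := hb y h
    refine max_le ((neg_le_abs _).trans ?_) (by positivity)
    exact_mod_cast this
  · refine mul_le_mul_of_nonneg_right ?_ (by positivity)
    refine max_le ?_ (by linarith [hu x])
    unfold nlD
    linarith [hu (x + y), hu (x - y)]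

lemma pos_part_top {N : ℕ} (hN : 2 ≤ N) (α : ℝ) (hα : α ∈ Set.Ioo (0 : ℝ) 1)
    (f : EuclideanSpace ℝ (Fin N) → ℝ)
    (hf : ContDiff ℝ 2 f)
    (hf_nonneg : ∀ e ∈ Metric.sphere (0 : EuclideanSpace ℝ (Fin N)) 1, 0 ≤ f e)
    (hf_pos : ∃ e₀ ∈ Metric.sphere (0 : EuclideanSpace ℝ (Fin N)) 1, 0 < f e₀)
    (x : EuclideanSpace ℝ (Fin N)) :
    ∫⁻ y, ENNReal.ofReal (max (nlD (uHom2a α f) x y) 0 * ‖y‖ ^ (-((N : ℝ) + 2 * α))) = ⊤ := by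
  obtain ⟨e, he, hfe⟩ := hf_pos
  have he1 : ‖e‖ = 1 := by simpa using he
  have he0 : e ≠ 0 := by rintro rfl; simp at he1
  obtain ⟨h0, h1⟩ := hα
  have hu := uHom2a_nonneg α f hf_nonneg
  have hue : 0 < uHom2a α f e := by simp [uHom2a, he0, he1, hfe]
  set c := uHom2a α f e / 2 with hc
  have hcpos : 0 < c := by positivity
  have hcont : ContinuousAt (uHom2a α f) e := (uHom2a_contDiffAt α f hf e he0).continuousAt
  have hev : ∀ᶠ z in 𝓝 e, c < uHom2a α f z :=
    hcont.eventually (lt_mem_nhds (by linarith))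
  obtain ⟨ε₀, hε₀, hball⟩ := Metric.eventually_nhds_iff_ball.1 hev
  obtain ⟨ε, hε, hε1, hε2⟩ : ∃ ε : ℝ, 0 < ε ∧ ε ≤ 1 / 4 ∧ 2 * ε ≤ ε₀ :=
    ⟨min (1 / 4) (ε₀ / 2), by positivity, min_le_left _ _, by
      linarith [min_le_right (1 / 4 : ℝ) (ε₀ / 2)]⟩
  have hpow : Tendsto (fun k : ℕ => (2 : ℝ) ^ k) atTop atTop :=
    tendsto_pow_atTop_atTop_of_one_lt (by norm_num)
  have hpow2 : Tendsto (fun k : ℕ => ((2 : ℝ) ^ k) ^ (2 * α)) atTop atTop :=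
    (tendsto_rpow_atTop (by linarith)).comp hpow
  obtain ⟨K, hK⟩ := eventually_atTop.1 ((hpow.eventually_ge_atTop (‖x‖ / ε)).and
    (hpow2.eventually_ge_atTop (4 * uHom2a α f x / c)))
  let A : ℕ → Set (EuclideanSpace ℝ (Fin N)) := fun k =>
    Metric.ball ((2 : ℝ) ^ (K + k) • e) ((2 : ℝ) ^ (K + k) * ε)
  have hA : ∀ k, MeasurableSet (A k) := fun k => measurableSet_ball
  have hnorm : ∀ k, ∀ y ∈ A k, (2 : ℝ) ^ (K + k) * (3 / 4) < ‖y‖ ∧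
      ‖y‖ < (2 : ℝ) ^ (K + k) * (5 / 4) := by
    intro k y hy
    have hy' : ‖y - (2 : ℝ) ^ (K + k) • e‖ < (2 : ℝ) ^ (K + k) * ε := by
      simpa [A, dist_eq_norm] using hy
    have hs : ‖(2 : ℝ) ^ (K + k) • e‖ = 2 ^ (K + k) := by
      rw [norm_smul, he1]; simp
    have hp : (0 : ℝ) < 2 ^ (K + k) := by positivity
    have h3 := abs_norm_sub_norm_le y ((2 : ℝ) ^ (K + k) • e)
    rw [hs] at h3
    have h4 := abs_le.1 h3
    constructor <;> nlinarith
  have hdisj : Pairwise (Function.onFun Disjoint A) := by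
    have hlt : ∀ i j, i < j → Disjoint (A i) (A j) := by
      intro i j hij
      rw [Set.disjoint_left]
      intro y hyi hyj
      have h3 := (hnorm i y hyi).2
      have h4 := (hnorm j y hyj).1
      have h5 : (2 : ℝ) ^ (K + i + 1) ≤ 2 ^ (K + j) :=
        pow_le_pow_right₀ (by norm_num) (by omega)
      rw [pow_succ] at h5
      have hp : (0 : ℝ) < 2 ^ (K + i) := by positivity
      linarith
    intro i j hij
    rcases lt_or_gt_of_ne hij with h | h
    · exact hlt i j h
    · exact (hlt j i h).symm
  let m : ENNReal := ENNReal.ofReal (c / 2 * 2 ^ (-((N : ℝ) + 2 * α))) *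
    volume (Metric.ball (0 : EuclideanSpace ℝ (Fin N)) ε)
  have hm : m ≠ 0 := by
    refine mul_ne_zero ?_ (Metric.measure_ball_pos _ _ hε).ne'
    rw [Ne, ENNReal.ofReal_eq_zero, not_le]
    positivity
  have hle : ∀ k, m ≤ ∫⁻ y in A k,
      ENNReal.ofReal (max (nlD (uHom2a α f) x y) 0 * ‖y‖ ^ (-((N : ℝ) + 2 * α))) := by
    intro k
    obtain ⟨hk1, hk2⟩ := hK (K + k) (by omega)
    have hAk : A k = Metric.ball ((2 : ℝ) ^ (K + k) • e) ((2 : ℝ) ^ (K + k) * ε) := rfl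
    have hnk := hnorm k
    have hT : (0 : ℝ) < 2 ^ (K + k) := by positivity
    generalize (2 : ℝ) ^ (K + k) = T at hk1 hk2 hAk hnk hT
    calc m = ENNReal.ofReal (c / 2 * T ^ (2 * α) * (2 * T) ^ (-((N : ℝ) + 2 * α))) *
          volume (A k) := by
          rw [hAk, Measure.addHaar_ball_mul_of_pos _ _ hT, ← mul_assoc,
            ← ENNReal.ofReal_mul (by positivity)]
          simp only [m]
          congr 2
          rw [finrank_euclideanSpace, Fintype.card_fin, Real.mul_rpow (by norm_num) hT.le,
            ← Real.rpow_natCast T N]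
          have : T ^ (2 * α) * T ^ (-((N : ℝ) + 2 * α)) * T ^ (N : ℝ) = 1 := by
            rw [← Real.rpow_add hT, ← Real.rpow_add hT]
            ring_nf; simp
          linear_combination (-(c / 2 * 2 ^ (-((N : ℝ) + 2 * α)))) * this
      _ = ∫⁻ y in A k, ENNReal.ofReal (c / 2 * T ^ (2 * α) * (2 * T) ^ (-((N : ℝ) + 2 * α))) := by
          rw [setLIntegral_const]
      _ ≤ _ := by
          refine setLIntegral_mono' (hA k) fun y hy => ENNReal.ofReal_le_ofReal ?_
          obtain ⟨hn1, hn2⟩ := hnk y hy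
          have hy0 : 0 < ‖y‖ := by linarith
          refine mul_le_mul ?_ ?_ (by positivity) (le_max_right _ _)
          · refine le_trans ?_ (le_max_left _ _)
            have hz : x + y = T • (T⁻¹ • (x + y)) := by
              rw [smul_smul, mul_inv_cancel₀ hT.ne', one_smul]
            have hin : T⁻¹ • (x + y) ∈ Metric.ball e ε₀ := by
              rw [Metric.mem_ball, dist_eq_norm]
              have h5 : T⁻¹ • (x + y) - e = T⁻¹ • (x + (y - T • e)) := by
                rw [smul_add, smul_add, smul_sub, smul_smul, inv_mul_cancel₀ hT.ne', one_smul]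
                abel
              have hy' : ‖y - T • e‖ < T * ε := by
                rw [hAk] at hy
                simpa [dist_eq_norm] using hy
              have hx' : ‖x‖ ≤ T * ε := by rwa [div_le_iff₀ hε] at hk1
              have h6 := norm_add_le x (y - T • e)
              rw [h5, norm_smul, norm_inv, Real.norm_of_nonneg hT.le, inv_mul_lt_iff₀ hT]
              nlinarith
            have h7 := hball _ hin
            have h8 : uHom2a α f (x + y) = T ^ (2 * α) * uHom2a α f (T⁻¹ • (x + y)) := by
              conv_lhs => rw [hz]
              exact uHom2a_smul α f _ T hT
            have hTp : 0 < T ^ (2 * α) := by positivity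
            have h9 : 4 * uHom2a α f x ≤ T ^ (2 * α) * c := by
              rwa [div_le_iff₀ hcpos] at hk2
            have h10 : T ^ (2 * α) * c ≤ uHom2a α f (x + y) := by
              rw [h8]; exact mul_le_mul_of_nonneg_left h7.le hTp.le
            unfold nlD
            linarith [hu (x - y)]
          · exact Real.rpow_le_rpow_of_nonpos hy0 (by linarith) (by
              have : (0 : ℝ) ≤ N := Nat.cast_nonneg N
              linarith)
  rw [eq_top_iff]
  calc (⊤ : ENNReal) = ∑' _ : ℕ, m := (ENNReal.tsum_const_eq_top_of_ne_zero hm).symm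
    _ ≤ ∑' k, ∫⁻ y in A k,
      ENNReal.ofReal (max (nlD (uHom2a α f) x y) 0 * ‖y‖ ^ (-((N : ℝ) + 2 * α))) :=
        ENNReal.tsum_le_tsum hle
    _ = ∫⁻ y in ⋃ k, A k,
      ENNReal.ofReal (max (nlD (uHom2a α f) x y) 0 * ‖y‖ ^ (-((N : ℝ) + 2 * α))) :=
        (lintegral_iUnion hA hdisj _).symm
    _ ≤ _ := setLIntegral_le_lintegral _ _

end Helpers

/-- No positive `2α`-homogeneous supersolutions: the bound `β⁻ > -2α` in
Lemma 3.2. -/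
theorem no_two_alpha_homogeneous_supersolution
    (N : ℕ) (hN : 2 ≤ N) (α : ℝ) (hα : α ∈ Set.Ioo (0 : ℝ) 1)
    (f : EuclideanSpace ℝ (Fin N) → ℝ)
    (hf : ContDiff ℝ 2 f)
    (hf_nonneg : ∀ e ∈ Metric.sphere (0 : EuclideanSpace ℝ (Fin N)) 1, 0 ≤ f e)
    (hf_pos : ∃ e₀ ∈ Metric.sphere (0 : EuclideanSpace ℝ (Fin N)) 1, 0 < f e₀) :
    ∀ x : EuclideanSpace ℝ (Fin N), x ≠ 0 →
      (∫⁻ y, ENNReal.ofReal (max (nlD (uHom2a α f) x y) 0 * ‖y‖ ^ (-((N : ℝ) + 2 * α))) = ⊤) ∧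
      (∫⁻ y, ENNReal.ofReal (max (-nlD (uHom2a α f) x y) 0 * ‖y‖ ^ (-((N : ℝ) + 2 * α))) < ⊤) ∧
      ¬ Integrable (fun y => nlD (uHom2a α f) x y * ‖y‖ ^ (-((N : ℝ) + 2 * α))) := by
  intro x hx
  have htop := pos_part_top hN α hα f hf hf_nonneg hf_pos x
  refine ⟨htop, neg_part_finite hN α hα f hf hf_nonneg x hx, fun hint => ?_⟩
  have hlt := hint.norm.lintegral_lt_top
  refine absurd htop (ne_of_lt (lt_of_le_of_lt (lintegral_mono fun y => ?_) hlt))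
  refine ENNReal.ofReal_le_ofReal ?_
  rw [norm_mul, Real.norm_eq_abs, Real.norm_of_nonneg (by positivity)]
  exact mul_le_mul_of_nonneg_right (max_le (le_abs_self _) (abs_nonneg _)) (by positivity)
end

section
/- The function (x·ν)₊^α is α-harmonic on a half-space, and is a classical supersolution for M⁻ (used in Lemma 3.1(ii)). Let N ≥ 2, α ∈ (0,1), and let ν ∈ ℝ^N be a unit vector. Define u(z) = max(z·ν, 0)^α. Then for every x ∈ ℝ^N with x·ν > 0: (a) the function y ↦ δ(u,x,y) |y|^{−(N+2α)} is Lebesgue integrable on ℝ^N and ∫_{ℝ^N} δ(u,x,y) |y|^{−(N+2α)} dy = 0; (b) consequently, for any 0 < λ ≤ Λ, the function y ↦ S₋(δ(u,x,y)) |y|^{−(N+2α)} is Lebesgue integrable and ∫_{ℝ^N} S₋(δ(u,x,y)) |y|^{−(N+2α)} dy ≤ 0, i.e. M⁻(u)(x) ≤ 0 at every point of the half-space {x : x·ν > 0}. -/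
open MeasureTheory RealInnerProductSpace

/-- `S₋(t) = λ t⁺ - Λ t⁻`. -/
noncomputable def Sminus (l L t : ℝ) : ℝ := l * max t 0 - L * max (-t) 0

/-- Normalized one-dimensional second difference. -/
noncomputable def hpD (α t : ℝ) : ℝ := max (1 + t) 0 ^ α + max (1 - t) 0 ^ α - 2

/-- Majorant. -/
noncomputable def hpm (α t : ℝ) : ℝ := if t ≤ 1 then t ^ 2 else t ^ α

lemma hpD_neg (α t : ℝ) : hpD α (-t) = hpD α t := by
  unfold hpD; rw [sub_neg_eq_add, ← sub_eq_add_neg]; ring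

lemma hpD_abs (α t : ℝ) : hpD α |t| = hpD α t := by
  rcases abs_choice t with h | h <;> rw [h]
  exact hpD_neg α t

lemma hpD_cont {α : ℝ} (h0 : 0 < α) : Continuous (hpD α) := by
  unfold hpD
  have := h0.le
  fun_prop (disch := simp [this])

lemma hpm_nonneg {α t : ℝ} (ht : 0 ≤ t) : 0 ≤ hpm α t := by
  unfold hpm; split_ifs <;> positivity

lemma hpm_mono {α s t : ℝ} (h0 : 0 < α) (hs : 0 ≤ s) (hst : s ≤ t) : hpm α s ≤ hpm α t := by
  unfold hpm
  split_ifs with h1 h2 h2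
  · gcongr
  · have : 1 ≤ t ^ α := Real.one_le_rpow (by linarith) h0.le
    nlinarith
  · linarith
  · gcongr

lemma hpD_bound_nonneg {α t : ℝ} (h0 : 0 < α) (h1 : α < 1) (ht : 0 ≤ t) :
    |hpD α t| ≤ 2 * hpm α t := by
  unfold hpD hpm
  split_ifs with h
  · rw [max_eq_left (by linarith), max_eq_left (by linarith), abs_le]
    have hA := rpow_one_add_le_one_add_mul_self (s := t) (by linarith) h0.le h1.le
    have hB := rpow_one_add_le_one_add_mul_self (s := -t) (by linarith) h0.le h1.le
    rw [← sub_eq_add_neg] at hB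
    constructor
    · have hp : 0 ≤ 1 - t ^ 2 := by nlinarith
      have h3 : 1 - t ^ 2 ≤ (1 - t ^ 2) ^ α := by
        rcases hp.eq_or_lt with h | h
        · rw [← h, Real.zero_rpow h0.ne']
        · calc 1 - t ^ 2 = (1 - t ^ 2) ^ (1 : ℝ) := by simp
            _ ≤ _ := Real.rpow_le_rpow_of_exponent_ge h (by nlinarith) h1.le
      have h4 : (1 - t ^ 2) ^ α = (1 + t) ^ α * (1 - t) ^ α := by
        rw [← Real.mul_rpow (by linarith) (by linarith)]; congr 1; ring
      have h5 : 0 ≤ (1 + t) ^ α := by positivity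
      have h6 : 0 ≤ (1 - t) ^ α := Real.rpow_nonneg (by linarith) _
      have h7 : (1 - t ^ 2) ^ 2 ≤ 1 - t ^ 2 := by nlinarith
      have h8 : 1 - t ^ 2 ≤ ((1 + t) ^ α + (1 - t) ^ α) / 2 := by
        apply abs_le_of_sq_le_sq' _ (by positivity) |>.2
        nlinarith [sq_nonneg ((1 + t) ^ α - (1 - t) ^ α)]
      linarith
    · nlinarith
  · push Not at h
    rw [max_eq_left (by linarith), max_eq_right (by linarith), Real.zero_rpow h0.ne', abs_le]
    have h2 : 1 ≤ t ^ α := Real.one_le_rpow h.le h0.le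
    have h3 : (1 + t) ^ α ≤ (2 * t) ^ α := by gcongr; linarith
    rw [Real.mul_rpow (by norm_num) ht] at h3
    have h4 : (2 : ℝ) ^ α ≤ 2 := by
      calc (2 : ℝ) ^ α ≤ 2 ^ (1 : ℝ) := Real.rpow_le_rpow_of_exponent_le (by norm_num) h1.le
        _ = 2 := by simp
    have h5 : 0 ≤ (1 + t) ^ α := by positivity
    constructor <;> nlinarith

lemma hpD_bound {α t r : ℝ} (h0 : 0 < α) (h1 : α < 1) (ht : |t| ≤ r) :
    |hpD α t| ≤ 2 * hpm α r := by
  rw [← hpD_abs]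
  have := hpD_bound_nonneg h0 h1 (abs_nonneg t)
  have := hpm_mono h0 (abs_nonneg t) ht
  linarith

lemma hpm_int {α a : ℝ} (h0 : 0 < α) (h1 : α < 1) (ha : 0 < a) :
    IntegrableOn (fun t => hpm α (t / a) * t ^ (-1 - 2 * α)) (Set.Ioi 0) := by
  rw [← Set.Ioc_union_Ioi_eq_Ioi ha.le]
  apply IntegrableOn.union
  · have : IntegrableOn (fun t : ℝ => (a ^ 2)⁻¹ * t ^ (1 - 2 * α)) (Set.Ioc 0 a) :=
      ((intervalIntegral.intervalIntegrable_rpow' (a := 0) (b := a) (r := 1 - 2 * α)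
        (by linarith)).1).const_mul _
    refine this.congr_fun ?_ measurableSet_Ioc
    intro t ht
    have h2 : t / a ≤ 1 := (div_le_one ha).2 ht.2
    simp only [hpm, h2, if_true]
    rw [show 1 - 2 * α = 2 + (-1 - 2 * α) by ring, Real.rpow_add ht.1, Real.rpow_two]
    field_simp
  · have : IntegrableOn (fun t : ℝ => (a ^ α)⁻¹ * t ^ (-1 - α)) (Set.Ioi a) :=
      (integrableOn_Ioi_rpow_of_lt (by linarith) ha).const_mul _
    refine this.congr_fun ?_ measurableSet_Ioi
    intro t ht
    have ht : a < t := ht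
    have h2 : ¬ t / a ≤ 1 := by rw [div_le_one ha]; linarith
    simp only [hpm, h2, if_false]
    rw [show -1 - α = α + (-1 - 2 * α) by ring, Real.rpow_add (by linarith),
      Real.div_rpow (by linarith) ha.le]
    field_simp

lemma hpD_int {α : ℝ} (h0 : 0 < α) (h1 : α < 1) :
    IntegrableOn (fun t => hpD α t * t ^ (-1 - 2 * α)) (Set.Ioi 0) := by
  refine Integrable.mono' ((hpm_int h0 h1 one_pos).const_mul 2) ?_ ?_
  · have := (hpD_cont h0).measurable
    apply Measurable.aestronglyMeasurable
    fun_prop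
  · filter_upwards [ae_restrict_mem measurableSet_Ioi] with t ht
    have ht : 0 < t := ht
    have h2 := hpD_bound h0 h1 (abs_of_pos ht).le
    have h3 : 0 ≤ t ^ (-1 - 2 * α) := by positivity
    rw [Real.norm_eq_abs, abs_mul, abs_of_nonneg h3, div_one, ← mul_assoc]
    gcongr

/-- Auxiliary weight. -/
noncomputable def hpw (α s : ℝ) : ℝ := max (1 - s) 0 ^ α * s ^ (-1 - 2 * α)

lemma hpw_contAt {α s : ℝ} (h0 : 0 < α) (hs : 0 < s) : ContinuousAt (hpw α) s := by
  unfold hpw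
  refine ContinuousAt.mul ?_ (Real.continuousAt_rpow_const _ _ (Or.inl hs.ne'))
  refine ContinuousAt.rpow_const (by fun_prop) (Or.inr h0.le)

lemma hpw_intble {α a b : ℝ} (h0 : 0 < α) (ha : 0 < a) (hb : 0 < b) :
    IntervalIntegrable (hpw α) volume a b := by
  apply ContinuousOn.intervalIntegrable
  intro s hs
  exact (hpw_contAt h0 ((lt_min ha hb).trans_le hs.1)).continuousWithinAt

lemma hpW_deriv {α s : ℝ} (h0 : 0 < α) (hs : 0 < s) :
    HasDerivAt (fun x => ∫ y in (1 : ℝ)..x, hpw α y) (hpw α s) s := by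
  refine intervalIntegral.integral_hasDerivAt_right (hpw_intble h0 one_pos hs) ?_
    (hpw_contAt h0 hs)
  refine ContinuousAt.stronglyMeasurableAtFilter isOpen_Ioi
    (fun x hx => hpw_contAt h0 hx) s hs

/-- Primitive. -/
noncomputable def hpP (α t : ℝ) : ℝ :=
  (∫ y in (1 : ℝ)..(t / (1 + t)), hpw α y) - (∫ y in (1 : ℝ)..t, hpw α y)
    + α⁻¹ * (t ^ (-(2 * α)) * ((1 + t) ^ α - 1))

lemma hpP_deriv {α t : ℝ} (h0 : 0 < α) (ht : 0 < t) :
    HasDerivAt (hpP α) (-(hpD α t * t ^ (-1 - 2 * α))) t := by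
  have h1t : 0 < 1 + t := by linarith
  have hA : HasDerivAt (fun t : ℝ => t / (1 + t)) (1 / (1 + t) ^ 2) t := by
    refine ((hasDerivAt_id' t).div ((hasDerivAt_id' t).const_add 1) h1t.ne').congr_deriv ?_
    congr 1; ring
  have hB := (hpW_deriv h0 (s := t / (1 + t)) (by positivity)).comp t hA
  have hC := hpW_deriv h0 ht
  have hE : HasDerivAt (fun t : ℝ => t ^ (-(2 * α))) (-(2 * α) * t ^ (-(2 * α) - 1)) t :=
    Real.hasDerivAt_rpow_const (Or.inl ht.ne')
  have hF : HasDerivAt (fun t : ℝ => (1 + t) ^ α - 1) (1 * α * (1 + t) ^ (α - 1)) t :=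
    (((hasDerivAt_id t).const_add 1).rpow_const (Or.inl h1t.ne')).sub_const 1
  have := (hB.sub hC).add ((hE.mul hF).const_mul α⁻¹)
  unfold hpP
  refine this.congr_deriv ?_
  unfold hpw hpD
  have e1 : 1 - t / (1 + t) = (1 + t)⁻¹ := by field_simp; ring
  have e2 : max (1 + t) 0 = 1 + t := max_eq_left h1t.le
  have e3 : max (1 + t)⁻¹ 0 = (1 + t)⁻¹ := max_eq_left (by positivity)
  rw [e1, e2, e3, Real.div_rpow ht.le h1t.le, Real.inv_rpow h1t.le,
    show -(2 * α) - 1 = -1 - 2 * α by ring, show -(2 * α) = 1 + (-1 - 2 * α) by ring,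
    Real.rpow_add ht, Real.rpow_sub_one h1t.ne', Real.rpow_one,
    show (1 + t) ^ (-1 - 2 * α) = ((1 + t) * (1 + t) ^ α * (1 + t) ^ α)⁻¹ by
      rw [show -1 - 2 * α = -(1 + α + α) by ring, Real.rpow_neg h1t.le, Real.rpow_add h1t,
        Real.rpow_add h1t, Real.rpow_one]]
  have hp : 0 < (1 + t) ^ α := by positivity
  generalize (1 + t) ^ α = A at *
  generalize max (1 - t) 0 ^ α = B at *
  generalize t ^ (-1 - 2 * α) = T at *
  field_simp
  ring

lemma hpP_zero (α : ℝ) : hpP α 0 = 0 := by simp [hpP]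

lemma hpP_bound {α t : ℝ} (h0 : 0 < α) (h1 : α < 1) (ht : 0 < t) (ht1 : t < 1) :
    |hpP α t| ≤ α⁻¹ * 3 * t ^ (2 - 2 * α) := by
  have h1t : 0 < 1 + t := by linarith
  have hq : 0 < t / (1 + t) := by positivity
  have hle : t / (1 + t) ≤ t := div_le_self ht.le (by linarith)
  have e : hpP α t = α⁻¹ * (t ^ (-(2 * α)) * ((1 + t) ^ α - 1))
      - ∫ y in (t / (1 + t))..t, hpw α y := by
    unfold hpP
    have := intervalIntegral.integral_add_adjacent_intervals
      (hpw_intble h0 one_pos hq) (hpw_intble h0 hq ht)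
    rw [← this]; ring
  have hpi : IntervalIntegrable (fun y : ℝ => y ^ (-1 - 2 * α)) volume (t / (1 + t)) t := by
    apply ContinuousOn.intervalIntegrable
    intro s hs
    refine (Real.continuousAt_rpow_const _ _ (Or.inl ?_)).continuousWithinAt
    exact ((lt_min hq ht).trans_le hs.1).ne'
  have hJ : ∫ y in (t / (1 + t))..t, y ^ (-1 - 2 * α)
      = (2 * α)⁻¹ * (t ^ (-(2 * α)) * ((1 + t) ^ α * (1 + t) ^ α - 1)) := by
    rw [integral_rpow]
    · rw [show -1 - 2 * α + 1 = -(2 * α) by ring, Real.div_rpow ht.le h1t.le,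
        Real.rpow_neg h1t.le, two_mul, Real.rpow_add h1t]
      field_simp
      ring
    · right
      refine ⟨by linarith, ?_⟩
      intro h
      exact absurd ((lt_min hq ht).trans_le h.1) (lt_irrefl _)
  have hup : ∫ y in (t / (1 + t))..t, hpw α y ≤ ∫ y in (t / (1 + t))..t, y ^ (-1 - 2 * α) := by
    apply intervalIntegral.integral_mono_on hle (hpw_intble h0 hq ht) hpi
    intro s hs
    have hs0 : 0 < s := hq.trans_le hs.1
    unfold hpw
    apply mul_le_of_le_one_left (by positivity)
    exact Real.rpow_le_one (le_max_right _ _) (max_le (by linarith) (by norm_num)) h0.le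
  have hlo : (1 - t) * ∫ y in (t / (1 + t))..t, y ^ (-1 - 2 * α)
      ≤ ∫ y in (t / (1 + t))..t, hpw α y := by
    rw [← intervalIntegral.integral_const_mul]
    apply intervalIntegral.integral_mono_on hle (hpi.const_mul _) (hpw_intble h0 hq ht)
    intro s hs
    have hs0 : 0 < s := hq.trans_le hs.1
    unfold hpw
    refine mul_le_mul_of_nonneg_right ?_ (by positivity)
    calc 1 - t = (1 - t) ^ (1 : ℝ) := by simp
      _ ≤ (1 - t) ^ α := Real.rpow_le_rpow_of_exponent_ge (by linarith) (by linarith) h1.le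
      _ ≤ _ := Real.rpow_le_rpow (by linarith) (le_max_of_le_left (by linarith [hs.2])) h0.le
  have hA := rpow_one_add_le_one_add_mul_self (s := t) (by linarith) h0.le h1.le
  have hA1 : 1 ≤ (1 + t) ^ α := Real.one_le_rpow (by linarith) h0.le
  have hT : t ^ (2 - 2 * α) = t ^ (-(2 * α)) * t ^ 2 := by
    rw [show 2 - 2 * α = -(2 * α) + 2 by ring, Real.rpow_add ht, Real.rpow_two]
  have hT0 : 0 < t ^ (-(2 * α)) := by positivity
  rw [hJ] at hup hlo
  rw [e, hT]
  generalize (∫ y in (t / (1 + t))..t, hpw α y) = J at *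
  generalize (1 + t) ^ α = A at *
  generalize t ^ (-(2 * α)) = T at *
  have hA2 : A - 1 ≤ t := by nlinarith
  rw [mul_inv] at hup hlo
  have hi : 0 < α⁻¹ := by positivity
  generalize α⁻¹ = c at *
  have hcT : 0 < c * T := by positivity
  have k1 : (A - 1) ^ 2 ≤ t ^ 2 := by nlinarith
  have k2 : A * A - 1 ≤ 3 * t := by nlinarith
  have k3 : t * (A * A - 1) ≤ 3 * t ^ 2 := by nlinarith
  rw [abs_le]
  constructor
  · have := mul_le_mul_of_nonneg_left k1 hcT.le
    have := mul_nonneg hcT.le (sq_nonneg t)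
    nlinarith
  · have := mul_le_mul_of_nonneg_left k3 hcT.le
    have := mul_nonneg hcT.le (sq_nonneg t)
    have := mul_nonneg hcT.le (sq_nonneg (A - 1))
    nlinarith

lemma hpP_cont0 {α : ℝ} (h0 : 0 < α) (h1 : α < 1) :
    ContinuousWithinAt (hpP α) (Set.Ici 0) 0 := by
  unfold ContinuousWithinAt
  rw [hpP_zero]
  have hl : Filter.Tendsto (fun t : ℝ => α⁻¹ * 3 * t ^ (2 - 2 * α)) (nhdsWithin 0 (Set.Ici 0))
      (nhds 0) := by
    have : ContinuousAt (fun t : ℝ => α⁻¹ * 3 * t ^ (2 - 2 * α)) 0 :=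
      (Real.continuousAt_rpow_const _ _ (Or.inr (by linarith))).const_mul _
    have h := this.tendsto
    rw [Real.zero_rpow (by linarith), mul_zero] at h
    exact h.mono_left nhdsWithin_le_nhds
  refine squeeze_zero_norm' ?_ hl
  have : Set.Iio (1 : ℝ) ∈ nhdsWithin (0 : ℝ) (Set.Ici 0) :=
    nhdsWithin_le_nhds (Iio_mem_nhds one_pos)
  filter_upwards [this, self_mem_nhdsWithin] with t h2 h3
  rcases (show (0 : ℝ) ≤ t from h3).eq_or_lt with h | h
  · rw [← h, hpP_zero, norm_zero, Real.zero_rpow (by linarith), mul_zero]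
  · exact hpP_bound h0 h1 h h2

lemma hpP_top {α : ℝ} (h0 : 0 < α) : Filter.Tendsto (hpP α) Filter.atTop (nhds 0) := by
  have hq : Filter.Tendsto (fun t : ℝ => t / (1 + t)) Filter.atTop (nhds 1) := by
    have : Filter.Tendsto (fun t : ℝ => 1 - (1 + t)⁻¹) Filter.atTop (nhds (1 - 0)) :=
      tendsto_const_nhds.sub (tendsto_inv_atTop_zero.comp
        (Filter.tendsto_atTop_add_const_left _ 1 Filter.tendsto_id))
    rw [sub_zero] at this
    refine this.congr' ?_
    filter_upwards [Filter.eventually_gt_atTop 0] with t ht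
    field_simp
    ring
  have hA := (hpW_deriv h0 (s := 1) one_pos).continuousAt.tendsto.comp hq
  rw [intervalIntegral.integral_same] at hA
  have hB : Filter.Tendsto (fun t : ℝ => ∫ y in (1 : ℝ)..t, hpw α y) Filter.atTop (nhds 0) := by
    refine tendsto_const_nhds.congr' ?_
    filter_upwards [Filter.eventually_ge_atTop 1] with t ht
    symm
    apply intervalIntegral.integral_zero_ae
    refine .of_forall fun y hy => ?_
    rw [Set.uIoc_of_le ht] at hy
    have := hy.1
    rw [hpw, max_eq_right (by linarith), Real.zero_rpow h0.ne', zero_mul]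
  have hC : Filter.Tendsto (fun t : ℝ => t ^ (-(2 * α)) * ((1 + t) ^ α - 1))
      Filter.atTop (nhds 0) := by
    have h := (tendsto_rpow_neg_atTop h0).const_mul (2 ^ α)
    rw [mul_zero] at h
    refine squeeze_zero' ?_ ?_ h
    · filter_upwards [Filter.eventually_ge_atTop 1] with t ht
      have := Real.one_le_rpow (x := 1 + t) (by linarith) h0.le
      exact mul_nonneg (by positivity) (by linarith)
    · filter_upwards [Filter.eventually_ge_atTop 1] with t ht
      have h2 : (1 + t) ^ α ≤ (2 * t) ^ α := by gcongr; linarith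
      rw [Real.mul_rpow (by norm_num) (by linarith)] at h2
      have h3 : t ^ (-α) = t ^ (-(2 * α)) * t ^ α := by
        rw [← Real.rpow_add (by linarith)]; congr 1; ring
      rw [h3]
      have h4 : 0 ≤ t ^ (-(2 * α)) := by positivity
      nlinarith
  have := (hA.sub hB).add (hC.const_mul α⁻¹)
  unfold hpP
  simpa using this

lemma hpD_integral {α : ℝ} (h0 : 0 < α) (h1 : α < 1) :
    ∫ t in Set.Ioi (0 : ℝ), hpD α t * t ^ (-1 - 2 * α) = 0 := by
  have := integral_Ioi_of_hasDerivAt_of_tendsto (hpP_cont0 h0 h1)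
    (fun x hx => hpP_deriv h0 hx) (hpD_int h0 h1).neg (hpP_top h0)
  rw [hpP_zero, sub_zero, integral_neg] at this
  linarith

lemma hpD_integral_scaled {α : ℝ} (h0 : 0 < α) (h1 : α < 1) (c : ℝ) :
    ∫ t in Set.Ioi (0 : ℝ), hpD α (c * t) * t ^ (-1 - 2 * α) = 0 := by
  rcases eq_or_ne c 0 with rfl | hc
  · simp [hpD]; norm_num
  have hc' : 0 < |c| := abs_pos.2 hc
  have := integral_comp_mul_left_Ioi (fun t => hpD α t * t ^ (-1 - 2 * α)) 0 hc'
  rw [mul_zero, hpD_integral h0 h1, smul_zero] at this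
  have h2 : ∫ t in Set.Ioi (0 : ℝ), hpD α (c * t) * t ^ (-1 - 2 * α)
      = ∫ t in Set.Ioi (0 : ℝ), (|c| ^ (-1 - 2 * α))⁻¹ *
        (hpD α (|c| * t) * (|c| * t) ^ (-1 - 2 * α)) := by
    refine setIntegral_congr_fun measurableSet_Ioi fun t ht => ?_
    have ht : 0 < t := ht
    have hp : 0 < |c| ^ (-1 - 2 * α) := by positivity
    rw [Real.mul_rpow hc'.le ht.le, ← hpD_abs α (c * t), abs_mul, abs_of_pos ht]
    field_simp
  rw [h2, integral_const_mul, this, mul_zero]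

lemma hp_nlD {N : ℕ} {α : ℝ} (ν x y : EuclideanSpace ℝ (Fin N)) (hx : 0 < ⟪x, ν⟫) :
    nlD (fun z => max ⟪z, ν⟫ 0 ^ α) x y
      = ⟪x, ν⟫ ^ α * hpD α (⟪y, ν⟫ / ⟪x, ν⟫) := by
  unfold nlD hpD
  simp only [inner_add_left, inner_sub_left]
  generalize (⟪x, ν⟫ : ℝ) = a at *
  generalize (⟪y, ν⟫ : ℝ) = b at *
  rw [mul_sub, mul_add, ← Real.mul_rpow hx.le (le_max_right _ _),
    ← Real.mul_rpow hx.le (le_max_right _ _), mul_max_of_nonneg _ _ hx.le,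
    mul_max_of_nonneg _ _ hx.le, mul_zero, max_eq_left hx.le]
  have e1 : a * (1 + b / a) = a + b := by field_simp
  have e2 : a * (1 - b / a) = a - b := by field_simp
  rw [e1, e2]; ring

lemma hp_pow {N : ℕ} (hN : 2 ≤ N) {r α : ℝ} (hr : 0 < r) :
    r ^ (N - 1) * r ^ (-((N : ℝ) + 2 * α)) = r ^ (-1 - 2 * α) := by
  rw [← Real.rpow_natCast, ← Real.rpow_add hr, Nat.cast_sub (by omega)]
  congr 1; push_cast; ring

lemma hp_integrable {N : ℕ} (hN : 2 ≤ N) {α : ℝ} (h0 : 0 < α) (h1 : α < 1)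
    (ν : EuclideanSpace ℝ (Fin N)) (hν : ‖ν‖ = 1) {a : ℝ} (ha : 0 < a) :
    Integrable (fun y : EuclideanSpace ℝ (Fin N) =>
      hpD α (⟪y, ν⟫ / a) * ‖y‖ ^ (-((N : ℝ) + 2 * α))) := by
  have : Nontrivial (EuclideanSpace ℝ (Fin N)) :=
    ⟨ν, 0, by intro h; rw [h, norm_zero] at hν; norm_num at hν⟩
  have hm : Integrable (fun y : EuclideanSpace ℝ (Fin N) =>
      (fun r : ℝ => hpm α (r / a) * r ^ (-((N : ℝ) + 2 * α))) ‖y‖) := by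
    rw [integrable_fun_norm_addHaar volume
      (f := fun r : ℝ => hpm α (r / a) * r ^ (-((N : ℝ) + 2 * α)))]
    refine (hpm_int h0 h1 ha).congr_fun ?_ (measurableSet_Ioi (a := (0 : ℝ)))
    intro r hr
    simp only [finrank_euclideanSpace, Fintype.card_fin, smul_eq_mul]
    rw [← hp_pow hN hr]; ring
  refine Integrable.mono' (hm.const_mul 2) ?_ ?_
  · have := (hpD_cont h0).measurable
    apply Measurable.aestronglyMeasurable
    fun_prop
  · refine .of_forall fun y => ?_
    have h3 : 0 ≤ ‖y‖ ^ (-((N : ℝ) + 2 * α)) := by positivity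
    have h4 : |⟪y, ν⟫ / a| ≤ ‖y‖ / a := by
      rw [abs_div, abs_of_pos ha]
      gcongr
      simpa [hν] using abs_real_inner_le_norm y ν
    have h2 := hpD_bound h0 h1 h4
    rw [Real.norm_eq_abs, abs_mul, abs_of_nonneg h3, ← mul_assoc]
    gcongr

lemma hp_integral {N : ℕ} (hN : 2 ≤ N) {α : ℝ} (h0 : 0 < α) (h1 : α < 1)
    (ν : EuclideanSpace ℝ (Fin N)) (hν : ‖ν‖ = 1) {a : ℝ} (ha : 0 < a) :
    ∫ y : EuclideanSpace ℝ (Fin N),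
      hpD α (⟪y, ν⟫ / a) * ‖y‖ ^ (-((N : ℝ) + 2 * α)) = 0 := by
  have : Nontrivial (EuclideanSpace ℝ (Fin N)) :=
    ⟨ν, 0, by intro h; rw [h, norm_zero] at hν; norm_num at hν⟩
  set F : EuclideanSpace ℝ (Fin N) → ℝ :=
    fun y => hpD α (⟪y, ν⟫ / a) * ‖y‖ ^ (-((N : ℝ) + 2 * α)) with hF
  have hFint : Integrable F := hp_integrable hN h0 h1 ν hν ha
  set G : (Metric.sphere (0 : EuclideanSpace ℝ (Fin N)) 1) × Set.Ioi (0 : ℝ) → ℝ :=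
    fun p => F (p.2.1 • p.1.1) with hG
  have hGF : ∀ y : ({0}ᶜ : Set (EuclideanSpace ℝ (Fin N))),
      G (homeomorphUnitSphereProd _ y) = F y := by
    intro y
    have hy : ‖y.1‖ ≠ 0 := norm_ne_zero_iff.2 y.2
    simp [hG, smul_smul, hy]
  have hmp := (volume : Measure (EuclideanSpace ℝ (Fin N))).measurePreserving_homeomorphUnitSphereProd
  have e1 : ∫ y, F y = ∫ p, G p ∂((volume : Measure (EuclideanSpace ℝ (Fin N))).toSphere.prod
      (.volumeIoiPow (Module.finrank ℝ (EuclideanSpace ℝ (Fin N)) - 1))) := by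
    rw [← hmp.integral_comp (Homeomorph.measurableEmbedding _) G]
    simp_rw [hGF]
    rw [integral_subtype_comap (measurableSet_singleton _).compl F, restrict_compl_singleton]
  have hGint : Integrable G ((volume : Measure (EuclideanSpace ℝ (Fin N))).toSphere.prod
      (.volumeIoiPow (Module.finrank ℝ (EuclideanSpace ℝ (Fin N)) - 1))) := by
    rw [← hmp.integrable_comp_emb (Homeomorph.measurableEmbedding _)]
    have : G ∘ (homeomorphUnitSphereProd (EuclideanSpace ℝ (Fin N))) = F ∘ Subtype.val :=
      funext hGF
    rw [this, ← integrableOn_iff_comap_subtypeVal (measurableSet_singleton _).compl]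
    exact hFint.integrableOn
  rw [e1, integral_prod G hGint]
  apply integral_eq_zero_of_ae
  refine .of_forall fun ω => ?_
  simp only [Measure.volumeIoiPow, ENNReal.ofReal, hG, Pi.zero_apply]
  rw [integral_withDensity_eq_integral_smul
    ((measurable_subtype_coe.pow_const _).real_toNNReal),
    integral_subtype_comap (measurableSet_Ioi (a := (0 : ℝ)))
      fun r : ℝ => Real.toNNReal (r ^ (Module.finrank ℝ (EuclideanSpace ℝ (Fin N)) - 1))
        • F (r • ω.1)]
  refine Eq.trans ?_ (hpD_integral_scaled h0 h1 (⟪ω.1, ν⟫ / a))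
  refine setIntegral_congr_fun measurableSet_Ioi fun r hr => ?_
  have hr : 0 < r := hr
  rw [NNReal.smul_def, Real.coe_toNNReal _ (pow_nonneg hr.le _), smul_eq_mul, hF]
  simp only [finrank_euclideanSpace, Fintype.card_fin]
  rw [← hp_pow hN hr, norm_smul, Real.norm_eq_abs, abs_of_pos hr, norm_eq_of_mem_sphere ω,
    mul_one, real_inner_smul_left, show r * ⟪ω.1, ν⟫ / a = ⟪ω.1, ν⟫ / a * r by ring]
  ring

/-- `(x·ν)₊^α` is α-harmonic in the half-space `{x·ν > 0}`, and is a classical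
supersolution for `M⁻` there (used in Lemma 3.1(ii)). -/
theorem halfspace_power_alpha_harmonic
    (N : ℕ) (hN : 2 ≤ N) (α : ℝ) (hα : α ∈ Set.Ioo (0 : ℝ) 1)
    (ν : EuclideanSpace ℝ (Fin N)) (hν : ‖ν‖ = 1) :
    ∀ x : EuclideanSpace ℝ (Fin N), 0 < ⟪x, ν⟫ →
      (Integrable (fun y => nlD (fun z => max ⟪z, ν⟫ 0 ^ α) x y
          * ‖y‖ ^ (-((N : ℝ) + 2 * α))) ∧
       ∫ y, nlD (fun z => max ⟪z, ν⟫ 0 ^ α) x y * ‖y‖ ^ (-((N : ℝ) + 2 * α)) = 0) ∧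
      (∀ l L : ℝ, 0 < l → l ≤ L →
        Integrable (fun y => Sminus l L (nlD (fun z => max ⟪z, ν⟫ 0 ^ α) x y)
            * ‖y‖ ^ (-((N : ℝ) + 2 * α))) ∧
        ∫ y, Sminus l L (nlD (fun z => max ⟪z, ν⟫ 0 ^ α) x y)
            * ‖y‖ ^ (-((N : ℝ) + 2 * α)) ≤ 0) := by
  intro x hx
  have hI : Integrable (fun y => nlD (fun z => max ⟪z, ν⟫ 0 ^ α) x y
      * ‖y‖ ^ (-((N : ℝ) + 2 * α))) := by
    simp_rw [hp_nlD ν x _ hx, mul_assoc]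
    exact (hp_integrable hN hα.1 hα.2 ν hν hx).const_mul _
  have hZ : ∫ y, nlD (fun z => max ⟪z, ν⟫ 0 ^ α) x y * ‖y‖ ^ (-((N : ℝ) + 2 * α)) = 0 := by
    simp_rw [hp_nlD ν x _ hx, mul_assoc]
    rw [integral_const_mul, hp_integral hN hα.1 hα.2 ν hν hx, mul_zero]
  refine ⟨⟨hI, hZ⟩, fun l L hl hL => ?_⟩
  have hS : Integrable (fun y => Sminus l L (nlD (fun z => max ⟪z, ν⟫ 0 ^ α) x y)
      * ‖y‖ ^ (-((N : ℝ) + 2 * α))) := by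
    refine ((hI.pos_part.const_mul l).sub (hI.neg_part.const_mul L)).congr (.of_forall fun y => ?_)
    have h3 : 0 ≤ ‖y‖ ^ (-((N : ℝ) + 2 * α)) := by positivity
    simp only [Sminus, Pi.sub_apply]
    rw [sub_mul, mul_assoc, mul_assoc, max_mul_of_nonneg _ _ h3, max_mul_of_nonneg _ _ h3,
      zero_mul, neg_mul]
  refine ⟨hS, ?_⟩
  calc _ ≤ ∫ y, l * (nlD (fun z => max ⟪z, ν⟫ 0 ^ α) x y * ‖y‖ ^ (-((N : ℝ) + 2 * α))) := by
        refine integral_mono hS (hI.const_mul l) fun y => ?_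
        have h3 : 0 ≤ ‖y‖ ^ (-((N : ℝ) + 2 * α)) := by positivity
        simp only
        rw [← mul_assoc]
        refine mul_le_mul_of_nonneg_right ?_ h3
        generalize nlD (fun z => max ⟪z, ν⟫ 0 ^ α) x y = d
        unfold Sminus
        rcases le_total 0 d with h | h
        · rw [max_eq_left h, max_eq_right (by linarith)]; linarith
        · rw [max_eq_right h, max_eq_left (by linarith)]; nlinarith
    _ = 0 := by rw [integral_const_mul, hZ, mul_zero]
end

section
/- The Kelvin image (x_N)₊^α |x|^{−N} is α-harmonic in the half-space (Section 1, computation of β⁺ = N−α and β⁻ = −α for the fractional Laplacian). Let N ≥ 2 and α ∈ (0,1). Define u(x) = max(x_N, 0)^α |x|^{−N} for x ≠ 0 and u(0) = 0, where x_N denotes the last coordinate of x. Then for every x ∈ ℝ^N with x_N > 0, the function y ↦ δ(u,x,y) |y|^{−(N+2α)} is Lebesgue integrable on ℝ^N and ∫_{ℝ^N} δ(u,x,y) |y|^{−(N+2α)} dy = 0. -/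
open MeasureTheory Classical

section General

set_option linter.unusedSectionVars false

open Filter Topology Module

variable {E : Type*} [NormedAddCommGroup E] [InnerProductSpace ℝ E] [FiniteDimensional ℝ E]
  [MeasurableSpace E] [BorelSpace E]

/-- Second difference in a general space. -/
noncomputable def dl (f : E → ℝ) (x y : E) : ℝ := f (x + y) + f (x - y) - 2 * f x

/-- The kernel. -/
noncomputable def kerK (E : Type*) [NormedAddCommGroup E] [InnerProductSpace ℝ E] (α : ℝ) (y : E) : ℝ :=
  ‖y‖ ^ (-((finrank ℝ E : ℝ) + 2 * α))

/-- Integrability conditions at `x`. -/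
structure Good (μ : Measure E) (α : ℝ) (f : E → ℝ) (x : E) : Prop where
  d : Integrable (fun y => dl f x y * kerK E α y) μ
  m : Integrable (fun y => (f (x + y) - f x) * (min 1 ‖y‖ * kerK E α y)) μ

lemma kerK_neg (α : ℝ) (y : E) : kerK E α (-y) = kerK E α y := by simp [kerK]

lemma kerK_nonneg (α : ℝ) (y : E) : 0 ≤ kerK E α y := by unfold kerK; positivity

lemma kerK_meas (α : ℝ) : Measurable (kerK E α) := by
  unfold kerK; fun_prop

lemma Good.int_J {μ : Measure E} {α : ℝ} {f : E → ℝ} {x : E} (h : Good μ α f x) {φ : E → ℝ}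
    (hφ : Measurable φ) {C : ℝ} (hC : ∀ y, |φ y| ≤ C * min 1 ‖y‖) :
    Integrable (fun y => (f (x + y) - f x) * (φ y * kerK E α y)) μ := by
  have h1 : ∀ y, (f (x + y) - f x) * (φ y * kerK E α y)
      = (φ y / min 1 ‖y‖) * ((f (x + y) - f x) * (min 1 ‖y‖ * kerK E α y)) := by
    intro y
    by_cases hy : y = 0
    · subst hy; simp
    · have : 0 < min 1 ‖y‖ := lt_min one_pos (norm_pos_iff.2 hy)
      field_simp
  simp_rw [h1]
  refine h.m.bdd_mul (c := |C|) (Measurable.aestronglyMeasurable (by fun_prop)) (Eventually.of_forall fun y => ?_)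
  by_cases hy : y = 0
  · subst hy; simp
  have : 0 < min 1 ‖y‖ := lt_min one_pos (norm_pos_iff.2 hy)
  rw [norm_div, Real.norm_eq_abs, Real.norm_eq_abs, abs_of_pos this, div_le_iff₀ this]
  exact (hC y).trans (mul_le_mul_of_nonneg_right (le_abs_self C) this.le)

lemma reg_bound {ε ρ : ℝ} (hε : 0 < ε) (hρ : 0 ≤ ρ) :
    |ρ ^ 2 / (ρ ^ 2 + ε)| ≤ (1 + 1 / ε) * min 1 ρ := by
  rw [abs_of_nonneg (by positivity), div_le_iff₀ (by positivity)]
  rcases le_total 1 ρ with h | h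
  · rw [min_eq_left h]
    have : 0 < 1 / ε := by positivity
    nlinarith [sq_nonneg ρ]
  · rw [min_eq_right h]
    have h1 : (1 + 1 / ε) * ρ * (ρ ^ 2 + ε) = ρ ^ 3 + ρ * ε + ρ ^ 3 / ε + ρ := by
      field_simp; ring
    rw [h1]
    have : 0 ≤ ρ ^ 3 / ε := by positivity
    have : 0 ≤ ρ * ε := by positivity
    have : 0 ≤ ρ ^ 3 := by positivity
    nlinarith

lemma reg_bound2 {ε ρ m : ℝ} (hε : 0 < ε) (hρ : 0 ≤ ρ) (hm : 0 ≤ m) (hmρ : |m - 1| ≤ ρ) :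
    |ρ ^ 2 / (ρ ^ 2 + ε * m ^ 2) - ρ ^ 2 / (ρ ^ 2 + ε)| ≤ 3 * min 1 ρ := by
  have a1 : 0 ≤ ρ ^ 2 / (ρ ^ 2 + ε * m ^ 2) := by positivity
  have a2 : 0 ≤ ρ ^ 2 / (ρ ^ 2 + ε) := by positivity
  have b1 : ρ ^ 2 / (ρ ^ 2 + ε * m ^ 2) ≤ 1 := 
    div_le_one_of_le₀ (by nlinarith [mul_nonneg hε.le (sq_nonneg m)]) (by positivity)
  have b2 : ρ ^ 2 / (ρ ^ 2 + ε) ≤ 1 := 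
    div_le_one_of_le₀ (by nlinarith) (by positivity)
  rcases le_total 1 ρ with h | h
  · rw [min_eq_left h, abs_le]; constructor <;> linarith
  · rw [min_eq_right h]
    rcases hρ.eq_or_lt with h0 | h0
    · subst h0; simp
    have e : ρ ^ 2 / (ρ ^ 2 + ε * m ^ 2) - ρ ^ 2 / (ρ ^ 2 + ε)
        = (ρ ^ 2 / (ρ ^ 2 + ε * m ^ 2)) * (ε / (ρ ^ 2 + ε)) * (1 - m ^ 2) := by
      have : ρ ^ 2 + ε * m ^ 2 ≠ 0 := by positivity
      field_simp; ring
    have c2 : ε / (ρ ^ 2 + ε) ≤ 1 := div_le_one_of_le₀ (by nlinarith) (by positivity)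
    have c1 : 0 ≤ ε / (ρ ^ 2 + ε) := by positivity
    rw [e, abs_mul, abs_of_nonneg (mul_nonneg a1 c1)]
    have d1 : |1 - m ^ 2| ≤ 3 * ρ := by
      obtain ⟨h1, h2⟩ := abs_le.1 hmρ
      rw [abs_le]; constructor <;> nlinarith
    calc _ ≤ 1 * |1 - m ^ 2| := 
          mul_le_mul_of_nonneg_right (mul_le_one₀ b1 c1 c2) (abs_nonneg _)
      _ ≤ _ := by simpa using d1

variable (μ : Measure E) [μ.IsAddHaarMeasure]

lemma Good.tendsto_J {α : ℝ} {f : E → ℝ} {x : E} (h : Good μ α f x) :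
    Tendsto (fun ε : ℝ => ∫ y, (f (x + y) - f x) * (‖y‖ ^ 2 / (‖y‖ ^ 2 + ε) * kerK E α y) ∂μ)
      (𝓝[>] 0) (𝓝 ((1 / 2) * ∫ y, dl f x y * kerK E α y ∂μ)) := by
  have key : ∀ ε : ℝ, 0 < ε → 
      ∫ y, (f (x + y) - f x) * (‖y‖ ^ 2 / (‖y‖ ^ 2 + ε) * kerK E α y) ∂μ
      = (1 / 2) * ∫ y, (‖y‖ ^ 2 / (‖y‖ ^ 2 + ε)) * (dl f x y * kerK E α y) ∂μ := by
    intro ε hε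
    have hi := h.int_J (φ := fun y => ‖y‖ ^ 2 / (‖y‖ ^ 2 + ε)) (by fun_prop) 
      (fun y => reg_bound hε (norm_nonneg y))
    have h2 := integral_neg_eq_self (fun y => (f (x + y) - f x) * (‖y‖ ^ 2 / (‖y‖ ^ 2 + ε) * kerK E α y)) μ
    have hi2 := hi.comp_neg
    have h3 := integral_add hi hi2
    rw [h2] at h3
    have : ∀ y, (‖y‖ ^ 2 / (‖y‖ ^ 2 + ε)) * (dl f x y * kerK E α y)
      = (f (x + y) - f x) * (‖y‖ ^ 2 / (‖y‖ ^ 2 + ε) * kerK E α y) + 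
        (f (x + -y) - f x) * (‖-y‖ ^ 2 / (‖-y‖ ^ 2 + ε) * kerK E α (-y)) := by
      intro y; rw [kerK_neg, norm_neg, dl, ← sub_eq_add_neg]; ring
    simp_rw [this]
    rw [h3]; ring
  have lim : Tendsto (fun ε : ℝ => ∫ y, (‖y‖ ^ 2 / (‖y‖ ^ 2 + ε)) * (dl f x y * kerK E α y) ∂μ)
      (𝓝[>] 0) (𝓝 (∫ y, dl f x y * kerK E α y ∂μ)) := by
    refine tendsto_integral_filter_of_dominated_convergence 
      (fun y => ‖dl f x y * kerK E α y‖) ?_ ?_ h.d.norm ?_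
    · refine Eventually.of_forall fun ε => ?_
      exact (AEStronglyMeasurable.mul (Measurable.aestronglyMeasurable (by fun_prop)) h.d.1)
    · filter_upwards [self_mem_nhdsWithin] with ε hε
      refine Eventually.of_forall fun y => ?_
      rw [norm_mul]
      have hε' : 0 < ε := hε
      refine mul_le_of_le_one_left (norm_nonneg _) ?_
      rw [Real.norm_eq_abs, abs_of_nonneg (by positivity)]
      exact div_le_one_of_le₀ (by linarith) (by positivity)
    · refine Eventually.of_forall fun y => ?_
      by_cases hy : y = 0
      · subst hy; simp [dl]
        have : f x + f x - 2 * f x = 0 := by ring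
        simp [this]
      · have hy' : ‖y‖ ^ 2 ≠ 0 := by simpa using hy
        have : Tendsto (fun ε : ℝ => (‖y‖ ^ 2 / (‖y‖ ^ 2 + ε)) * (dl f x y * kerK E α y)) (𝓝 0)
            (𝓝 ((‖y‖ ^ 2 / (‖y‖ ^ 2 + 0)) * (dl f x y * kerK E α y))) := by
          refine Tendsto.mul_const _ (Tendsto.div tendsto_const_nhds ?_ (by simpa using hy))
          exact tendsto_const_nhds.add tendsto_id
        rw [add_zero, div_self hy', one_mul] at this
        exact this.mono_left nhdsWithin_le_nhds
  refine (lim.const_mul (1 / 2)).congr' ?_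
  filter_upwards [self_mem_nhdsWithin] with ε hε
  rw [key ε hε]

lemma Good.int_Jstar {α : ℝ} {f : E → ℝ} {x : E} (hx : ‖x‖ = 1) (h : Good μ α f x) {ε : ℝ}
    (hε : 0 < ε) :
    Integrable (fun y => (f (x + y) - f x) * (‖y‖ ^ 2 / (‖y‖ ^ 2 + ε * ‖x + y‖ ^ 2) * kerK E α y)) μ := by
  refine h.int_J (φ := fun y => ‖y‖ ^ 2 / (‖y‖ ^ 2 + ε * ‖x + y‖ ^ 2)) (by fun_prop) 
      (C := (1 + 1 / ε) + 3) (fun y => ?_)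
  have h1 := reg_bound hε (norm_nonneg y)
  have h2 := reg_bound2 (m := ‖x + y‖) hε (norm_nonneg y) (norm_nonneg _) (by
    rw [← hx]; simpa using abs_norm_sub_norm_le (x + y) x)
  have := abs_add_le (‖y‖ ^ 2 / (‖y‖ ^ 2 + ε * ‖x + y‖ ^ 2) - ‖y‖ ^ 2 / (‖y‖ ^ 2 + ε))
    (‖y‖ ^ 2 / (‖y‖ ^ 2 + ε))
  rw [sub_add_cancel] at this
  linarith

lemma Good.tendsto_Jstar {α : ℝ} {f : E → ℝ} {x : E} (hx : ‖x‖ = 1) (h : Good μ α f x) :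
    Tendsto (fun ε : ℝ => ∫ y, (f (x + y) - f x) * 
        (‖y‖ ^ 2 / (‖y‖ ^ 2 + ε * ‖x + y‖ ^ 2) * kerK E α y) ∂μ)
      (𝓝[>] 0) (𝓝 ((1 / 2) * ∫ y, dl f x y * kerK E α y ∂μ)) := by
  have lim : Tendsto (fun ε : ℝ => ∫ y, (f (x + y) - f x) * 
        ((‖y‖ ^ 2 / (‖y‖ ^ 2 + ε * ‖x + y‖ ^ 2) - ‖y‖ ^ 2 / (‖y‖ ^ 2 + ε)) * kerK E α y) ∂μ)
      (𝓝[>] 0) (𝓝 (∫ y : E, (0 : ℝ) ∂μ)) := by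
    refine tendsto_integral_filter_of_dominated_convergence 
      (fun y => 3 * ‖(f (x + y) - f x) * (min 1 ‖y‖ * kerK E α y)‖) ?_ ?_ (h.m.norm.const_mul 3) ?_
    · filter_upwards [self_mem_nhdsWithin] with ε hε
      refine (h.int_J (φ := fun y => (‖y‖ ^ 2 / (‖y‖ ^ 2 + ε * ‖x + y‖ ^ 2) - ‖y‖ ^ 2 / (‖y‖ ^ 2 + ε)))
        (by fun_prop) (C := 3) (fun y => ?_)).1
      exact reg_bound2 (m := ‖x + y‖) hε (norm_nonneg y) (norm_nonneg _) (by
        rw [← hx]; simpa using abs_norm_sub_norm_le (x + y) x)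
    · filter_upwards [self_mem_nhdsWithin] with ε hε
      refine Eventually.of_forall fun y => ?_
      have := reg_bound2 (m := ‖x + y‖) hε (norm_nonneg y) (norm_nonneg _) (by
        rw [← hx]; simpa using abs_norm_sub_norm_le (x + y) x)
      rw [norm_mul, norm_mul, norm_mul, norm_mul]
      have e : ‖min 1 ‖y‖‖ = min 1 ‖y‖ := Real.norm_of_nonneg (le_min zero_le_one (norm_nonneg y))
      rw [e]
      calc _ ≤ ‖f (x + y) - f x‖ * ((3 * min 1 ‖y‖) * ‖kerK E α y‖) := by gcongr; exact this
        _ = _ := by ring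
    · refine Eventually.of_forall fun y => ?_
      by_cases hy : y = 0
      · subst hy; simp
      · have hy' : ‖y‖ ^ 2 ≠ 0 := by simpa using hy
        have : Tendsto (fun ε : ℝ => (f (x + y) - f x) * 
            ((‖y‖ ^ 2 / (‖y‖ ^ 2 + ε * ‖x + y‖ ^ 2) - ‖y‖ ^ 2 / (‖y‖ ^ 2 + ε)) * kerK E α y)) (𝓝 0)
            (𝓝 ((f (x + y) - f x) * 
            ((‖y‖ ^ 2 / (‖y‖ ^ 2 + 0 * ‖x + y‖ ^ 2) - ‖y‖ ^ 2 / (‖y‖ ^ 2 + 0)) * kerK E α y))) := by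
          refine Tendsto.const_mul _ (Tendsto.mul_const _ (Tendsto.sub ?_ ?_))
          · refine (Tendsto.div tendsto_const_nhds ?_ (by simpa using hy))
            exact tendsto_const_nhds.add (tendsto_id.mul_const _)
          · refine (Tendsto.div tendsto_const_nhds ?_ (by simpa using hy))
            exact tendsto_const_nhds.add tendsto_id
        simp only [zero_mul, sub_self, mul_zero] at this
        exact this.mono_left nhdsWithin_le_nhds
  rw [integral_zero] at lim
  have := lim.add (h.tendsto_J μ)
  rw [zero_add] at this
  refine this.congr' ?_
  filter_upwards [self_mem_nhdsWithin] with ε hε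
  have hi := h.int_J (φ := fun y => ‖y‖ ^ 2 / (‖y‖ ^ 2 + ε)) (by fun_prop) 
      (fun y => reg_bound hε (norm_nonneg y))
  have hi2 := h.int_J (φ := fun y => (‖y‖ ^ 2 / (‖y‖ ^ 2 + ε * ‖x + y‖ ^ 2) - ‖y‖ ^ 2 / (‖y‖ ^ 2 + ε)))
        (by fun_prop) (C := 3) (fun y => reg_bound2 (m := ‖x + y‖) hε (norm_nonneg y) (norm_nonneg _) (by
        rw [← hx]; simpa using abs_norm_sub_norm_le (x + y) x))
  rw [← integral_add hi2 hi]
  congr 1; ext y; ring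

/-- The inversion. -/
noncomputable def kinv (w : E) : E := (‖w‖ ^ 2)⁻¹ • w

lemma kinv_eq (w : E) : kinv w = EuclideanGeometry.inversion 0 1 w := by
  simp [kinv, EuclideanGeometry.inversion]

lemma norm_kinv (w : E) : ‖kinv w‖ = ‖w‖⁻¹ := by
  by_cases h : w = 0
  · subst h; simp [kinv]
  have : ‖w‖ ≠ 0 := by simpa using h
  rw [kinv, norm_smul, norm_inv, norm_pow, norm_norm]
  field_simp

lemma kinv_kinv (w : E) : kinv (kinv w) = w := by
  by_cases h : w = 0
  · subst h; simp [kinv]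
  rw [kinv_eq, kinv_eq, EuclideanGeometry.inversion_inversion 0 one_ne_zero]

lemma kinv_ne {w : E} (h : w ≠ 0) : kinv w ≠ 0 := by
  have : ‖w‖ ≠ 0 := by simpa using h
  simp [kinv, h]

lemma norm_kinv_sub {x w : E} (hx : ‖x‖ = 1) (hw : w ≠ 0) : ‖kinv w - x‖ = ‖w - x‖ / ‖w‖ := by
  have hx0 : x ≠ 0 := by rintro rfl; simp at hx
  have e : kinv x = x := by simp [kinv, hx]
  have := EuclideanGeometry.dist_inversion_inversion hw hx0 1
  rw [← kinv_eq, ← kinv_eq, e] at this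
  simp [hx, dist_eq_norm] at this
  rw [this]; ring

lemma integral_kinv (g : E → ℝ) :
    ∫ z, g z ∂μ = ∫ w, ((‖w‖ ^ 2)⁻¹ ^ (finrank ℝ E)) * g (kinv w) ∂μ := by
  rcases subsingleton_or_nontrivial E with hE | hE
  · have : finrank ℝ E = 0 := finrank_zero_of_subsingleton
    have h1 : ∀ w : E, kinv w = w := fun w => Subsingleton.elim _ _
    simp [this, h1]
  have h0 : μ.restrict ({0}ᶜ : Set E) = μ := Measure.restrict_eq_self_of_ae_mem (by
    rw [ae_iff]; simp)
  have himg : (kinv : E → E) '' {0}ᶜ = {0}ᶜ := by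
    ext z; constructor
    · rintro ⟨w, hw, rfl⟩; exact kinv_ne hw
    · intro hz; exact ⟨kinv z, kinv_ne hz, kinv_kinv z⟩
  have hinj : Set.InjOn (kinv : E → E) {0}ᶜ := fun a _ b _ hab => by
    rw [← kinv_kinv a, hab, kinv_kinv]
  have := integral_image_eq_integral_abs_det_fderiv_smul μ (s := ({0}ᶜ : Set E)) 
    (f := kinv) (f' := fun w => ((1 : ℝ) / dist w 0) ^ 2 • 
      (((ℝ ∙ (w - 0))ᗮ.reflection : E ≃ₗᵢ[ℝ] E) : E →L[ℝ] E))
    (measurableSet_singleton 0).compl (fun w hw => by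
      have h := EuclideanGeometry.hasFDerivAt_inversion (c := (0 : E)) (R := 1) (x := w) hw
      have e : (EuclideanGeometry.inversion (0 : E) 1) = kinv := by
        ext z; rw [kinv_eq]
      rw [e] at h
      exact h.hasFDerivWithinAt) hinj g
  rw [himg, h0] at this
  rw [this]
  congr 1; ext w
  rw [smul_eq_mul]
  congr 1
  rw [ContinuousLinearMap.det]
  have hd : |LinearMap.det (((ℝ ∙ (w - 0))ᗮ.reflection : E ≃ₗᵢ[ℝ] E).toLinearEquiv : E →ₗ[ℝ] E)| = 1 := by
    have h := Submodule.det_reflection (𝕜 := ℝ) (ℝ ∙ (w - 0))ᗮ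
    exact (congrArg abs h).trans (by simp)
  rw [ContinuousLinearMap.toLinearMap_smul, LinearMap.det_smul, abs_mul]
  have : ((((ℝ ∙ (w - 0))ᗮ.reflection : E ≃ₗᵢ[ℝ] E) : E →L[ℝ] E) : E →ₗ[ℝ] E) = 
    (((ℝ ∙ (w - 0))ᗮ.reflection : E ≃ₗᵢ[ℝ] E).toLinearEquiv : E →ₗ[ℝ] E) := rfl
  rw [this, hd]
  simp

/-- Kelvin transform -/
noncomputable def kel (α : ℝ) (f : E → ℝ) (w : E) : ℝ := 
  ‖w‖ ^ (2 * α - (finrank ℝ E : ℝ)) * f (kinv w)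

lemma kel_at {α : ℝ} {f : E → ℝ} {x : E} (hx : ‖x‖ = 1) : kel α f x = f x := by
  simp [kel, kinv, hx]

lemma kel_J {α : ℝ} {f : E → ℝ} {x : E} [Nontrivial E] (hx : ‖x‖ = 1) {ε : ℝ} (hε : 0 < ε) :
    ∫ y, (kel α f (x + y) - kel α f x) * (‖y‖ ^ 2 / (‖y‖ ^ 2 + ε) * kerK E α y) ∂μ
    = ∫ y, (f (x + y) - f x * ‖x + y‖ ^ (2 * α - (finrank ℝ E : ℝ))) * 
        (‖y‖ ^ 2 / (‖y‖ ^ 2 + ε * ‖x + y‖ ^ 2) * kerK E α y) ∂μ := by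
  rw [← integral_sub_right_eq_self _ x]
  conv_rhs => rw [← integral_sub_right_eq_self _ x]
  rw [integral_kinv]
  refine integral_congr_ae ?_
  have h0 : ∀ᵐ w ∂μ, w ≠ 0 := by rw [ae_iff]; simp
  filter_upwards [h0] with w hw
  have hm : 0 < ‖w‖ := norm_pos_iff.2 hw
  have hx2 := kel_at (α := α) (f := f) hx
  simp only [add_sub_cancel]
  rw [hx2, kel, kinv_kinv, norm_kinv, kerK, kerK, norm_kinv_sub hx hw]
  set m := ‖w‖
  set ρ := ‖w - x‖
  set n := finrank ℝ E
  have hρ : 0 ≤ ρ := norm_nonneg _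
  have e1 : (ρ / m) ^ 2 / ((ρ / m) ^ 2 + ε) = ρ ^ 2 / (ρ ^ 2 + ε * m ^ 2) := by
    rw [div_pow]; field_simp
  rw [e1, Real.div_rpow hρ hm.le, Real.inv_rpow hm.le, Real.rpow_neg hm.le]
  have e2 : m ^ (2 * α - (n : ℝ)) = m ^ (2 * α) / m ^ n := by
    rw [Real.rpow_sub hm, Real.rpow_natCast]
  have e3 : m ^ ((n : ℝ) + 2 * α) = m ^ (2 * α) * m ^ n := by
    rw [Real.rpow_add hm, Real.rpow_natCast, mul_comm]
  rw [e2, e3]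
  have : 0 < m ^ (2 * α) := Real.rpow_pos_of_pos hm _
  have h4 : (m ^ 2)⁻¹ ^ n = (m ^ n)⁻¹ * (m ^ n)⁻¹ := by
    rw [inv_pow, ← pow_mul, mul_comm 2 n, pow_mul, sq, mul_inv]
  rw [h4]
  have : 0 < m ^ n := by positivity
  generalize ρ ^ 2 / (ρ ^ 2 + ε * m ^ 2) = A
  generalize ρ ^ (-((n : ℝ) + 2 * α)) = B
  field_simp

lemma kel_tendsto {α : ℝ} {f : E → ℝ} {x : E} [Nontrivial E] (hx : ‖x‖ = 1) 
    (hf : Good μ α f x) (h1 : Good μ α (kel α (fun _ => 1)) x) :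
    Tendsto (fun ε : ℝ => ∫ y, (kel α f (x + y) - kel α f x) * 
      (‖y‖ ^ 2 / (‖y‖ ^ 2 + ε) * kerK E α y) ∂μ)
      (𝓝[>] 0) (𝓝 ((1 / 2) * ∫ y, dl f x y * kerK E α y ∂μ - 
        f x * ((1 / 2) * ∫ y, dl (kel α (fun _ => 1)) x y * kerK E α y ∂μ))) := by
  refine Tendsto.congr' ?_ ((hf.tendsto_Jstar μ hx).sub ((h1.tendsto_Jstar μ hx).const_mul (f x)))
  filter_upwards [self_mem_nhdsWithin] with ε hε
  have hε' : 0 < ε := hε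
  rw [kel_J μ hx hε', ← integral_const_mul, ← integral_sub (hf.int_Jstar μ hx hε') 
    ((h1.int_Jstar μ hx hε').const_mul _)]
  congr 1; ext y
  rw [kel_at hx]
  simp only [kel, mul_one]
  ring

lemma kel_one {α : ℝ} {x : E} [Nontrivial E] (hx : ‖x‖ = 1) 
    (h0 : Good μ α (fun _ => (1 : ℝ)) x) (h1 : Good μ α (kel α (fun _ => 1)) x) :
    ∫ y, dl (kel α (fun _ => 1)) x y * kerK E α y ∂μ = 0 := by
  have a := tendsto_nhds_unique (h1.tendsto_J μ) (kel_tendsto μ hx h0 h1)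
  have : ∀ y, dl (fun _ : E => (1 : ℝ)) x y = 0 := by intro y; simp only [dl]; norm_num
  simp only [this, zero_mul, integral_zero] at a
  linarith

lemma kel_main {α : ℝ} {f : E → ℝ} {x : E} [Nontrivial E] (hx : ‖x‖ = 1) 
    (hf : Good μ α f x) (hkf : Good μ α (kel α f) x)
    (h0 : Good μ α (fun _ => (1 : ℝ)) x) (h1 : Good μ α (kel α (fun _ => 1)) x) :
    ∫ y, dl (kel α f) x y * kerK E α y ∂μ = ∫ y, dl f x y * kerK E α y ∂μ := by
  have a := tendsto_nhds_unique (hkf.tendsto_J μ) (kel_tendsto μ hx hf h1)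
  rw [kel_one μ hx h0 h1] at a
  linarith

lemma C2_bounds {f : E → ℝ} {x : E} (hc : ContDiffAt ℝ 2 f x) :
    ∃ r : ℝ, 0 < r ∧ r ≤ 1 ∧ ∃ L : ℝ, 0 ≤ L ∧ ∀ y, ‖y‖ < r → |f (x + y) - f x| ≤ L * ‖y‖ ∧
      |dl f x y| ≤ L * ‖y‖ ^ 2 := by
  obtain ⟨K, t, ht, hK⟩ := (hc.of_le one_le_two).exists_lipschitzOnWith
  obtain ⟨K', t', ht', hK'⟩ := 
    (hc.fderiv_right (m := 1) (by norm_num [one_add_one_eq_two])).exists_lipschitzOnWith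
  have hd : ∀ᶠ z in 𝓝 x, DifferentiableAt ℝ f z :=
    (hc.eventually (by simp)).mono fun z hz => hz.differentiableAt (by simp)
  obtain ⟨r, hr, hball⟩ := Metric.mem_nhds_iff.1 (inter_mem (inter_mem ht ht') hd)
  refine ⟨min r 1, by positivity, min_le_right _ _, K + 2 * K', by positivity, fun y hy => ?_⟩
  have hyr : ‖y‖ < r := hy.trans_le (min_le_left _ _)
  have hx0 : x ∈ Metric.ball x r := Metric.mem_ball_self hr
  have hxy : x + y ∈ Metric.ball x r := by simpa using hyr
  constructor
  · have := hK.dist_le_mul _ (hball hxy).1.1 _ (hball hx0).1.1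
    rw [Real.dist_eq, dist_eq_norm, add_sub_cancel_left] at this
    refine this.trans (mul_le_mul_of_nonneg_right ?_ (norm_nonneg _))
    have : (0 : ℝ) ≤ K' := K'.2
    linarith
  · have hsub : Metric.closedBall x ‖y‖ ⊆ Metric.ball x r := Metric.closedBall_subset_ball hyr
    have key : ∀ z ∈ Metric.closedBall x ‖y‖, 
        ‖f z - f x - fderiv ℝ f x (z - x)‖ ≤ (K' * ‖y‖) * ‖z - x‖ := by
      intro z hz
      refine Convex.norm_image_sub_le_of_norm_hasFDerivWithin_le' (f' := fderiv ℝ f) 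
        (s := Metric.closedBall x ‖y‖)
        (fun w hw => ?_) (fun w hw => ?_) (convex_closedBall _ _) 
        (Metric.mem_closedBall_self (norm_nonneg _)) hz
      · exact (show DifferentiableAt ℝ f w from (hball (hsub hw)).2).hasFDerivAt.hasFDerivWithinAt
      · have := hK'.dist_le_mul _ (hball (hsub hw)).1.2 _ (hball hx0).1.2
        rw [dist_eq_norm] at this
        exact this.trans (mul_le_mul_of_nonneg_left hw K'.2)
    have k1 := key (x + y) (by simp)
    have k2 := key (x - y) (by simp)
    rw [add_sub_cancel_left, Real.norm_eq_abs, abs_le] at k1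
    rw [sub_sub_cancel_left, norm_neg, map_neg, Real.norm_eq_abs, abs_le] at k2
    have hK0 : 0 ≤ (K : ℝ) * ‖y‖ ^ 2 := by positivity
    rw [dl, abs_le]
    constructor <;> nlinarith

lemma int_near [Nontrivial E] {β r : ℝ} (hβ : -(finrank ℝ E : ℝ) < β) :
    IntegrableOn (fun y : E => ‖y‖ ^ β) (Metric.ball 0 r) μ := by
  rcases le_or_gt r 0 with h | hr
  · simp [Metric.ball_eq_empty.2 h]
  rw [integrableOn_fun_norm_addHaar μ (f := fun t => t ^ β)]
  have hn : 0 < finrank ℝ E := finrank_pos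
  have := (intervalIntegral.integrableOn_Ioo_rpow_iff (s := (finrank ℝ E : ℝ) - 1 + β) hr).2 (by linarith)
  refine this.congr_fun (fun t ht => ?_) measurableSet_Ioo
  have ht0 : 0 < t := ht.1
  simp only [smul_eq_mul]
  rw [Real.rpow_add ht0, ← Real.rpow_natCast, Nat.cast_sub hn, Nat.cast_one]

lemma int_far [Nontrivial E] {a p : ℝ} (ha : -(finrank ℝ E : ℝ) < a) 
    (hp0 : 0 ≤ p) (hp : (finrank ℝ E : ℝ) + a < p) :
    Integrable (fun y : E => ‖y‖ ^ a * (1 + ‖y‖) ^ (-p)) μ := by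
  rw [integrable_fun_norm_addHaar μ (f := fun t => t ^ a * (1 + t) ^ (-p))]
  have hn : 0 < finrank ℝ E := finrank_pos
  have e : ∀ t : ℝ, 0 < t → t ^ (finrank ℝ E - 1) * t ^ a = t ^ ((finrank ℝ E : ℝ) - 1 + a) := by
    intro t ht
    rw [Real.rpow_add ht, ← Real.rpow_natCast, Nat.cast_sub hn, Nat.cast_one]
  have hu : Set.Ioi (0 : ℝ) = Set.Ioc 0 1 ∪ Set.Ioi 1 := (Set.Ioc_union_Ioi_eq_Ioi zero_le_one).symm
  rw [hu]
  have hmeas : Measurable (fun t : ℝ => t ^ (finrank ℝ E - 1) • (t ^ a * (1 + t) ^ (-p))) := by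
    fun_prop
  refine IntegrableOn.union ?_ ?_
  · have := (intervalIntegral.integrableOn_Ioo_rpow_iff (s := (finrank ℝ E : ℝ) - 1 + a) 
      (t := 1) one_pos).2 (by linarith)
    rw [← integrableOn_Ioc_iff_integrableOn_Ioo] at this
    refine Integrable.mono' this hmeas.aestronglyMeasurable ?_
    refine ae_restrict_of_forall_mem measurableSet_Ioc fun t ht => ?_
    have ht0 : 0 < t := ht.1
    rw [Real.norm_of_nonneg (by positivity), smul_eq_mul, ← mul_assoc, e t ht0]
    refine mul_le_of_le_one_right (by positivity) ?_
    exact Real.rpow_le_one_of_one_le_of_nonpos (by linarith) (by linarith)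
  · have := integrableOn_Ioi_rpow_of_lt (a := (finrank ℝ E : ℝ) - 1 + a - p) (by linarith) one_pos
    refine Integrable.mono' this hmeas.aestronglyMeasurable ?_
    refine ae_restrict_of_forall_mem measurableSet_Ioi fun t ht => ?_
    have ht0 : 0 < t := one_pos.trans ht
    rw [Real.norm_of_nonneg (by positivity), smul_eq_mul, ← mul_assoc, e t ht0, sub_eq_add_neg _ p,
      Real.rpow_add ht0 _ (-p)]
    refine mul_le_mul_of_nonneg_left ?_ (by positivity)
    exact Real.rpow_le_rpow_of_nonpos ht0 (by linarith) (by linarith)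

lemma kerK_far {α : ℝ} (hα : 0 < α) {x y : E} (hx : ‖x‖ ≤ 1) {r : ℝ} (hr : 0 < r) (hy : r ≤ ‖y‖) :
    kerK E α y ≤ (1 + 2 / r) ^ ((finrank ℝ E : ℝ) + 2 * α) * 
      (1 + ‖x + y‖) ^ (-((finrank ℝ E : ℝ) + 2 * α)) := by
  have hy0 : 0 < ‖y‖ := hr.trans_le hy
  have h1 : (1 + ‖x + y‖) / (1 + 2 / r) ≤ ‖y‖ := by
    rw [div_le_iff₀ (by positivity)]
    have := norm_add_le x y
    have h2 : 2 ≤ ‖y‖ * (2 / r) := by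
      rw [mul_div_assoc', le_div_iff₀ hr]; linarith
    linarith
  have h3 : 0 < (1 + ‖x + y‖) / (1 + 2 / r) := by positivity
  rw [kerK]
  refine (Real.rpow_le_rpow_of_nonpos h3 h1 (by have := Nat.cast_nonneg (α := ℝ) (finrank ℝ E); linarith)).trans ?_
  rw [Real.div_rpow (by positivity) (by positivity), Real.rpow_neg (x := 1 + 2 / r) (by positivity),
    div_inv_eq_mul, mul_comm]

lemma good_of [Nontrivial E] {α a : ℝ} (hα : 0 < α) (hα1 : α < 1) {f : E → ℝ} {x : E}
    (hx : ‖x‖ = 1) (hfm : Measurable f) (hb : ∀ w, |f w| ≤ ‖w‖ ^ a)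
    (ha1 : -(finrank ℝ E : ℝ) < a) (ha2 : a < 2 * α) (hc : ContDiffAt ℝ 2 f x) :
    Good μ α f x := by
  obtain ⟨r, hr, hr1, L, hL, hLy⟩ := C2_bounds hc
  set p : ℝ := (finrank ℝ E : ℝ) + 2 * α with hp
  have hn : (0 : ℝ) ≤ finrank ℝ E := Nat.cast_nonneg _
  have hp0 : 0 < p := by positivity
  have i1 : Integrable (fun y : E => (Metric.ball (0 : E) r).indicator (fun y => ‖y‖ ^ (2 - p)) y) μ :=
    (integrable_indicator_iff measurableSet_ball).2 (int_near μ (by linarith))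
  have i2 : Integrable (fun y : E => ‖x + y‖ ^ a * (1 + ‖x + y‖) ^ (-p)) μ :=
    (int_far μ (a := a) (p := p) ha1 hp0.le (by linarith)).comp_add_left x
  have i3 : Integrable (fun y : E => ‖x - y‖ ^ a * (1 + ‖x - y‖) ^ (-p)) μ :=
    (int_far μ (a := a) (p := p) ha1 hp0.le (by linarith)).comp_sub_left x
  have i4 : Integrable (fun y : E => (1 + ‖0 + y‖) ^ (-p)) μ := by
    simpa using integrable_one_add_norm (μ := μ) (E := E) (r := p) (by linarith)
  set C := (1 + 2 / r) ^ p with hC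
  have hC0 : 0 ≤ C := by positivity
  have itot := (i1.const_mul L).add (((i2.add i3).add (i4.const_mul (2 * |f x|))).const_mul C)
  have hmd : Measurable (fun y => dl f x y * kerK E α y) := by
    have := kerK_meas (E := E) α
    unfold dl; fun_prop
  have hmm : Measurable (fun y => (f (x + y) - f x) * (min 1 ‖y‖ * kerK E α y)) := by
    have := kerK_meas (E := E) α
    fun_prop
  have near : ∀ y : E, ‖y‖ < r → ∀ A : ℝ, |A| ≤ L * ‖y‖ ^ 2 → 
      |A * kerK E α y| ≤ L * ‖y‖ ^ (2 - p) := by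
    intro y hy A hA
    by_cases hy0 : y = 0
    · subst hy0
      have : A = 0 := by simpa using hA
      subst this; simp; positivity
    have hy' : 0 < ‖y‖ := norm_pos_iff.2 hy0
    rw [abs_mul, abs_of_nonneg (kerK_nonneg α y), sub_eq_add_neg, Real.rpow_add hy', ← mul_assoc]
    rw [kerK]
    refine mul_le_mul_of_nonneg_right ?_ (by positivity)
    simpa using hA
  have far : ∀ y : E, r ≤ ‖y‖ → (|f (x + y)| + |f (x - y)| + 2 * |f x|) * kerK E α y ≤
      C * (‖x + y‖ ^ a * (1 + ‖x + y‖) ^ (-p) + ‖x - y‖ ^ a * (1 + ‖x - y‖) ^ (-p) 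
        + 2 * |f x| * (1 + ‖0 + y‖) ^ (-p)) := by
    intro y hy
    have k1 := kerK_far hα hx.le hr hy
    have k2 := kerK_far hα hx.le hr (y := -y) (by simpa using hy)
    have k3 := kerK_far hα (x := (0 : E)) (by simp) hr hy
    rw [kerK_neg, ← sub_eq_add_neg] at k2
    rw [← hp, ← hC] at k1 k2 k3
    have q := kerK_nonneg α y
    have m1 := mul_le_mul (hb (x + y)) k1 q (by positivity)
    have m2 := mul_le_mul (hb (x - y)) k2 q (by positivity)
    have m3 := mul_le_mul_of_nonneg_left k3 (show 0 ≤ 2 * |f x| by positivity)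
    linarith
  have tot : ∀ y : E, ∀ A : ℝ, (‖y‖ < r → |A| ≤ L * ‖y‖ ^ 2) → 
      (|A| ≤ |f (x + y)| + |f (x - y)| + 2 * |f x|) → 
      ‖A * kerK E α y‖ ≤ L * (Metric.ball (0 : E) r).indicator (fun y => ‖y‖ ^ (2 - p)) y + 
      C * (‖x + y‖ ^ a * (1 + ‖x + y‖) ^ (-p) + ‖x - y‖ ^ a * (1 + ‖x - y‖) ^ (-p) 
        + 2 * |f x| * (1 + ‖0 + y‖) ^ (-p)) := by
    intro y A hA1 hA2
    rw [Real.norm_eq_abs]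
    by_cases hy : ‖y‖ < r
    · have := near y hy A (hA1 hy)
      rw [Set.indicator_of_mem (by simpa using hy)]
      have : 0 ≤ C * (‖x + y‖ ^ a * (1 + ‖x + y‖) ^ (-p) + ‖x - y‖ ^ a * (1 + ‖x - y‖) ^ (-p) 
        + 2 * |f x| * (1 + ‖0 + y‖) ^ (-p)) := by positivity
      linarith
    · rw [Set.indicator_of_notMem (by simpa using hy), mul_zero, zero_add]
      refine le_trans ?_ (far y (not_lt.1 hy))
      rw [abs_mul, abs_of_nonneg (kerK_nonneg α y)]
      exact mul_le_mul_of_nonneg_right hA2 (kerK_nonneg α y)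
  refine ⟨Integrable.mono' itot hmd.aestronglyMeasurable (Eventually.of_forall fun y => ?_), 
    Integrable.mono' itot hmm.aestronglyMeasurable (Eventually.of_forall fun y => ?_)⟩
  · refine tot y (dl f x y) (fun hy => (hLy y hy).2) ?_
    rw [dl]
    refine (abs_sub _ _).trans ?_
    rw [abs_mul, abs_two]
    gcongr
    exact abs_add_le _ _
  · rw [← mul_assoc]
    refine tot y _ (fun hy => ?_) ?_
    · rw [abs_mul, abs_of_nonneg (le_min zero_le_one (norm_nonneg y)), sq, ← mul_assoc]
      exact mul_le_mul (hLy y hy).1 (min_le_right _ _) (by positivity) (by positivity)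
    · rw [abs_mul, abs_of_nonneg (le_min zero_le_one (norm_nonneg y))]
      refine (mul_le_of_le_one_right (abs_nonneg _) (min_le_left _ _)).trans ?_
      refine (abs_sub _ _).trans ?_
      have := abs_nonneg (f x)
      have := abs_nonneg (f (x - y))
      linarith

lemma kel_contDiff {α : ℝ} {f : E → ℝ} {x : E} (hx : ‖x‖ = 1) (hc : ContDiffAt ℝ 2 f x) :
    ContDiffAt ℝ 2 (kel α f) x := by
  have hx0 : x ≠ 0 := by rintro rfl; simp at hx
  have hn : ContDiffAt ℝ 2 (fun w : E => ‖w‖) x := contDiffAt_norm ℝ hx0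
  have h1 : ContDiffAt ℝ 2 (fun w : E => ‖w‖ ^ (2 * α - (finrank ℝ E : ℝ))) x :=
    hn.rpow_const_of_ne (by simpa using hx0)
  have h2 : ContDiffAt ℝ 2 (kinv : E → E) x := by
    unfold kinv
    exact ((hn.pow 2).inv (by simpa using hx0)).smul contDiffAt_id
  have e : kinv x = x := by simp [kinv, hx]
  unfold kel
  exact h1.mul (ContDiffAt.comp x (by rw [e]; exact hc) h2)

lemma kel_meas {α : ℝ} {f : E → ℝ} (hf : Measurable f) : Measurable (kel α f) := by
  have : Measurable (kinv : E → E) := by unfold kinv; fun_prop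
  unfold kel; fun_prop

lemma kel_bound {α a : ℝ} {f : E → ℝ} (hf0 : f 0 = 0) (hb : ∀ w, |f w| ≤ ‖w‖ ^ a) (w : E) :
    |kel α f w| ≤ ‖w‖ ^ (2 * α - (finrank ℝ E : ℝ) - a) := by
  by_cases hw : w = 0
  · subst hw
    simp only [kel, kinv, smul_zero, hf0, mul_zero, abs_zero]
    exact Real.rpow_nonneg (norm_nonneg _) _
  have hw' : 0 < ‖w‖ := norm_pos_iff.2 hw
  have := hb (kinv w)
  rw [norm_kinv, Real.inv_rpow hw'.le] at this
  rw [kel, abs_mul, abs_of_nonneg (Real.rpow_nonneg (norm_nonneg w) _), Real.rpow_sub hw' _ a, div_eq_mul_inv]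
  exact mul_le_mul_of_nonneg_left this (Real.rpow_nonneg (norm_nonneg w) _)

lemma good_one [Nontrivial E] {α : ℝ} (hα : 0 < α) (hα1 : α < 1) {x : E} (hx : ‖x‖ = 1) :
    Good μ α (fun _ => (1 : ℝ)) x :=
  good_of μ (a := 0) hα hα1 hx measurable_const (by simp) 
    (by have := finrank_pos (R := ℝ) (M := E); simpa using this) (by linarith) contDiffAt_const

lemma good_kel_one [Nontrivial E] {α : ℝ} (hα : 0 < α) (hα1 : α < 1) {x : E} (hx : ‖x‖ = 1) :
    Good μ α (kel α (fun _ => (1 : ℝ))) x := by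
  have hn : (0 : ℝ) < finrank ℝ E := Nat.cast_pos.2 finrank_pos
  refine good_of μ (a := 2 * α - (finrank ℝ E : ℝ)) hα hα1 hx (kel_meas measurable_const) ?_ 
    (by linarith) (by linarith) (kel_contDiff hx contDiffAt_const)
  intro w
  simp only [kel, mul_one]
  rw [abs_of_nonneg (by positivity)]

lemma good_kel [Nontrivial E] {α a : ℝ} (hα : 0 < α) (hα1 : α < 1) {f : E → ℝ} {x : E}
    (hx : ‖x‖ = 1) (hfm : Measurable f) (hf0 : f 0 = 0) (hb : ∀ w, |f w| ≤ ‖w‖ ^ a)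
    (ha1 : -(finrank ℝ E : ℝ) < a) (ha2 : a < 2 * α) (hc : ContDiffAt ℝ 2 f x) :
    Good μ α (kel α f) x :=
  good_of μ (a := 2 * α - (finrank ℝ E : ℝ) - a) hα hα1 hx (kel_meas hfm) (kel_bound hf0 hb)
    (by linarith) (by linarith) (kel_contDiff hx hc)

end General

section OneDim

open Filter Topology Module

lemma Q_deriv_gt {α s : ℝ} (hα : 0 < α) (hs : 1 < s) :
    HasDerivAt (fun s : ℝ => (s ^ α - 1) ^ 2 * |s - 1| ^ (-(2 * α)) / (2 * α))
      ((s ^ α - 1) * (1 - s ^ (α - 1)) * |s - 1| ^ (-(1 + 2 * α))) s := by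
  have hs0 : 0 < s := by linarith
  have h1 : 0 < s - 1 := by linarith
  have hd : HasDerivAt (fun s : ℝ => (s ^ α - 1) ^ 2 * (s - 1) ^ (-(2 * α)) / (2 * α))
      ((s ^ α - 1) * (1 - s ^ (α - 1)) * (s - 1) ^ (-(1 + 2 * α))) s := by
    have a1 := ((Real.hasDerivAt_rpow_const (x := s) (p := α) (Or.inl hs0.ne')).sub_const 1).pow 2
    have a2 := ((hasDerivAt_id s).sub_const 1).rpow_const (p := -(2 * α)) (Or.inl h1.ne')
    refine ((a1.mul a2).div_const (2 * α)).congr_deriv ?_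
    simp only [id, Pi.pow_apply]
    have e1 : (s - 1) ^ (-(2 * α)) = (s - 1) ^ (-(1 + 2 * α)) * (s - 1) := by
      rw [← Real.rpow_add_one h1.ne']; congr 1; ring
    have e2 : (s - 1) ^ (-(2 * α) - 1) = (s - 1) ^ (-(1 + 2 * α)) := by congr 1; ring
    have e3 : s ^ α = s ^ (α - 1) * s := by
      rw [← Real.rpow_add_one hs0.ne']; congr 1; ring
    rw [e1, e2, e3]
    generalize (s - 1) ^ (-(1 + 2 * α)) = A
    generalize s ^ (α - 1) = B
    field_simp
    push_cast
    ring
  rw [abs_of_pos h1]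
  refine hd.congr_of_eventuallyEq ?_
  filter_upwards [lt_mem_nhds hs] with t ht
  rw [abs_of_pos (by linarith)]

lemma Q_deriv_lt {α s : ℝ} (hα : 0 < α) (hs0 : 0 < s) (hs : s < 1) :
    HasDerivAt (fun s : ℝ => -((s ^ α - 1) ^ 2 * |s - 1| ^ (-(2 * α)) / (2 * α)))
      ((s ^ α - 1) * (1 - s ^ (α - 1)) * |s - 1| ^ (-(1 + 2 * α))) s := by
  have h1 : 0 < 1 - s := by linarith
  have hd : HasDerivAt (fun s : ℝ => -((s ^ α - 1) ^ 2 * (1 - s) ^ (-(2 * α)) / (2 * α)))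
      ((s ^ α - 1) * (1 - s ^ (α - 1)) * (1 - s) ^ (-(1 + 2 * α))) s := by
    have a1 := ((Real.hasDerivAt_rpow_const (x := s) (p := α) (Or.inl hs0.ne')).sub_const 1).pow 2
    have a2 := ((hasDerivAt_id s).const_sub 1).rpow_const (p := -(2 * α)) (Or.inl h1.ne')
    refine (((a1.mul a2).div_const (2 * α)).neg).congr_deriv ?_
    simp only [id, Pi.pow_apply]
    have e1 : (1 - s) ^ (-(2 * α)) = (1 - s) ^ (-(1 + 2 * α)) * (1 - s) := by
      rw [← Real.rpow_add_one h1.ne']; congr 1; ring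
    have e2 : (1 - s) ^ (-(2 * α) - 1) = (1 - s) ^ (-(1 + 2 * α)) := by congr 1; ring
    have e3 : s ^ α = s ^ (α - 1) * s := by
      rw [← Real.rpow_add_one hs0.ne']; congr 1; ring
    rw [e1, e2, e3]
    generalize (1 - s) ^ (-(1 + 2 * α)) = A
    generalize s ^ (α - 1) = B
    field_simp
    push_cast
    ring
  rw [abs_sub_comm, abs_of_pos h1]
  refine hd.congr_of_eventuallyEq ?_
  filter_upwards [gt_mem_nhds hs] with t ht
  rw [abs_sub_comm, abs_of_pos (by linarith)]

lemma rpow_sub_one_le {α s : ℝ} (hα : 0 < α) (hα1 : α < 1) (hs : 0 ≤ s) : |s ^ α - 1| ≤ |s - 1| := by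
  rcases le_total s 1 with h | h
  · have h1 : s ^ α ≤ 1 := Real.rpow_le_one hs h hα.le
    have h2 : s ≤ s ^ α := Real.self_le_rpow_of_le_one hs h hα1.le
    rw [abs_of_nonpos (by linarith), abs_of_nonpos (by linarith)]; linarith
  · have h1 : 1 ≤ s ^ α := Real.one_le_rpow h hα.le
    have h2 : s ^ α ≤ s := Real.rpow_le_self_of_one_le h hα1.le
    rw [abs_of_nonneg (by linarith), abs_of_nonneg (by linarith)]; linarith

lemma Q_cont {α : ℝ} (hα : 0 < α) (hα1 : α < 1) :
    ContinuousOn (fun s : ℝ => (s ^ α - 1) ^ 2 * |s - 1| ^ (-(2 * α)) / (2 * α)) (Set.Ici 0) := by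
  refine ContinuousOn.div_const ?_ _
  intro s hs
  by_cases h1 : s = 1
  · subst h1
    have h0 : ((1 : ℝ) ^ α - 1) ^ 2 * |(1 : ℝ) - 1| ^ (-(2 * α)) = 0 := by simp
    rw [ContinuousWithinAt, h0]
    have lim : Tendsto (fun s : ℝ => |s - 1| ^ (2 - 2 * α)) (𝓝[Set.Ici 0] 1) (𝓝 0) := by
      have : ContinuousAt (fun s : ℝ => |s - 1| ^ (2 - 2 * α)) 1 :=
        ContinuousAt.rpow_const (by fun_prop) (Or.inr (by linarith))
      have h2 := this.tendsto
      simp only [sub_self, abs_zero] at h2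
      rw [Real.zero_rpow (by linarith)] at h2
      exact h2.mono_left nhdsWithin_le_nhds
    refine tendsto_of_tendsto_of_tendsto_of_le_of_le' tendsto_const_nhds lim ?_ ?_
    · exact Eventually.of_forall fun s => by positivity
    · filter_upwards [self_mem_nhdsWithin] with s hs
      have h3 := rpow_sub_one_le hα hα1 hs
      by_cases h1 : s = 1
      · subst h1; rw [h0]; positivity
      have h4 : 0 < |s - 1| := abs_pos.2 (sub_ne_zero.2 h1)
      rw [sub_eq_add_neg 2 (2 * α), Real.rpow_add h4]
      refine mul_le_mul_of_nonneg_right ?_ (by positivity)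
      rw [Real.rpow_two, sq_abs]
      exact sq_le_sq.2 h3
  · refine ContinuousAt.continuousWithinAt ?_
    refine ContinuousAt.mul ?_ (ContinuousAt.rpow_const (by fun_prop) (Or.inl ?_))
    · exact ((continuousAt_id.rpow_const (Or.inr hα.le)).sub continuousAt_const).pow 2
    · simpa [sub_eq_zero] using h1

lemma Q_lim {α : ℝ} (hα : 0 < α) :
    Tendsto (fun s : ℝ => (s ^ α - 1) ^ 2 * |s - 1| ^ (-(2 * α)) / (2 * α)) atTop (𝓝 (1 / (2 * α))) := by
  refine Tendsto.div_const ?_ _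
  have h1 : Tendsto (fun s : ℝ => s - 1) atTop atTop := tendsto_atTop_add_const_right _ _ tendsto_id
  have h2 : Tendsto (fun s : ℝ => (1 + (s - 1)⁻¹) ^ α - (s - 1) ^ (-α)) atTop (𝓝 ((1 + 0) ^ α - 0)) := by
    refine Tendsto.sub ?_ ((tendsto_rpow_neg_atTop hα).comp h1)
    exact (tendsto_const_nhds.add (tendsto_inv_atTop_zero.comp h1)).rpow_const (Or.inl (by norm_num))
  have h3 := h2.pow 2
  simp only [add_zero, Real.one_rpow, sub_zero, one_pow] at h3
  refine h3.congr' ?_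
  filter_upwards [eventually_gt_atTop 1] with s hs
  have p1 : 0 < s - 1 := by linarith
  have e : 1 + (s - 1)⁻¹ = s / (s - 1) := by field_simp; ring
  rw [e, abs_of_pos p1, Real.div_rpow (by linarith) p1.le, Real.rpow_neg p1.le, Real.rpow_neg p1.le,
    mul_comm 2 α, Real.rpow_mul p1.le, Real.rpow_two]
  have : 0 < (s - 1) ^ α := Real.rpow_pos_of_pos p1 _
  field_simp

lemma Q_nonneg {α s : ℝ} (hα : 0 < α) (hα1 : α < 1) (hs : 0 < s) :
    0 ≤ (s ^ α - 1) * (1 - s ^ (α - 1)) * |s - 1| ^ (-(1 + 2 * α)) := by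
  refine mul_nonneg ?_ (by positivity)
  rcases le_total s 1 with h | h
  · have h1 : s ^ α ≤ 1 := Real.rpow_le_one hs.le h hα.le
    have h2 : 1 ≤ s ^ (α - 1) := Real.one_le_rpow_of_pos_of_le_one_of_nonpos hs h (by linarith)
    nlinarith
  · have h1 : 1 ≤ s ^ α := Real.one_le_rpow h hα.le
    have h2 : s ^ (α - 1) ≤ 1 := Real.rpow_le_one_of_one_le_of_nonpos h (by linarith)
    nlinarith

lemma R_deriv {α s : ℝ} (hα : 0 < α) (hs : 0 < s) :
    HasDerivAt (fun s : ℝ => (s ^ (2 * α) * (1 + s) ^ (-(2 * α)) - (1 + s) ^ (-(2 * α))) / (2 * α))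
      ((1 + s ^ (2 * α - 1)) * (1 + s) ^ (-(1 + 2 * α))) s := by
  have h1 : 0 < 1 + s := by linarith
  have a1 := (Real.hasDerivAt_rpow_const (x := s) (p := 2 * α) (Or.inl hs.ne'))
  have a2 := ((hasDerivAt_id s).const_add 1).rpow_const (p := -(2 * α)) (Or.inl h1.ne')
  refine (((a1.mul a2).sub a2).div_const (2 * α)).congr_deriv ?_
  simp only [id]
  have e1 : (1 + s) ^ (-(2 * α)) = (1 + s) ^ (-(1 + 2 * α)) * (1 + s) := by
    rw [← Real.rpow_add_one h1.ne']; congr 1; ring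
  have e2 : (1 + s) ^ (-(2 * α) - 1) = (1 + s) ^ (-(1 + 2 * α)) := by congr 1; ring
  have e3 : s ^ (2 * α) = s ^ (2 * α - 1) * s := by
    rw [← Real.rpow_add_one hs.ne']; congr 1; ring
  rw [e1, e2, e3]
  generalize (1 + s) ^ (-(1 + 2 * α)) = A
  generalize s ^ (2 * α - 1) = B
  field_simp
  ring

lemma R_lim {α : ℝ} (hα : 0 < α) :
    Tendsto (fun s : ℝ => (s ^ (2 * α) * (1 + s) ^ (-(2 * α)) - (1 + s) ^ (-(2 * α))) / (2 * α))
      atTop (𝓝 (1 / (2 * α))) := by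
  refine Tendsto.div_const ?_ _
  have h1 : Tendsto (fun s : ℝ => 1 + s) atTop atTop := tendsto_atTop_add_const_left _ _ tendsto_id
  have h2 : Tendsto (fun s : ℝ => (1 - (1 + s)⁻¹) ^ (2 * α) - (1 + s) ^ (-(2 * α))) atTop 
      (𝓝 ((1 - 0) ^ (2 * α) - 0)) := by
    refine Tendsto.sub ?_ ((tendsto_rpow_neg_atTop (by linarith)).comp h1)
    exact (tendsto_const_nhds.sub (tendsto_inv_atTop_zero.comp h1)).rpow_const (Or.inl (by norm_num))
  simp only [Real.one_rpow, sub_zero] at h2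
  refine h2.congr' ?_
  filter_upwards [eventually_gt_atTop 0] with s hs
  have p1 : 0 < 1 + s := by linarith
  have e : 1 - (1 + s)⁻¹ = s / (1 + s) := by field_simp; ring
  rw [e, Real.div_rpow hs.le p1.le, Real.rpow_neg p1.le, div_eq_mul_inv]

/-- the combination in dimension one -/
lemma oneD_int {α : ℝ} (hα : 0 < α) (hα1 : α < 1) {G : ℝ → ℝ} 
    (hpos : ∀ s, 0 < s → G s = (s ^ α - 1) * (1 - s ^ (α - 1)))
    (hneg : ∀ s, 0 < s → G (-s) = -(1 + s ^ (2 * α - 1))) :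
    Integrable (fun s => G s * |s - 1| ^ (-(1 + 2 * α))) ∧ 
    ∫ s, G s * |s - 1| ^ (-(1 + 2 * α)) = 0 := by
  set H := fun s => G s * |s - 1| ^ (-(1 + 2 * α)) with hH
  have hc := Q_cont hα hα1
  have c1 : ContinuousWithinAt (fun s : ℝ => (s ^ α - 1) ^ 2 * |s - 1| ^ (-(2 * α)) / (2 * α)) 
      (Set.Ici 1) 1 := (hc 1 (Set.mem_Ici.2 zero_le_one)).mono (Set.Ici_subset_Ici.2 zero_le_one)
  have i1 := integrableOn_Ioi_deriv_of_nonneg c1 (fun s hs => Q_deriv_gt hα hs) 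
    (fun s hs => Q_nonneg hα hα1 (one_pos.trans hs)) (Q_lim hα)
  have v1 := integral_Ioi_of_hasDerivAt_of_nonneg c1 (fun s hs => Q_deriv_gt hα hs) 
    (fun s hs => Q_nonneg hα hα1 (one_pos.trans hs)) (Q_lim hα)
  have c2 : ContinuousOn (fun s : ℝ => -((s ^ α - 1) ^ 2 * |s - 1| ^ (-(2 * α)) / (2 * α))) 
      (Set.Icc 0 1) := (hc.mono Set.Icc_subset_Ici_self).neg
  have i2 := intervalIntegral.integrableOn_deriv_of_nonneg c2 
    (fun s hs => Q_deriv_lt hα hs.1 hs.2) (fun s hs => Q_nonneg hα hα1 hs.1)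
  have v2 := intervalIntegral.integral_eq_sub_of_hasDerivAt_of_le zero_le_one c2
    (fun s hs => Q_deriv_lt hα hs.1 hs.2) 
    ((intervalIntegrable_iff_integrableOn_Ioc_of_le zero_le_one).2 i2)
  rw [intervalIntegral.integral_of_le zero_le_one] at v2
  have c3 : ContinuousWithinAt (fun s : ℝ => (s ^ (2 * α) * (1 + s) ^ (-(2 * α)) - (1 + s) ^ (-(2 * α))) / (2 * α)) 
      (Set.Ici 0) 0 := by
    refine ContinuousAt.continuousWithinAt ?_
    have q1 : ContinuousAt (fun s : ℝ => (1 + s) ^ (-(2 * α))) 0 :=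
      ContinuousAt.rpow_const (by fun_prop) (Or.inl (by norm_num))
    have q2 : ContinuousAt (fun s : ℝ => s ^ (2 * α)) 0 :=
      continuousAt_id.rpow_const (Or.inr (by linarith))
    exact ((q2.mul q1).sub q1).div_const _
  have n3 : ∀ s ∈ Set.Ioi (0 : ℝ), 0 ≤ (1 + s ^ (2 * α - 1)) * (1 + s) ^ (-(1 + 2 * α)) := by
    intro s hs
    have hs' : 0 < s := hs
    positivity
  have i3 := integrableOn_Ioi_deriv_of_nonneg c3 (fun s hs => R_deriv hα hs) n3 (R_lim hα)
  have v3 := integral_Ioi_of_hasDerivAt_of_nonneg c3 (fun s hs => R_deriv hα hs) n3 (R_lim hα)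
  have h2α : 2 * α ≠ 0 := by linarith
  simp only [Real.one_rpow, sub_self, Real.zero_rpow hα.ne', Real.zero_rpow h2α, zero_sub, abs_neg, abs_one,
    zero_mul, mul_zero, add_zero, ne_eq, OfNat.ofNat_ne_zero, not_false_eq_true, zero_pow, zero_div, neg_zero,
    mul_one, even_two, Even.neg_pow, one_pow, sub_zero] at v1 v2 v3
  have e1 : Set.EqOn (fun s : ℝ => (s ^ α - 1) * (1 - s ^ (α - 1)) * |s - 1| ^ (-(1 + 2 * α))) H 
      (Set.Ioi 0) := fun s hs => by simp only [hH, hpos s hs]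
  have e1' := e1.mono (Set.Ioi_subset_Ioi zero_le_one)
  have e2' := e1.mono (show Set.Ioc (0 : ℝ) 1 ⊆ Set.Ioi 0 from fun s hs => hs.1)
  have e3 : Set.EqOn (fun s : ℝ => (1 + s ^ (2 * α - 1)) * (1 + s) ^ (-(1 + 2 * α))) 
      (fun s => - H (-s)) (Set.Ioi 0) := fun s hs => by
    have hs' : 0 < s := hs
    simp only [hH, hneg s hs]
    have : |-s - 1| = 1 + s := by rw [abs_of_nonpos (by linarith)]; ring
    rw [this]; ring
  have j1 : IntegrableOn H (Set.Ioi 1) := i1.congr_fun e1' measurableSet_Ioi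
  have j2 : IntegrableOn H (Set.Ioc 0 1) := i2.congr_fun e2' measurableSet_Ioc
  have j3 : IntegrableOn (fun s => - H (-s)) (Set.Ioi 0) := i3.congr_fun e3 measurableSet_Ioi
  rw [setIntegral_congr_fun measurableSet_Ioi e1'] at v1
  rw [setIntegral_congr_fun measurableSet_Ioc e2'] at v2
  rw [setIntegral_congr_fun measurableSet_Ioi e3, integral_neg] at v3
  have j3' : IntegrableOn H (Set.Iic 0) := by
    rw [integrableOn_Iic_iff_integrableOn_Iio]
    have h4 := (Measure.measurePreserving_neg (volume : Measure ℝ)).integrableOn_comp_preimage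
      (f := H) (s := Set.Iio 0) (MeasurableEquiv.neg ℝ).measurableEmbedding
    rw [← h4]
    have h5 : (Neg.neg : ℝ → ℝ) ⁻¹' (Set.Iio 0) = Set.Ioi 0 := by ext; simp
    rw [h5]
    simpa [Function.comp_def] using j3
  have v3' : ∫ s in Set.Iic 0, H s = -(1 / (2 * α) - -1 / (2 * α)) := by
    rw [integral_comp_neg_Ioi, neg_zero] at v3
    linarith
  have j12 : IntegrableOn H (Set.Ioi 0) := by
    rw [← Set.Ioc_union_Ioi_eq_Ioi zero_le_one]; exact j2.union j1
  have v12 : ∫ s in Set.Ioi 0, H s = 1 / (2 * α) + 1 / (2 * α) := by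
    rw [← Set.Ioc_union_Ioi_eq_Ioi (zero_le_one (α := ℝ)), 
      setIntegral_union (Set.Ioc_disjoint_Ioi le_rfl) measurableSet_Ioi j2 j1, v1, v2]
    ring
  constructor
  · rw [← integrableOn_univ, ← Set.Iic_union_Ioi (a := (0 : ℝ))]; exact j3'.union j12
  · rw [← intervalIntegral.integral_Iic_add_Ioi j3' j12, v3', v12]; ring

end OneDim

section OneDimB

open Filter Topology Module

lemma phi_bound {α t r : ℝ} (hα : 0 < α) (h : |t| ≤ r) : |max t 0 ^ α| ≤ r ^ α := by
  have h0 : 0 ≤ max t 0 := le_max_right _ _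
  rw [abs_of_nonneg (Real.rpow_nonneg h0 _)]
  exact Real.rpow_le_rpow h0 (max_le ((le_abs_self t).trans h) ((abs_nonneg t).trans h)) hα.le

lemma oneD_zero {α : ℝ} (hα : 0 < α) (hα1 : α < 1) :
    Good volume α (fun t : ℝ => max t 0 ^ α) 1 ∧
    ∫ y, dl (fun t : ℝ => max t 0 ^ α) 1 y * kerK ℝ α y = 0 := by
  set φ : ℝ → ℝ := fun t : ℝ => max t 0 ^ α with hφ
  have hx : ‖(1 : ℝ)‖ = 1 := by simp
  have hφm : Measurable φ := by fun_prop
  have hφ0 : φ 0 = 0 := by simp [hφ, hα.ne']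
  have hφ1 : φ 1 = 1 := by simp [hφ]
  have hb : ∀ w, |φ w| ≤ ‖w‖ ^ α := fun w => phi_bound hα le_rfl
  have ha1 : -(finrank ℝ ℝ : ℝ) < α := by simp; linarith
  have hc : ContDiffAt ℝ 2 φ 1 := by
    have h1 : ContDiffAt ℝ 2 (fun t : ℝ => t ^ α) 1 := 
      Real.contDiffAt_rpow_const_of_ne one_ne_zero
    refine h1.congr_of_eventuallyEq ?_
    filter_upwards [lt_mem_nhds (zero_lt_one' ℝ)] with t ht
    simp only [hφ]; rw [max_eq_left ht.le]
  have g1 := good_of volume hα hα1 hx hφm hb ha1 (by linarith) hc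
  have g2 := good_kel volume hα hα1 hx hφm hφ0 hb ha1 (by linarith) hc
  have g3 := good_one (E := ℝ) volume hα hα1 hx
  have g4 := good_kel_one (E := ℝ) volume hα hα1 hx
  refine ⟨g1, ?_⟩
  have e1 := kel_one volume hx g3 g4
  have e2 := kel_main volume hx g1 g2 g3 g4
  have L := ((g1.tendsto_J volume).add (g2.tendsto_J volume)).sub (g4.tendsto_J volume)
  rw [e1, e2] at L
  set G : ℝ → ℝ := fun s => φ s + kel α φ s - 1 - kel α (fun _ => (1 : ℝ)) s with hG
  obtain ⟨hi, hz⟩ := oneD_int (G := G) hα hα1 (by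
    intro s hs
    have h1 : φ s = s ^ α := by simp only [hφ]; rw [max_eq_left hs.le]
    have h2 : kinv s = s⁻¹ := by simp [kinv]; field_simp
    have h3 : φ s⁻¹ = s ^ (-α) := by
      simp only [hφ]; rw [max_eq_left (inv_pos.2 hs).le, Real.rpow_neg hs.le, Real.inv_rpow hs.le]
    simp only [hG, kel, h1, h2, h3, finrank_self, Real.norm_eq_abs, abs_of_pos hs, Nat.cast_one, mul_one]
    have q1 : s ^ (2 * α - 1 + -α) = s ^ (α - 1) := by congr 1; ring
    have q2 : s ^ (2 * α - 1) = s ^ α * s ^ (α - 1) := by rw [← Real.rpow_add hs]; congr 1; ring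
    rw [← Real.rpow_add hs, q1, q2]
    ring) (by
    intro s hs
    have h1 : φ (-s) = 0 := by simp only [hφ]; rw [max_eq_right (by linarith), Real.zero_rpow hα.ne']
    have h2 : kinv (-s) = -s⁻¹ := by simp [kinv]; field_simp
    have h3 : φ (-s⁻¹) = 0 := by
      have := inv_pos.2 hs
      simp only [hφ]; rw [max_eq_right (by linarith), Real.zero_rpow hα.ne']
    simp only [hG, kel, h1, h2, h3, finrank_self, Real.norm_eq_abs, abs_neg, abs_of_pos hs, Nat.cast_one]
    ring)
  have hk : ∀ y : ℝ, kerK ℝ α y = |1 + y - 1| ^ (-(1 + 2 * α)) := by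
    intro y; simp [kerK]
  have hi' : Integrable (fun y => G (1 + y) * kerK ℝ α y) := by
    have := hi.comp_add_left 1
    simpa only [hk] using this
  have hz' : ∫ y, G (1 + y) * kerK ℝ α y = 0 := by
    rw [← hz, ← integral_add_left_eq_self (fun s => G s * |s - 1| ^ (-(1 + 2 * α))) 1]
    simp only [hk]
  have L2 : Tendsto (fun ε : ℝ => ∫ y, (‖y‖ ^ 2 / (‖y‖ ^ 2 + ε)) * (G (1 + y) * kerK ℝ α y))
      (𝓝[>] 0) (𝓝 (∫ y, G (1 + y) * kerK ℝ α y)) := by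
    refine tendsto_integral_filter_of_dominated_convergence (fun y => ‖G (1 + y) * kerK ℝ α y‖) ?_ ?_
      hi'.norm ?_
    · refine Eventually.of_forall fun ε => ?_
      exact (Measurable.aestronglyMeasurable (by fun_prop)).mul hi'.1
    · filter_upwards [self_mem_nhdsWithin] with ε hε
      refine Eventually.of_forall fun y => ?_
      have hε : 0 < ε := hε
      rw [norm_mul]
      refine mul_le_of_le_one_left (norm_nonneg _) ?_
      rw [Real.norm_of_nonneg (by positivity)]
      exact div_le_one_of_le₀ (by linarith) (by positivity)
    · have h0 : ∀ᵐ y : ℝ, y ≠ 0 := by simp [ae_iff]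
      filter_upwards [h0] with y hy
      have hy' : ‖y‖ ^ 2 ≠ 0 := by simpa using hy
      have : Tendsto (fun ε : ℝ => ‖y‖ ^ 2 / (‖y‖ ^ 2 + ε)) (𝓝 0) (𝓝 (‖y‖ ^ 2 / (‖y‖ ^ 2 + 0))) :=
        tendsto_const_nhds.div (tendsto_const_nhds.add tendsto_id) (by simpa using hy')
      rw [add_zero, div_self hy'] at this
      simpa using (this.mono_left nhdsWithin_le_nhds).mul_const (G (1 + y) * kerK ℝ α y)
  have e3 : ∀ᶠ ε : ℝ in 𝓝[>] 0, ∫ y : ℝ, (‖y‖ ^ 2 / (‖y‖ ^ 2 + ε)) * (G (1 + y) * kerK ℝ α y)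
      = (∫ y : ℝ, (φ (1 + y) - φ 1) * (‖y‖ ^ 2 / (‖y‖ ^ 2 + ε) * kerK ℝ α y))
       + (∫ y : ℝ, (kel α φ (1 + y) - kel α φ (1 : ℝ)) * (‖y‖ ^ 2 / (‖y‖ ^ 2 + ε) * kerK ℝ α y))
       - ∫ y : ℝ, (kel α (fun _ => (1 : ℝ)) (1 + y) - kel α (fun _ => (1 : ℝ)) (1 : ℝ)) * (‖y‖ ^ 2 / (‖y‖ ^ 2 + ε) * kerK ℝ α y) := by
    filter_upwards [self_mem_nhdsWithin] with ε hε
    have hε : 0 < ε := hε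
    have hm : Measurable (fun y : ℝ => ‖y‖ ^ 2 / (‖y‖ ^ 2 + ε)) := by fun_prop
    have hbd : ∀ y : ℝ, |‖y‖ ^ 2 / (‖y‖ ^ 2 + ε)| ≤ (1 + 1 / ε) * min 1 ‖y‖ := 
      fun y => reg_bound hε (norm_nonneg y)
    have i1 := g1.int_J hm hbd
    have i2 := g2.int_J hm hbd
    have i4 := g4.int_J hm hbd
    have i12 := integral_sub (i1.add i2) i4
    have i12' := integral_add i1 i2
    rw [← i12']
    refine Eq.trans ?_ i12
    congr 1; ext y
    simp only [hG, Pi.add_apply]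
    rw [kel_at hx, kel_at hx, hφ1]
    ring
  have := tendsto_nhds_unique (L2.congr' e3) L
  rw [hz'] at this
  have t : ∀ A : ℝ, 0 = (1 / 2 * A + 1 / 2 * A) - 1 / 2 * 0 → A = 0 := by intro A h; linarith
  exact t _ this

end OneDimB

section Polar

open Filter Topology Module

lemma polar_zero {E : Type*} [NormedAddCommGroup E] [NormedSpace ℝ E] [FiniteDimensional ℝ E]
    [MeasurableSpace E] [BorelSpace E] [Nontrivial E] (μ : Measure E) [μ.IsAddHaarMeasure] (F : E → ℝ)
    (h : ∀ n : E, ∫ r in Set.Ioi (0 : ℝ), r ^ (finrank ℝ E - 1) * F (r • n) = 0) :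
    ∫ y, F y ∂μ = 0 := by
  set H : (Metric.sphere (0 : E) 1) × Set.Ioi (0 : ℝ) → ℝ := fun p => F ((p.2 : ℝ) • (p.1 : E)) with hH
  have e1 : ∫ y, F y ∂μ = ∫ y : ({(0)}ᶜ : Set E), F y ∂(μ.comap (↑)) := by
    rw [integral_subtype_comap (measurableSet_singleton _).compl F,
        restrict_compl_singleton]
  have e2 : ∫ y : ({(0)}ᶜ : Set E), F y ∂(μ.comap (↑)) 
      = ∫ p, H p ∂μ.toSphere.prod (.volumeIoiPow (finrank ℝ E - 1)) := by
    rw [← μ.measurePreserving_homeomorphUnitSphereProd.integral_comp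
        (Homeomorph.measurableEmbedding _) H]
    congr 1; ext y
    have : ((homeomorphUnitSphereProd E).symm (homeomorphUnitSphereProd E y) : E) = y := by simp
    rw [homeomorphUnitSphereProd_symm_apply_coe] at this
    simp only [hH]
    rw [this]
  rw [e1, e2]
  by_cases hi : Integrable H (μ.toSphere.prod (.volumeIoiPow (finrank ℝ E - 1)))
  swap
  · exact integral_undef hi
  rw [integral_prod _ hi]
  have : ∀ n : Metric.sphere (0 : E) 1, 
      ∫ r, H (n, r) ∂(Measure.volumeIoiPow (finrank ℝ E - 1)) = 0 := by
    intro n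
    simp only [Measure.volumeIoiPow, ENNReal.ofReal, hH]
    rw [integral_withDensity_eq_integral_smul,
      integral_subtype_comap measurableSet_Ioi fun a : ℝ ↦ 
        Real.toNNReal (a ^ (finrank ℝ E - 1)) • F (a • (n : E))]
    · refine Eq.trans ?_ (h n)
      refine setIntegral_congr_fun measurableSet_Ioi fun x hx ↦ ?_
      simp only [NNReal.smul_def, Real.coe_toNNReal _ (pow_nonneg (Set.mem_Ioi.1 hx).le _), smul_eq_mul]
    · exact (measurable_subtype_coe.pow_const _).real_toNNReal
  simp [this]

lemma ray_zero {α c : ℝ} (hα : 0 < α) (hα1 : α < 1) (hc : 0 < c) (τ : ℝ) :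
    ∫ r in Set.Ioi (0 : ℝ), (max (c + r * τ) 0 ^ α + max (c - r * τ) 0 ^ α - 2 * max c 0 ^ α)
      * r ^ (-(1 + 2 * α)) = 0 := by
  set g : ℝ → ℝ := fun r => (max (1 + r) 0 ^ α + max (1 - r) 0 ^ α - 2 * max 1 0 ^ α)
      * r ^ (-(1 + 2 * α)) with hg
  have h0 : ∫ r in Set.Ioi (0 : ℝ), g r = 0 := by
    have h1 := (oneD_zero hα hα1).2
    have h2 := integral_comp_abs (f := g)
    have h3 : ∫ y, g |y| = 0 := by
      rw [← h1]
      congr 1; ext y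
      simp only [hg, dl, kerK, finrank_self, Nat.cast_one, Real.norm_eq_abs]
      congr 1
      rcases abs_choice y with h | h
      · rw [h]
      · rw [h, sub_neg_eq_add, ← sub_eq_add_neg]; ring
    linarith
  have pos : ∀ τ : ℝ, 0 < τ → ∫ r in Set.Ioi (0 : ℝ), 
      (max (c + r * τ) 0 ^ α + max (c - r * τ) 0 ^ α - 2 * max c 0 ^ α)
      * r ^ (-(1 + 2 * α)) = 0 := by
    intro τ hτ
    have hb : 0 < τ / c := by positivity
    have h1 := integral_comp_mul_left_Ioi g 0 hb
    rw [mul_zero, h0, smul_zero] at h1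
    have sc : ∀ t : ℝ, max (c * t) 0 ^ α = c ^ α * max t 0 ^ α := by
      intro t
      rw [← Real.mul_rpow hc.le (le_max_right _ _), mul_max_of_nonneg _ _ hc.le, mul_zero]
    have h2 : ∀ r ∈ Set.Ioi (0 : ℝ), 
      (max (c + r * τ) 0 ^ α + max (c - r * τ) 0 ^ α - 2 * max c 0 ^ α) * r ^ (-(1 + 2 * α))
        = (c ^ α * (τ / c) ^ (1 + 2 * α)) * g (τ / c * r) := by
      intro r hr
      have hr : 0 < r := hr
      have a1 : c + r * τ = c * (1 + τ / c * r) := by field_simp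
      have a2 : c - r * τ = c * (1 - τ / c * r) := by field_simp
      have a3 : max c 0 ^ α = c ^ α * max 1 0 ^ α := by rw [← sc, mul_one]
      have a4 : (τ / c) ^ (1 + 2 * α) * (τ / c * r) ^ (-(1 + 2 * α)) = r ^ (-(1 + 2 * α)) := by
        rw [Real.mul_rpow hb.le hr.le, ← mul_assoc, ← Real.rpow_add hb, add_neg_cancel, Real.rpow_zero, one_mul]
      rw [a1, a2, a3, sc, sc, ← a4]
      simp only [hg]
      ring
    rw [setIntegral_congr_fun measurableSet_Ioi h2, integral_const_mul, h1, mul_zero]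
  rcases lt_trichotomy τ 0 with h | h | h
  · refine Eq.trans ?_ (pos (-τ) (by linarith))
    refine setIntegral_congr_fun measurableSet_Ioi fun r hr ↦ ?_
    simp only [mul_neg, sub_neg_eq_add, ← sub_eq_add_neg]
    ring
  · subst h
    have : ∀ r : ℝ, (max (c + r * 0) 0 ^ α + max (c - r * 0) 0 ^ α - 2 * max c 0 ^ α) = 0 := by
      intro r; simp only [mul_zero, add_zero, sub_zero]; ring
    simp only [this, zero_mul, integral_zero]
  · exact pos τ h

end Polar

section Final

open Filter Topology Module

lemma unit_case {N : ℕ} (i : Fin N) {α : ℝ} (hα : 0 < α) (hα1 : α < 1)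
    {x : EuclideanSpace ℝ (Fin N)} (hx : ‖x‖ = 1) (hxi : 0 < x i) :
    Integrable (fun y => dl (kel α (fun w : EuclideanSpace ℝ (Fin N) => max (w i) 0 ^ α)) x y
      * kerK (EuclideanSpace ℝ (Fin N)) α y) ∧
    ∫ y, dl (kel α (fun w : EuclideanSpace ℝ (Fin N) => max (w i) 0 ^ α)) x y
      * kerK (EuclideanSpace ℝ (Fin N)) α y = 0 := by
  have hN : 0 < N := i.pos
  have hfr : finrank ℝ (EuclideanSpace ℝ (Fin N)) = N := by simp
  have : Nontrivial (EuclideanSpace ℝ (Fin N)) := 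
    Module.nontrivial_of_finrank_pos (R := ℝ) (by rw [hfr]; exact hN)
  set v : EuclideanSpace ℝ (Fin N) → ℝ := fun w => max (w i) 0 ^ α with hv
  have hvm : Measurable v := by fun_prop
  have hv0 : v 0 = 0 := by simp [hv, hα.ne']
  have hb : ∀ w, |v w| ≤ ‖w‖ ^ α := fun w => phi_bound hα (PiLp.norm_apply_le w i)
  have ha1 : -(finrank ℝ (EuclideanSpace ℝ (Fin N)) : ℝ) < α := by 
    have : (0 : ℝ) ≤ (finrank ℝ (EuclideanSpace ℝ (Fin N)) : ℝ) := Nat.cast_nonneg _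
    linarith
  have hc : ContDiffAt ℝ 2 v x := by
    have h0 : ContDiffAt ℝ 2 (fun w : EuclideanSpace ℝ (Fin N) => w i) x := 
      (EuclideanSpace.proj i : EuclideanSpace ℝ (Fin N) →L[ℝ] ℝ).contDiff.contDiffAt
    have h1 : ContDiffAt ℝ 2 (fun w : EuclideanSpace ℝ (Fin N) => (w i) ^ α) x := 
      h0.rpow_const_of_ne hxi.ne'
    refine h1.congr_of_eventuallyEq ?_
    filter_upwards [h0.continuousAt.eventually (lt_mem_nhds hxi)] with w hw
    simp only [hv]; rw [max_eq_left hw.le]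
  have g1 := good_of volume hα hα1 hx hvm hb ha1 (by linarith) hc
  have g2 := good_kel volume hα hα1 hx hvm hv0 hb ha1 (by linarith) hc
  have g3 := good_one (E := EuclideanSpace ℝ (Fin N)) volume hα hα1 hx
  have g4 := good_kel_one (E := EuclideanSpace ℝ (Fin N)) volume hα hα1 hx
  refine ⟨g2.d, ?_⟩
  rw [kel_main volume hx g1 g2 g3 g4]
  refine polar_zero volume _ fun n => ?_
  by_cases hn : n = 0
  · subst hn
    have : dl v x 0 = 0 := by simp only [dl, add_zero, sub_zero]; ring
    simp [this]
  have hn' : 0 < ‖n‖ := norm_pos_iff.2 hn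
  have hray := ray_zero hα hα1 hxi (n i)
  have : ∀ r ∈ Set.Ioi (0 : ℝ), r ^ (finrank ℝ (EuclideanSpace ℝ (Fin N)) - 1) * 
      (dl v x (r • n) * kerK (EuclideanSpace ℝ (Fin N)) α (r • n)) =
      ‖n‖ ^ (-((N : ℝ) + 2 * α)) * ((max (x i + r * n i) 0 ^ α + max (x i - r * n i) 0 ^ α - 2 * max (x i) 0 ^ α)
      * r ^ (-(1 + 2 * α))) := by
    intro r hr
    have hr : 0 < r := hr
    have e : r ^ (N - 1) * r ^ (-((N : ℝ) + 2 * α)) = r ^ (-(1 + 2 * α)) := by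
      rw [← Real.rpow_natCast, ← Real.rpow_add hr, Nat.cast_sub hN]
      congr 1; push_cast; ring
    simp only [dl, kerK, hfr, hv, norm_smul, Real.norm_of_nonneg hr.le, PiLp.add_apply, PiLp.sub_apply,
      PiLp.smul_apply, smul_eq_mul]
    rw [Real.mul_rpow hr.le hn'.le, ← e]
    ring
  rw [setIntegral_congr_fun measurableSet_Ioi this, integral_const_mul, hray, mul_zero]

lemma u_eq {N : ℕ} (i : Fin N) {α : ℝ} (hα : 0 < α) (z : EuclideanSpace ℝ (Fin N)) :
    (if z = 0 then 0 else max (z i) 0 ^ α * ‖z‖ ^ (-(N : ℝ))) = 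
      kel α (fun w : EuclideanSpace ℝ (Fin N) => max (w i) 0 ^ α) z := by
  split_ifs with h
  · subst h; simp [kel, kinv, hα.ne']
  have hz : 0 < ‖z‖ := norm_pos_iff.2 h
  have h2 : 0 ≤ (‖z‖ ^ 2)⁻¹ := by positivity
  have e1 : max ((‖z‖ ^ 2)⁻¹ * z i) 0 = (‖z‖ ^ 2)⁻¹ * max (z i) 0 := by
    rw [mul_max_of_nonneg _ _ h2, mul_zero]
  have e2 : ((‖z‖ ^ 2)⁻¹) ^ α = ‖z‖ ^ (-(2 * α)) := by
    rw [Real.rpow_neg hz.le, Real.inv_rpow (by positivity), Real.rpow_mul hz.le, Real.rpow_two]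
  simp only [kel, kinv, PiLp.smul_apply, smul_eq_mul, e1, finrank_euclideanSpace, Fintype.card_fin]
  rw [Real.mul_rpow h2 (le_max_right _ _), e2, ← mul_assoc, ← Real.rpow_add hz, mul_comm]
  congr 2; ring

lemma u_smul {N : ℕ} (i : Fin N) {α l : ℝ} (hl : 0 < l) (z : EuclideanSpace ℝ (Fin N)) :
    kel α (fun w : EuclideanSpace ℝ (Fin N) => max (w i) 0 ^ α) (l • z) = 
      l ^ (α - N) * kel α (fun w : EuclideanSpace ℝ (Fin N) => max (w i) 0 ^ α) z := by
  have h2 : 0 ≤ l⁻¹ := by positivity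
  have e0 : (‖l • z‖ ^ 2)⁻¹ * (l * z i) = l⁻¹ * ((‖z‖ ^ 2)⁻¹ * z i) := by
    rw [norm_smul, Real.norm_of_nonneg hl.le]
    by_cases hz : ‖z‖ = 0
    · simp [hz]
    · field_simp
  have e1 : max (l⁻¹ * ((‖z‖ ^ 2)⁻¹ * z i)) 0 = l⁻¹ * max ((‖z‖ ^ 2)⁻¹ * z i) 0 := by
    rw [mul_max_of_nonneg _ _ h2, mul_zero]
  have e2 : l⁻¹ ^ α = l ^ (-α) := by rw [Real.rpow_neg hl.le, Real.inv_rpow hl.le]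
  simp only [kel, kinv, PiLp.smul_apply, smul_eq_mul, e0, e1, finrank_euclideanSpace, Fintype.card_fin]
  rw [Real.mul_rpow h2 (le_max_right _ _), e2, norm_smul, Real.norm_of_nonneg hl.le, 
    Real.mul_rpow hl.le (norm_nonneg _)]
  have e3 : l ^ (α - N) = l ^ (2 * α - N) * l ^ (-α) := by
    rw [← Real.rpow_add hl]; congr 1; ring
  rw [e3]; ring

end Final

/-- The Kelvin image `u(x) = (x_N)₊^α |x|^{-N}` (with `u(0)=0`) is α-harmonic
in the half-space `{x_N > 0}`. -/
theorem kelvin_image_alpha_harmonic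
    (N : ℕ) (hN : 2 ≤ N) (α : ℝ) (hα : α ∈ Set.Ioo (0 : ℝ) 1) :
    ∀ x : EuclideanSpace ℝ (Fin N), 0 < x ⟨N - 1, by omega⟩ →
      Integrable (fun y => nlD
          (fun z => if z = 0 then 0
            else max (z ⟨N - 1, by omega⟩) 0 ^ α * ‖z‖ ^ (-(N : ℝ))) x y
          * ‖y‖ ^ (-((N : ℝ) + 2 * α))) ∧
      ∫ y, nlD
          (fun z => if z = 0 then 0
            else max (z ⟨N - 1, by omega⟩) 0 ^ α * ‖z‖ ^ (-(N : ℝ))) x y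
          * ‖y‖ ^ (-((N : ℝ) + 2 * α)) = 0 := by
  obtain ⟨hα0, hα1⟩ := hα
  intro x hxi
  set i : Fin N := ⟨N - 1, by omega⟩ with hi
  simp only [u_eq i hα0]
  set u := kel α (fun w : EuclideanSpace ℝ (Fin N) => max (w i) 0 ^ α) with hu
  have hx0 : x ≠ 0 := by rintro rfl; simp at hxi
  have hl : 0 < ‖x‖ := norm_pos_iff.2 hx0
  set l := ‖x‖ with hldef
  have hx1 : ‖l⁻¹ • x‖ = 1 := by
    rw [norm_smul, norm_inv, Real.norm_of_nonneg hl.le, ← hldef, inv_mul_cancel₀ hl.ne']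
  have hx1i : 0 < (l⁻¹ • x) i := by
    rw [PiLp.smul_apply, smul_eq_mul]; positivity
  obtain ⟨h1, h2⟩ := unit_case i hα0 hα1 hx1 hx1i
  rw [← hu] at h1 h2
  have hxx : x = l • (l⁻¹ • x) := by rw [smul_smul, mul_inv_cancel₀ hl.ne', one_smul]
  have key : ∀ y : EuclideanSpace ℝ (Fin N), nlD u x (l • y) * ‖l • y‖ ^ (-((N : ℝ) + 2 * α))
      = (l ^ (α - N) * l ^ (-((N : ℝ) + 2 * α))) * 
        (dl u (l⁻¹ • x) y * kerK (EuclideanSpace ℝ (Fin N)) α y) := by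
    intro y
    have a1 : u (x + l • y) = l ^ (α - N) * u (l⁻¹ • x + y) := by
      rw [hu, ← u_smul i hl, smul_add, ← hxx]
    have a2 : u (x - l • y) = l ^ (α - N) * u (l⁻¹ • x - y) := by
      rw [hu, ← u_smul i hl, smul_sub, ← hxx]
    have a3 : u x = l ^ (α - N) * u (l⁻¹ • x) := by
      rw [hu, ← u_smul i hl, ← hxx]
    simp only [nlD, dl, kerK, finrank_euclideanSpace, Fintype.card_fin, a1, a2, a3]
    rw [norm_smul, Real.norm_of_nonneg hl.le, Real.mul_rpow hl.le (norm_nonneg _)]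
    ring
  constructor
  · rw [← integrable_comp_smul_iff volume _ hl.ne']
    simp only [key]
    exact h1.const_mul _
  · have h3 := Measure.integral_comp_smul volume 
      (fun y => nlD u x y * ‖y‖ ^ (-((N : ℝ) + 2 * α))) l
    simp only [key] at h3
    rw [integral_const_mul, h2, mul_zero] at h3
    have h4 := h3.symm
    rw [smul_eq_mul, mul_eq_zero] at h4
    refine h4.resolve_left ?_
    refine abs_ne_zero.2 ?_
    positivity
end
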